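/- H is a nontrivial cyclic group (equivalently r₂(H) = 1) if and only if n has one of the following forms, where p denotes a prime ≡ 1 (mod 4), q, q₁, q₂ distinct primes ≡ 3 (mod 4), all coprime to l, and δ ∈ {1, 2}: (1) n = p with either (p/l) = −1, or (p/l) = 1 and (p/l)₄ ≠ (l/p)₄; (2) n = 2 with (2/l)₄ ≠ (−1)^((l−1)/8); (3) n = δ·q with (q/l) = −1; (4) n = q₁q₂ with (q₁/l) = −1 or (q₂/l) = −1. -/

import Mathlib

/-- `ε` is the fundamental unit of the real quadratic field `ℚ(√l)` (viewed inside `ℝ`):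
it lies in `ℚ(√l)`, it is a unit of the ring of integers (both `ε` and `ε⁻¹` are
algebraic integers), `ε > 1`, and it is the smallest such unit. -/
def IsFundamentalUnit (l : ℕ) (ε : ℝ) : Prop :=
  1 < ε ∧ ε ∈ IntermediateField.adjoin ℚ ({Real.sqrt (l : ℝ)} : Set ℝ) ∧
    IsIntegral ℤ ε ∧ IsIntegral ℤ ε⁻¹ ∧
    ∀ x : ℝ, 1 < x → x ∈ IntermediateField.adjoin ℚ ({Real.sqrt (l : ℝ)} : Set ℝ) →
      IsIntegral ℤ x → IsIntegral ℤ x⁻¹ → ε ≤ x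

/-- The Legendre symbol `(a/p)`, via Euler's criterion (so that no `Fact p.Prime`
instance is needed): for an odd prime `p` it is `1` if `a` is a nonzero square mod `p`,
`0` if `p ∣ a`, and `-1` otherwise. -/
def legSym (p : ℕ) (a : ℤ) : ℤ :=
  if (a : ZMod p) ^ ((p - 1) / 2) = 1 then 1 else if (a : ZMod p) = 0 then 0 else -1

/-- The rational fourth power residue symbol `(a/p)₄ ∈ {±1}`, meaningful when
`(a/p) = 1`; it is determined by `(a/p)₄ ≡ a ^ ((p-1)/4) (mod p)`. -/
def quartSym (p : ℕ) (a : ℤ) : ℤ :=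
  if (a : ZMod p) ^ ((p - 1) / 4) = 1 then 1 else -1

/-- The cardinality of the 2-torsion subgroup of the class group of `K`.
For a number field `K` this equals `2 ^ r₂(H)`, where `r₂(H)` is the rank of the
2-class group `H` of `K` (i.e. `dim_{𝔽₂} Cl(K)/Cl(K)²`); in particular
`r₂(H) = r` iff this cardinality is `2 ^ r`. -/
noncomputable def twoTorsCard (K : IntermediateField ℚ ℝ) : ℕ :=
  Nat.card {x : ClassGroup (NumberField.RingOfIntegers K) // x ^ 2 = 1}

/-- `i` as a primitive fourth root of unity in the Gaussian integers. -/
theorem gaussianInt_isPrimitiveRoot : IsPrimitiveRoot (⟨0, 1⟩ : GaussianInt) 4 := by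
  refine IsPrimitiveRoot.mk_of_lt _ (by norm_num) (by decide) ?_
  intro m hm hm'
  interval_cases m <;> decide

theorem exists_quartic_mulChar (l : ℕ) [Fact l.Prime] (h4 : 4 ∣ l - 1) :
    ∃ χ : MulChar (ZMod l) GaussianInt, orderOf χ = 4 :=
  MulChar.exists_mulChar_orderOf (ZMod l) (by rwa [ZMod.card]) gaussianInt_isPrimitiveRoot

theorem jacobiSum_quartic_norm (l : ℕ) [Fact l.Prime] {χ : MulChar (ZMod l) GaussianInt}
    (hχ : orderOf χ = 4) : (jacobiSum χ χ).norm = l := by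
  have hinj : Function.Injective GaussianInt.toComplex := fun x y h => by
    simpa using h
  set X := χ.ringHomComp GaussianInt.toComplex with hX
  have hpow : ∀ k : ℕ, X ^ k = 1 → 4 ∣ k := by
    intro k hk
    rw [hX, MulChar.ringHomComp_pow] at hk
    rw [← hχ]
    apply orderOf_dvd_of_pow_eq_one
    apply MulChar.injective_ringHomComp hinj
    exact hk.trans (MulChar.ringHomComp_one _).symm
  have h1 : X ≠ 1 := fun h => by
    have := hpow 1 (by rw [h, one_pow]); omega
  have h2 : X * X ≠ 1 := fun h => by
    have := hpow 2 (by rw [pow_two, h]); omega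
  have hc : ringChar ℂ ≠ ringChar (ZMod l) := by
    rw [ZMod.ringChar_zmod_n, ringChar.eq_zero]
    exact (Fact.out : l.Prime).ne_zero.symm
  have key := jacobiSum_mul_jacobiSum_inv hc h1 h1 h2
  have hstar : jacobiSum X⁻¹ X⁻¹ = (starRingEnd ℂ) (jacobiSum X X) := by
    rw [← jacobiSum_ringHomComp]
    have : X⁻¹ = X.ringHomComp (starRingEnd ℂ) := by
      rw [← MulChar.star_eq_inv]; rfl
    rw [this]
  rw [hstar, Complex.mul_conj, ZMod.card, hX, jacobiSum_ringHomComp,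
    ← GaussianInt.intCast_complex_norm] at key
  exact_mod_cast key

theorem jacobiSum_quartic_modEq (l : ℕ) [Fact l.Prime] (hl : l ≠ 2)
    {χ : MulChar (ZMod l) GaussianInt} (hχ : orderOf χ = 4) :
    (2 : GaussianInt) ∣ jacobiSum χ χ - 1 := by
  have h20 : (2 : ZMod l) ≠ 0 := by
    intro h
    have := (ZMod.natCast_eq_zero_iff 2 l).1 (by exact_mod_cast h)
    exact hl ((Nat.prime_dvd_prime_iff_eq Fact.out Nat.prime_two).1 this)
  set t : ZMod l := 1 / 2 with ht
  have ht1 : 1 - t = t := by rw [ht]; field_simp; norm_num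
  have hsum : (2 : GaussianInt) ∣ ∑ x ∈ Finset.univ.erase t, χ x * χ (1 - x) := by
    rw [← Ideal.mem_span_singleton, ← Ideal.Quotient.eq_zero_iff_mem, map_sum]
    refine Finset.sum_involution (fun x _ => 1 - x) ?_ ?_ ?_ ?_
    · intro x _
      rw [← map_add, Ideal.Quotient.eq_zero_iff_mem, Ideal.mem_span_singleton]
      refine ⟨χ x * χ (1 - x), ?_⟩
      rw [sub_sub_cancel]; ring
    · intro x hx _ h
      apply Finset.ne_of_mem_erase hx
      rw [ht, eq_div_iff h20]
      linear_combination (-1 : ZMod l) * h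
    · intro x hx
      refine Finset.mem_erase.2 ⟨fun h => Finset.ne_of_mem_erase hx ?_, Finset.mem_univ _⟩
      have : x = 1 - t := by rw [← h]; ring
      rw [this, ht1]
    · intro x _
      ring
  have ht0 : t ≠ 0 := by rw [ht]; exact one_div_ne_zero h20
  have hfour : χ t ^ 4 = 1 := by
    have : χ ^ 4 = 1 := by rw [← hχ]; exact pow_orderOf_eq_one χ
    rw [← MulChar.pow_apply' χ (by norm_num), this, MulChar.one_apply (Ne.isUnit ht0)]
  have hsq : (χ t * χ t - 1) * (χ t * χ t + 1) = 0 := by linear_combination hfour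
  have hterm : (2 : GaussianInt) ∣ χ t * χ (1 - t) - 1 := by
    rw [ht1]
    rcases mul_eq_zero.1 hsq with h | h
    · rw [h]; exact dvd_zero _
    · exact ⟨-1, by linear_combination h⟩
  rw [jacobiSum, ← Finset.add_sum_erase _ _ (Finset.mem_univ t)]
  have := dvd_add hterm hsum
  convert this using 1
  ring

theorem quartic_apply_eq_one_iff (l : ℕ) [Fact l.Prime] (h4 : 4 ∣ l - 1)
    {χ : MulChar (ZMod l) GaussianInt} (hχ : orderOf χ = 4) {a : ZMod l} (ha : a ≠ 0) :
    χ a = 1 ↔ a ^ ((l - 1) / 4) = 1 := by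
  obtain ⟨g, hg⟩ := IsCyclic.exists_generator (α := (ZMod l)ˣ)
  have hog : orderOf g = l - 1 := by
    rw [orderOf_eq_card_of_forall_mem_zpowers hg, Nat.card_eq_fintype_card,
      ZMod.card_units_eq_totient, Nat.totient_prime Fact.out]
  obtain ⟨k, hk⟩ := (Submonoid.mem_powers_iff _ _).1
    (mem_powers_iff_mem_zpowers.2 (hg (Units.mk0 a ha)))
  have hak : a = (g : ZMod l) ^ k := by
    rw [← Units.val_pow_eq_pow_val, hk]; rfl
  have hl1 : 0 < l - 1 := by have := (Fact.out : l.Prime).two_le; omega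
  have hgord : ∀ m : ℕ, χ (g : ZMod l) ^ m = 1 → 4 ∣ m := by
    intro m hm
    rw [← hχ]
    apply orderOf_dvd_of_pow_eq_one
    refine MulChar.ext fun x => ?_
    obtain ⟨j, hj⟩ := (Submonoid.mem_powers_iff _ _).1 (mem_powers_iff_mem_zpowers.2 (hg x))
    rw [MulChar.pow_apply_coe, MulChar.one_apply_coe, ← hj, Units.val_pow_eq_pow_val, map_pow,
      ← pow_mul, mul_comm, pow_mul, hm, one_pow]
  have hg4 : χ (g : ZMod l) ^ 4 = 1 := by
    rw [← MulChar.pow_apply_coe, ← hχ, pow_orderOf_eq_one, MulChar.one_apply_coe]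
  rw [hak, map_pow]
  constructor
  · intro h
    obtain ⟨c, rfl⟩ := hgord k h
    rw [← pow_mul, ← Units.val_pow_eq_pow_val, Units.val_eq_one,
      ← orderOf_dvd_iff_pow_eq_one, hog]
    exact ⟨c, by
      rw [mul_right_comm, Nat.mul_div_cancel' h4]⟩
  · intro h
    rw [← pow_mul, ← Units.val_pow_eq_pow_val, Units.val_eq_one] at h
    have h' := orderOf_dvd_iff_pow_eq_one.2 h
    rw [hog] at h'
    obtain ⟨c, hc⟩ := h4
    have : 4 ∣ k := by
      rw [hc] at h' hl1
      rw [Nat.mul_div_cancel_left _ (by norm_num : 0 < 4)] at h'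
      exact Nat.dvd_of_mul_dvd_mul_right (by omega) h'
    obtain ⟨e, rfl⟩ := this
    rw [pow_mul, hg4, one_pow]

theorem gaussianInt_mul_conj (A κ : ℤ) :
    (⟨A, κ⟩ : GaussianInt) * ⟨A, -κ⟩ = ((A ^ 2 + κ ^ 2 : ℤ) : GaussianInt) := by
  rw [Zsqrtd.ext_iff, Zsqrtd.re_mul, Zsqrtd.im_mul, Zsqrtd.re_intCast, Zsqrtd.im_intCast]
  constructor <;> ring

/-- If `A` is even and `A² + 1 = l B²` with `B` odd, and `J ≡ 1 (mod 2)` has norm `l`, then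
`A + κ i` is `± i J β²` for some sign `κ`. -/
theorem exists_eq_jacobi_mul_sq {l : ℕ} (hl : l.Prime) {A B : ℤ} (hAB : A ^ 2 + 1 = l * B ^ 2)
    (hB : Odd B) {J : GaussianInt} (hJ : J.norm = l) (hJ2 : (2 : GaussianInt) ∣ J - 1) :
    ∃ κ σ : ℤ, ∃ β : GaussianInt, κ ^ 2 = 1 ∧ σ ^ 2 = 1 ∧
      (⟨A, κ⟩ : GaussianInt) = σ * ⟨0, 1⟩ * J * β ^ 2 := by
  have hJJ : J * star J = (l : GaussianInt) := by
    have := Zsqrtd.norm_eq_mul_conj J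
    rw [hJ] at this
    rw [← this]; simp
  have hJirr : Prime J := by
    rw [← irreducible_iff_prime]
    constructor
    · rw [← Zsqrtd.norm_eq_one_iff, hJ, Int.natAbs_natCast]
      exact hl.one_lt.ne'
    · intro a b hab
      rw [← Zsqrtd.norm_eq_one_iff, ← Zsqrtd.norm_eq_one_iff]
      have h1 : a.norm.natAbs * b.norm.natAbs = l := by
        rw [← Int.natAbs_mul, ← Zsqrtd.norm_mul, ← hab, hJ, Int.natAbs_natCast]
      have := hl
      rw [← h1, Nat.prime_mul_iff] at this
      tauto
  have hprod : (⟨A, 1⟩ : GaussianInt) * ⟨A, -1⟩ = J * (star J * (B : GaussianInt) ^ 2) := by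
    rw [← mul_assoc, hJJ]
    have h2 : ((l : ℤ) : GaussianInt) * (B : GaussianInt) ^ 2 =
      ((A ^ 2 + 1 : ℤ) : GaussianInt) := by
      rw [hAB]; push_cast; ring
    rw [Int.cast_natCast] at h2
    rw [h2, gaussianInt_mul_conj, one_pow]
  obtain ⟨κ, hκ, γ, hγ⟩ : ∃ κ : ℤ, κ ^ 2 = 1 ∧ J ∣ (⟨A, κ⟩ : GaussianInt) := by
    rcases hJirr.dvd_or_dvd (Dvd.intro _ hprod.symm) with h | h
    · exact ⟨1, by norm_num, h⟩
    · exact ⟨-1, by norm_num, h⟩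
  have hsg : star J * star γ = (⟨A, -κ⟩ : GaussianInt) := by
    have := congrArg star hγ
    rw [star_mul', Zsqrtd.star_mk] at this
    exact this.symm
  have hl0 : (l : GaussianInt) ≠ 0 := by exact_mod_cast hl.ne_zero
  have hγγ : γ * star γ = (B : GaussianInt) ^ 2 := by
    apply mul_left_cancel₀ hl0
    rw [← hJJ]
    calc J * star J * (γ * star γ) = (J * γ) * (star J * star γ) := by ring
      _ = ⟨A, κ⟩ * ⟨A, -κ⟩ := by rw [hsg, hγ]
      _ = ((A ^ 2 + 1 : ℤ) : GaussianInt) := by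
        rw [gaussianInt_mul_conj, hκ]
      _ = _ := by rw [hAB, hJJ]; push_cast; ring
  have hcop : IsCoprime γ (star γ) := by
    obtain ⟨m, hm⟩ : ∃ m, B ^ 2 = 2 * m + 1 := hB.pow
    have hm' : (B : GaussianInt) ^ 2 = 2 * m + 1 := by
      exact_mod_cast congrArg (Int.cast : ℤ → GaussianInt) hm
    have h2 : J * γ - star J * star γ = 2 * (κ * ⟨0, 1⟩) := by
      rw [hsg, ← hγ]
      ext <;> simp [Zsqrtd.re_mul, Zsqrtd.im_mul]
      ring
    have hκi : (κ * ⟨0, 1⟩ : GaussianInt) * (κ * ⟨0, -1⟩) = 1 := by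
      ext <;> simp [Zsqrtd.re_mul, Zsqrtd.im_mul]
      linear_combination hκ
    refine ⟨star γ - m * (κ * ⟨0, -1⟩) * J, m * (κ * ⟨0, -1⟩) * star J, ?_⟩
    linear_combination hγγ + hm' - m * (κ * ⟨0, -1⟩) * h2 - 2 * m * hκi
  obtain ⟨β, u, hu⟩ := exists_associated_pow_of_mul_eq_pow' hcop hγγ
  have hunit : (u : GaussianInt).norm = 1 := by
    have := (Zsqrtd.norm_eq_one_iff' (d := -1) (by norm_num) (u : GaussianInt)).2 u.isUnit
    exact this
  have himo : Odd γ.im := by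
    obtain ⟨t, ht⟩ := hJ2
    have hJe : J = 1 + 2 * t := by linear_combination ht
    rw [hJe] at hγ
    have h3 := congrArg Zsqrtd.im hγ
    simp [Zsqrtd.re_mul, Zsqrtd.im_mul] at h3
    have hκo : Odd κ := by
      rcases mul_self_eq_one_iff.1 ((pow_two κ).symm.trans hκ) with h | h <;> rw [h] <;> decide
    have : Odd (γ.im + 2 * (t.re * γ.im + t.im * γ.re)) := by
      convert hκo using 1
      linear_combination -h3
    rcases Int.even_or_odd γ.im with he | ho
    · obtain ⟨a, ha⟩ := this
      obtain ⟨b, hb⟩ := he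
      omega
    · exact ho
  have him2 : ∃ c, (β ^ 2).im = 2 * c := ⟨β.re * β.im, by
    rw [pow_two, Zsqrtd.im_mul]; ring⟩
  have hcase : ((u : GaussianInt).re = 0 ∧ (u : GaussianInt).im ^ 2 = 1) := by
    have hn : (u : GaussianInt).re * (u : GaussianInt).re + (u : GaussianInt).im * (u : GaussianInt).im =
      1 := by
      have := hunit
      rw [Zsqrtd.norm_def] at this
      linear_combination this
    have hb1 : (u : GaussianInt).re ^ 2 ≤ 1 := by nlinarith [sq_nonneg (u : GaussianInt).im]
    have hb2 : (u : GaussianInt).re ≠ 0 → (u : GaussianInt).im = 0 := by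
      intro h
      have : 1 ≤ (u : GaussianInt).re ^ 2 := by
        have := Int.one_le_abs h
        nlinarith [sq_abs (u : GaussianInt).re]
      have : (u : GaussianInt).im ^ 2 = 0 := by nlinarith [sq_nonneg (u : GaussianInt).im]
      exact pow_eq_zero_iff (two_ne_zero) |>.1 this
    by_cases h0 : (u : GaussianInt).re = 0
    · exact ⟨h0, by rw [h0] at hn; linear_combination hn⟩
    · exfalso
      obtain ⟨c, hc⟩ := him2
      rw [← hu, Zsqrtd.im_mul, hc, hb2 h0] at himo
      obtain ⟨a, ha⟩ := himo
      have : 2 * (c * (u : GaussianInt).re) = 2 * a + 1 := by linear_combination ha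
      omega
  refine ⟨κ, (u : GaussianInt).im, β, hκ, hcase.2, ?_⟩
  rw [hγ, ← hu]
  have : (u : GaussianInt) = (u : GaussianInt).im * ⟨0, 1⟩ := by
    ext <;> simp [hcase.1]
  linear_combination J * β ^ 2 * this

/-- The Gauss sum computation: for a quartic character `χ` modulo `l` and a prime
`p ≡ 1 (mod 4)`, the image of `s J(χ, χ)` in `𝔽_p` is a square iff `χ(p) = 1`. -/
theorem isSquare_mul_jacobiSum_iff {l p : ℕ} [Fact l.Prime] [Fact p.Prime] (hp4 : p % 4 = 1)
    (hpl : p ≠ l) {χ : MulChar (ZMod l) GaussianInt} (hχ : orderOf χ = 4)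
    (φ : GaussianInt →+* ZMod p) {s : ZMod p} (hs : s ^ 2 = l) (hJ0 : s * φ (jacobiSum χ χ) ≠ 0) :
    IsSquare (s * φ (jacobiSum χ χ)) ↔ χ (p : ZMod l) = 1 := by
  set L := AlgebraicClosure (ZMod p)
  let e : ZMod p →+* L := algebraMap (ZMod p) L
  have he : Function.Injective e := e.injective
  have : CharP L p := charP_of_injective_algebraMap he p
  have hlL : (l : L) ≠ 0 := by
    intro h
    rw [CharP.cast_eq_zero_iff L p] at h
    exact hpl ((Nat.prime_dvd_prime_iff_eq Fact.out Fact.out).1 h)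
  have hneg : (-1 : L) ≠ 1 := by
    intro h
    have h2 : ((2 : ℕ) : L) = 0 := by push_cast; linear_combination -h
    rw [CharP.cast_eq_zero_iff L p, Nat.prime_dvd_prime_iff_eq Fact.out Nat.prime_two] at h2
    omega
  have : NeZero (l : L) := ⟨hlL⟩
  have : NeZero l := ⟨(Fact.out : l.Prime).ne_zero⟩
  obtain ⟨ζ, hζ⟩ := HasEnoughRootsOfUnity.exists_primitiveRoot L l
  set ψ := AddChar.zmodChar l hζ.pow_eq_one
  have hψ : ψ.IsPrimitive := AddChar.zmodChar_primitive_of_primitive_root l hζ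
  have hχ4 : ∀ a : (ZMod l)ˣ, χ a ^ 4 = 1 := fun a => by
    rw [← MulChar.pow_apply_coe, ← hχ, pow_orderOf_eq_one, MulChar.one_apply_coe]
  have hroot : ∀ z : GaussianInt, z ^ 4 = 1 → e (φ z) = 1 → z = 1 := by
    intro z hz h
    have hz' : (z - 1) * ((z + 1) * (z ^ 2 + 1)) = 0 := by linear_combination hz
    rcases mul_eq_zero.1 hz' with h1 | h1
    · exact sub_eq_zero.1 h1
    · exfalso
      apply hneg
      rcases mul_eq_zero.1 h1 with h2 | h2
      · have := congrArg (fun x => e (φ x)) h2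
        simp only [map_add, map_one, map_zero, h] at this
        linear_combination -this
      · have := congrArg (fun x => e (φ x)) h2
        simp only [map_add, map_one, map_zero, map_pow, h] at this
        linear_combination -this
  set X : MulChar (ZMod l) L := χ.ringHomComp (e.comp φ) with hX
  have hXa : ∀ a, X a = e (φ (χ a)) := fun a => rfl
  have hX4 : X ^ 4 = 1 := by
    rw [hX, MulChar.ringHomComp_pow, ← hχ, pow_orderOf_eq_one, MulChar.ringHomComp_one]
  have hXX : X * X ≠ 1 := by
    intro h
    have : χ ^ 2 = 1 := by
      refine MulChar.ext fun a => ?_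
      rw [MulChar.pow_apply_coe, MulChar.one_apply_coe]
      apply hroot
      · rw [← pow_mul, mul_comm, pow_mul, hχ4, one_pow]
      · have := congrArg (fun Y : MulChar (ZMod l) L => Y a) h
        simp only [MulChar.mul_apply, MulChar.one_apply_coe, hXa] at this
        rw [map_pow, map_pow, pow_two, this]
    have := orderOf_dvd_of_pow_eq_one this
    rw [hχ] at this
    omega
  have hX1 : X ≠ 1 := fun h => hXX (by rw [h, one_mul])
  set G := gaussSum X ψ with hG
  have hlc : (Fintype.card (ZMod l) : L) ≠ 0 := by rwa [ZMod.card]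
  have hG0 : G ≠ 0 := gaussSum_ne_zero_of_nontrivial hlc hX1 hψ
  have hJ : jacobiSum X X = e (φ (jacobiSum χ χ)) := jacobiSum_ringHomComp χ χ (e.comp φ)
  have hGG := jacobiSum_mul_nontrivial hXX ψ
  have hquad : (X * X).IsQuadratic := by
    rw [MulChar.isQuadratic_iff_sq_eq_one, ← pow_two, ← pow_mul, hX4]
  have hg2 := gaussSum_sq hXX hquad hψ
  have hm1 : (X * X) (-1) = 1 := by
    rw [MulChar.mul_apply, ← map_mul, neg_mul_neg, one_mul, map_one]
  rw [hm1, one_mul, ZMod.card] at hg2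
  set g := gaussSum (X * X) ψ
  have hgs : g = e s ∨ g = -e s := by
    apply sq_eq_sq_iff_eq_or_eq_neg.1
    rw [hg2, ← map_pow, hs, map_natCast]
  obtain ⟨m, hm⟩ : ∃ m, p = 4 * m + 1 := ⟨p / 4, by omega⟩
  have hXp : X ^ p = X := (congrArg (X ^ ·) hm).trans <| by rw [pow_succ, pow_mul, hX4, one_pow,
    one_mul]
  have hfrob := gaussSum_frob p X ψ
  rw [hXp, AddChar.pow_mulShift] at hfrob
  have hpl0 : (p : ZMod l) ≠ 0 := by
    rw [Ne, ZMod.natCast_eq_zero_iff, Nat.prime_dvd_prime_iff_eq Fact.out Fact.out]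
    exact hpl.symm
  have hshift := gaussSum_mulShift X ψ (Units.mk0 (p : ZMod l) hpl0)
  rw [Units.val_mk0, ← hfrob, ← hG] at hshift
  have hmain : X (p : ZMod l) * e (s * φ (jacobiSum χ χ)) ^ (2 * m) = 1 := by
    apply mul_right_cancel₀ hG0
    rw [one_mul]
    have hGm : G ^ p = e (s * φ (jacobiSum χ χ)) ^ (2 * m) * G := by
      refine (congrArg (G ^ ·) hm).trans ?_
      rw [pow_succ, show 4 * m = 2 * (2 * m) by ring, pow_mul, pow_two, ← hGG, hJ, map_mul]
      rcases hgs with h | h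
      · rw [h]
      · rw [h, neg_mul, Even.neg_pow (even_two_mul m)]
    rw [mul_assoc, ← hGm, hshift]
  have hp2 : p / 2 = 2 * m := by omega
  rw [ZMod.euler_criterion p hJ0, hp2]
  constructor
  · intro h
    rw [← map_pow, h, map_one, mul_one] at hmain
    exact hroot _ (hχ4 (Units.mk0 (p : ZMod l) hpl0)) hmain
  · intro h
    apply he
    rw [map_pow, map_one]
    rw [hXa, h, map_one, map_one, one_mul] at hmain
    exact hmain

/-- Scholz's reciprocity: for `ε = A + B√l` of norm `-1`, the symbol of `ε√l` at a prime above
`p` is the quartic symbol of `p` modulo `l`. -/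
theorem scholz_reciprocity {l p : ℕ} [Fact l.Prime] [Fact p.Prime] (hl4 : l % 4 = 1)
    (hp4 : p % 4 = 1) (hpl : p ≠ l) {A B : ℤ} (hAB : A ^ 2 + 1 = l * B ^ 2)
    (hB : Odd B) {s : ZMod p} (hs : s ^ 2 = l) :
    IsSquare ((A + B * s) * s) ↔ (p : ZMod l) ^ ((l - 1) / 4) = 1 := by
  have h4 : 4 ∣ l - 1 := by omega
  obtain ⟨χ, hχ⟩ := exists_quartic_mulChar l h4
  have hJn := jacobiSum_quartic_norm l hχ
  have hJ2 := jacobiSum_quartic_modEq l (by rintro rfl; omega) hχ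
  have hpl0 : (p : ZMod l) ≠ 0 := by
    rw [Ne, ZMod.natCast_eq_zero_iff, Nat.prime_dvd_prime_iff_eq Fact.out Fact.out]
    exact hpl.symm
  have hlp0 : (l : ZMod p) ≠ 0 := by
    rw [Ne, ZMod.natCast_eq_zero_iff, Nat.prime_dvd_prime_iff_eq Fact.out Fact.out]
    exact hpl
  have hs0 : s ≠ 0 := by rintro rfl; exact hlp0 (by rw [← hs]; simp)
  rw [← quartic_apply_eq_one_iff l h4 hχ hpl0]
  obtain ⟨κ, σ, β, hκ, hσ, hβ⟩ := exists_eq_jacobi_mul_sq Fact.out hAB hB hJn hJ2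
  set J := jacobiSum χ χ
  have h20 : (2 : ZMod p) ≠ 0 := by
    intro h
    have := (ZMod.natCast_eq_zero_iff 2 p).1 (by exact_mod_cast h)
    have := (Nat.prime_dvd_prime_iff_eq Fact.out Nat.prime_two).1 this
    omega
  obtain ⟨i₀, hi₀⟩ := ZMod.exists_sq_eq_neg_one_iff.2 (show p % 4 ≠ 3 by omega)
  have hκp : (κ : ZMod p) ^ 2 = 1 := by exact_mod_cast congrArg (Int.cast : ℤ → ZMod p) hκ
  have hσp : (σ : ZMod p) ^ 2 = 1 := by exact_mod_cast congrArg (Int.cast : ℤ → ZMod p) hσ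
  obtain ⟨j, hj, hAj⟩ : ∃ j : ZMod p, j * j = -1 ∧ (A : ZMod p) + κ * j ≠ 0 := by
    by_cases h : (A : ZMod p) + κ * i₀ = 0
    · refine ⟨-i₀, by rw [neg_mul_neg, ← hi₀], fun h' => ?_⟩
      have h1 : 2 * ((κ : ZMod p) * i₀) = 0 := by linear_combination h - h'
      have h2 : (κ : ZMod p) * i₀ = 0 := (mul_eq_zero.1 h1).resolve_left h20
      have h3 : ((κ : ZMod p) * i₀) ^ 2 = -1 := by
        rw [mul_pow, hκp, hi₀]; ring
      rw [h2] at h3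
      rw [zero_pow two_ne_zero] at h3
      exact (one_ne_zero : (1 : ZMod p) ≠ 0) (by linear_combination h3)
    · exact ⟨i₀, hi₀.symm, h⟩
  let φ : GaussianInt →+* ZMod p := Zsqrtd.lift ⟨j, by rw [hj]; simp⟩
  have hφ : ∀ a b : ℤ, φ ⟨a, b⟩ = a + b * j := fun a b => by
    simp [φ, Zsqrtd.lift]
  have hφσ : φ (σ : GaussianInt) = σ := map_intCast φ σ
  have hφβ : (A : ZMod p) + κ * j = σ * j * φ J * φ β ^ 2 := by
    have := congrArg φ hβ
    rw [map_mul, map_mul, map_mul, map_pow, hφσ, hφ, hφ, Int.cast_zero, zero_add,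
      Int.cast_one, one_mul] at this
    exact this
  have hβ0 : φ β ≠ 0 := by
    intro h
    rw [h] at hφβ
    exact hAj (by rw [hφβ]; ring)
  have hJ0 : φ J ≠ 0 := by
    intro h
    rw [h] at hφβ
    exact hAj (by rw [hφβ]; ring)
  rw [← isSquare_mul_jacobiSum_iff hp4 hpl hχ φ hs (mul_ne_zero hs0 hJ0)]
  have hABp : (A : ZMod p) ^ 2 + 1 = s ^ 2 * B ^ 2 := by
    rw [hs]; exact_mod_cast congrArg (Int.cast : ℤ → ZMod p) hAB
  set ε : ZMod p := A + B * s with hε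
  have hεε : ε ^ 2 = 2 * A * ε + 1 := by
    rw [hε]; linear_combination -hABp
  have hε0 : ε ≠ 0 := by
    intro h
    rw [h] at hεε
    exact (one_ne_zero : (1 : ZMod p) ≠ 0) (by linear_combination -hεε)
  obtain ⟨w, hw⟩ : IsSquare (σ : ZMod p) := by
    rcases mul_self_eq_one_iff.1 ((pow_two σ).symm.trans hσ) with h | h
    · exact ⟨1, by rw [h]; simp⟩
    · exact ⟨j, by rw [h, hj]; simp⟩
  have hw0 : w ≠ 0 := by
    rintro rfl
    rw [hw] at hσp
    simp at hσp
  have h1j : (1 : ZMod p) + j ≠ 0 := by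
    intro h
    apply h20
    linear_combination (-j + 1) * h + hj
  have hkey : (j * (1 - κ * j * ε)) ^ 2 = ε * φ J * ((1 + j) * w * φ β) ^ 2 := by
    have h1 : (j * (1 - κ * j * ε)) ^ 2 = 2 * ε * (A + κ * j) := by
      linear_combination (1 - 2 * κ * j * ε + κ ^ 2 * j ^ 2 * ε ^ 2 - ε ^ 2) * hj
        - j ^ 2 * ε ^ 2 * hκp + hεε
    rw [h1, hφβ, hw]
    linear_combination -ε * φ J * w ^ 2 * φ β ^ 2 * hj
  have hne : (1 + j) * w * φ β ≠ 0 := mul_ne_zero (mul_ne_zero h1j hw0) hβ0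
  have hsq : IsSquare (ε * φ J) := by
    refine ⟨j * (1 - κ * j * ε) / ((1 + j) * w * φ β), ?_⟩
    rw [← pow_two, div_pow, hkey, mul_div_cancel_right₀ _ (pow_ne_zero 2 hne)]
  obtain ⟨t, ht⟩ := hsq
  have ht0 : t ≠ 0 := by
    rintro rfl
    rw [mul_zero] at ht
    exact mul_ne_zero hε0 hJ0 ht
  constructor
  · rintro ⟨r, hr⟩
    refine ⟨r * t / ε, ?_⟩
    field_simp
    linear_combination t ^ 2 * hr + s * ε * ht
  · rintro ⟨r, hr⟩
    refine ⟨r * t / φ J, ?_⟩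
    field_simp
    linear_combination t ^ 2 * hr + s * φ J * ht

/-- For `A² + 1 = l B²` with `4 ∣ A`, the condition `8 ∣ A` is detected by the quartic symbol
of `2` modulo `l`. -/
theorem quartic_symbol_two {l : ℕ} [Fact l.Prime] (hl8 : l % 8 = 1) {A : ℕ} {B : ℤ}
    (hAB : (A : ℤ) ^ 2 + 1 = l * B ^ 2) (hA : 4 ∣ A) :
    (2 : ZMod l) ^ ((l - 1) / 4) * (-1) ^ ((l - 1) / 8) = if 8 ∣ A then 1 else -1 := by
  obtain ⟨e, he⟩ : ∃ e, l = 8 * e + 1 := ⟨l / 8, by omega⟩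
  have h4 : (l - 1) / 4 = 2 * e := by omega
  have h8 : (l - 1) / 8 = e := by omega
  have hl2 : l / 2 = 4 * e := by omega
  rw [h4, h8]
  have hA2 : (A : ZMod l) ^ 2 = -1 := by
    have := congrArg (Int.cast : ℤ → ZMod l) hAB
    push_cast at this
    rw [ZMod.natCast_self, zero_mul] at this
    linear_combination this
  have h1 : ((1 + A : ℤ) : ZMod l) ^ (4 * e) = 2 ^ (2 * e) * (-1) ^ e := by
    have : ((1 + A : ℤ) : ZMod l) ^ 2 = 2 * A := by
      push_cast; linear_combination hA2
    rw [show 4 * e = 2 * (2 * e) by ring, pow_mul, this, mul_pow, pow_mul (A : ZMod l), hA2]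
  rw [← h1, ← hl2, ← legendreSym.eq_pow, jacobiSym.legendreSym.to_jacobiSym]
  have hodd : Odd (1 + A) := by
    obtain ⟨c, rfl⟩ := hA
    exact ⟨2 * c, by ring⟩
  have hrec : jacobiSym (1 + A : ℤ) l = jacobiSym l (1 + A) := by
    have := jacobiSym.quadratic_reciprocity_one_mod_four (a := l) (b := 1 + A) (by omega) hodd
    rw [this]; push_cast; rfl
  have hmod : jacobiSym (l * B ^ 2) (1 + A) = jacobiSym 2 (1 + A) := by
    rw [← hAB, jacobiSym.mod_left, jacobiSym.mod_left 2]
    congr 1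
    apply Int.ModEq.eq
    rw [Int.modEq_iff_dvd]
    exact ⟨1 - A, by push_cast; ring⟩
  have hχ : jacobiSym 2 (1 + A) = if 8 ∣ A then 1 else -1 := by
    rw [jacobiSym.at_two hodd, ZMod.χ₈_nat_eq_if_mod_eight]
    have : (1 + A) % 2 ≠ 0 := by omega
    rw [if_neg this]
    by_cases h : 8 ∣ A
    · rw [if_pos h, if_pos (Or.inl (by omega))]
    · rw [if_neg h, if_neg (by omega)]
  have hne : jacobiSym 2 (1 + A) ≠ 0 := by
    rw [hχ]; split_ifs <;> norm_num
  rw [jacobiSym.mul_left, jacobiSym.pow_left] at hmod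
  have hB : jacobiSym B (1 + A) ^ 2 = 1 := by
    rcases jacobiSym.trichotomy B (1 + A) with h | h | h
    · rw [h, zero_pow two_ne_zero, mul_zero] at hmod
      exact absurd hmod.symm hne
    · rw [h]; norm_num
    · rw [h]; norm_num
  rw [hB, mul_one, hχ] at hmod
  rw [hrec, hmod]
  split_ifs <;> simp

theorem exists_prime_gt_modEq_three (N : ℕ) {P Q l a c : ℕ} (hP : P ≠ 0) (hQ : Q ≠ 0) (hl : l ≠ 0)
    (hPQ : P.Coprime Q) (hPl : P.Coprime l) (hQl : Q.Coprime l) (ha : a.Coprime P)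
    (hc : c.Coprime l) :
    ∃ r > N, r.Prime ∧ r ≡ a [MOD P] ∧ r ≡ 1 [MOD Q] ∧ r ≡ c [MOD l] := by
  obtain ⟨x, hxP, hxQ⟩ := Nat.chineseRemainder hPQ a 1
  obtain ⟨y, hyPQ, hyl⟩ := Nat.chineseRemainder (Nat.Coprime.mul_left hPl hQl) x c
  have hyP : y ≡ a [MOD P] := (hyPQ.of_mul_right Q).trans hxP
  have hyQ : y ≡ 1 [MOD Q] := (hyPQ.of_mul_left P).trans hxQ
  have hcop : y.Coprime (P * Q * l) := by
    refine Nat.Coprime.mul_right (Nat.Coprime.mul_right ?_ ?_) ?_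
    · rw [Nat.Coprime, hyP.gcd_eq]; exact ha
    · rw [Nat.Coprime, hyQ.gcd_eq]; exact Nat.gcd_one_left Q
    · rw [Nat.Coprime, hyl.gcd_eq]; exact hc
  obtain ⟨r, hr, hrp, hry⟩ := Nat.forall_exists_prime_gt_and_modEq N
    (mul_ne_zero (mul_ne_zero hP hQ) hl) hcop
  have hryPQ := hry.of_mul_right l
  exact ⟨r, hr, hrp, (hryPQ.of_mul_right Q).trans hyP, (hryPQ.of_mul_left P).trans hyQ,
    (hry.of_mul_left (P * Q)).trans hyl⟩

theorem exists_coprime_not_isSquare (p : ℕ) [Fact p.Prime] (hp : p ≠ 2) :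
    ∃ a : ℕ, a.Coprime p ∧ ¬ IsSquare (a : ZMod p) := by
  obtain ⟨a, ha⟩ := FiniteField.exists_nonsquare (F := ZMod p) (by rwa [ZMod.ringChar_zmod_n])
  refine ⟨a.val, ?_, by rwa [ZMod.natCast_zmod_val]⟩
  rw [Nat.coprime_comm, (Fact.out : p.Prime).coprime_iff_not_dvd, ← ZMod.natCast_eq_zero_iff,
    ZMod.natCast_zmod_val]
  rintro rfl
  exact ha (IsSquare.zero)

theorem isSquare_mul_of_not_isSquare {p : ℕ} [Fact p.Prime] {a b : ZMod p}
    (ha : ¬ IsSquare a) (hb : ¬ IsSquare b) : IsSquare (a * b) := by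
  have ha0 : a ≠ 0 := by rintro rfl; exact ha IsSquare.zero
  have hb0 : b ≠ 0 := by rintro rfl; exact hb IsSquare.zero
  rw [ZMod.euler_criterion p (mul_ne_zero ha0 hb0), mul_pow]
  rw [ZMod.euler_criterion p ha0] at ha
  rw [ZMod.euler_criterion p hb0] at hb
  rw [(ZMod.pow_div_two_eq_neg_one_or_one p ha0).resolve_left ha,
    (ZMod.pow_div_two_eq_neg_one_or_one p hb0).resolve_left hb]
  norm_num

/-- An auxiliary prime attached to a prime divisor `p₀` of `n`: it splits in `ℚ(√l)`, the number
`n ε √l` is a square at both primes above it, and it is a non-residue only at `p₀`. -/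
structure IsAuxPrime (l n p₀ : ℕ) (A B : ℤ) (r : ℕ) : Prop where
  prime : r.Prime
  gt : 2 * n * l < r
  mod_four : r % 4 = 1
  mod_eight : p₀ ≠ 2 → r % 8 = 1
  mod_eight_two : p₀ = 2 → r % 8 = 5
  not_isSquare : p₀ ≠ 2 → ¬ IsSquare (r : ZMod p₀)
  eq_one : ∀ p : ℕ, p.Prime → p ∣ n → p ≠ p₀ → (r : ZMod p) = 1
  pow_quarter : (r : ZMod l) ^ ((l - 1) / 4) = -1
  exists_sqrt : ∃ s : ZMod r, s ^ 2 = l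
  isSquare : ∀ s : ZMod r, s ^ 2 = l → IsSquare (n * ((A + B * s) * s))

theorem exists_isAuxPrime {l n p₀ : ℕ} (hlp : l.Prime) (hl4 : l % 4 = 1) (hn : Squarefree n)
    (hnl : n.Coprime l) (hp : p₀.Prime) (hpn : p₀ ∣ n) {A B : ℤ} (hAB : A ^ 2 + 1 = l * B ^ 2)
    (hB : Odd B) : ∃ r, IsAuxPrime l n p₀ A B r := by
  have : Fact l.Prime := ⟨hlp⟩
  have : Fact p₀.Prime := ⟨hp⟩
  have hl2 : l ≠ 2 := by rintro rfl; omega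
  obtain ⟨m, rfl⟩ := hpn
  have hm0 : m ≠ 0 := by rintro rfl; simp at hn
  have hpm : p₀.Coprime m := Nat.coprime_of_squarefree_mul hn
  have hpl : p₀.Coprime l := Nat.Coprime.coprime_mul_right hnl
  have hml : m.Coprime l := Nat.Coprime.coprime_mul_left hnl
  have h8l : Nat.Coprime 8 l := by
    rw [show 8 = 2 ^ 3 by norm_num]
    exact Nat.Coprime.pow_left 3 ((Nat.coprime_primes Nat.prime_two hlp).2 hl2.symm)
  obtain ⟨g, hgl, hg⟩ := exists_coprime_not_isSquare l hl2
  have hg0 : (g : ZMod l) ≠ 0 := by intro h; rw [h] at hg; exact hg IsSquare.zero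
  obtain ⟨r, hr, hrp, hrl, hr8m, hr8, hr8', hrns⟩ : ∃ r > 2 * (p₀ * m) * l, r.Prime ∧
      r ≡ g ^ 2 [MOD l] ∧ r ≡ 1 [MOD 4 * m] ∧ (p₀ ≠ 2 → r % 8 = 1) ∧ (p₀ = 2 → r % 8 = 5) ∧
      (p₀ ≠ 2 → ¬ IsSquare (r : ZMod p₀)) := by
    by_cases h2 : p₀ = 2
    · subst h2
      obtain ⟨r, hr, hrp, h1, h2, h3⟩ := exists_prime_gt_modEq_three (2 * (2 * m) * l) (P := 8)
        (Q := m) (l := l) (a := 5) (c := g ^ 2) (by norm_num) hm0 hlp.ne_zero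
        (by rw [show 8 = 2 ^ 3 by norm_num]; exact hpm.pow_left 3) h8l hml (by norm_num)
        (hgl.pow_left 2)
      refine ⟨r, hr, hrp, h3, ?_, fun h => absurd rfl h, fun _ => h1, fun h => absurd rfl h⟩
      refine (Nat.modEq_and_modEq_iff_modEq_mul ?_).1 ⟨?_, h2⟩
      · exact Nat.Coprime.pow_left 2 hpm
      · exact (Nat.ModEq.of_mul_left 2 (n := 4) h1).trans rfl
    · obtain ⟨a, hap, ha⟩ := exists_coprime_not_isSquare p₀ h2
      have hp8 : p₀.Coprime 8 := by
        rw [show 8 = 2 ^ 3 by norm_num]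
        exact Nat.Coprime.pow_right 3 ((Nat.coprime_primes hp Nat.prime_two).2 h2)
      obtain ⟨r, hr, hrp, h1, h2', h3⟩ := exists_prime_gt_modEq_three (2 * (p₀ * m) * l) (P := p₀)
        (Q := 8 * m) (l := l) (a := a) (c := g ^ 2) hp.ne_zero (by positivity) hlp.ne_zero
        (Nat.Coprime.mul_right hp8 hpm) hpl (Nat.Coprime.mul_left h8l hml) hap (hgl.pow_left 2)
      refine ⟨r, hr, hrp, h3, ?_, fun _ => h2'.of_mul_right m, fun h => absurd h h2, fun _ => ?_⟩
      · rw [show 8 * m = 2 * (4 * m) by ring] at h2'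
        exact h2'.of_mul_left 2
      · rwa [(ZMod.natCast_eq_natCast_iff _ _ _).2 h1]
  have hr4 : r % 4 = 1 := hr8m.of_mul_right m
  have : Fact r.Prime := ⟨hrp⟩
  have hrodd : Odd r := Nat.odd_iff.2 (by omega)
  have hrlz : (r : ZMod l) = (g : ZMod l) ^ 2 := by
    rw [(ZMod.natCast_eq_natCast_iff _ _ _).2 hrl]; push_cast; rfl
  have hrl' : l ≠ r := by
    rintro rfl
    have : 0 < p₀ * m := Nat.mul_pos hp.pos (Nat.pos_of_ne_zero hm0)
    nlinarith
  have hquart : (r : ZMod l) ^ ((l - 1) / 4) = -1 := by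
    rw [hrlz, ← pow_mul, show 2 * ((l - 1) / 4) = l / 2 by omega]
    exact (ZMod.pow_div_two_eq_neg_one_or_one l hg0).resolve_left
      (fun h => hg ((ZMod.euler_criterion l hg0).2 h))
  have hpow1 : (r : ZMod l) ^ ((l - 1) / 4) ≠ 1 := by
    rw [hquart]
    intro h
    have h2 : ((2 : ℕ) : ZMod l) = 0 := by push_cast; linear_combination -h
    rw [ZMod.natCast_eq_zero_iff, Nat.prime_dvd_prime_iff_eq hlp Nat.prime_two] at h2
    exact hl2 h2
  have hnns : ¬ IsSquare (((p₀ * m : ℕ) : ℤ) : ZMod r) := by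
    apply (ZMod.nonsquare_iff_jacobiSym_eq_neg_one).1
    rw [Nat.cast_mul, jacobiSym.mul_left]
    have hm1 : jacobiSym (m : ℤ) r = 1 := by
      rw [jacobiSym.mod_right _ hrodd, Int.natAbs_natCast, hr8m]
      rcases Nat.lt_or_ge 1 (4 * m) with h | h
      · rw [Nat.mod_eq_of_lt h, jacobiSym.one_right]
      · omega
    rw [hm1, mul_one]
    by_cases h2 : p₀ = 2
    · have h5 := hr8' h2
      rw [h2]
      rw [Nat.cast_ofNat, jacobiSym.at_two hrodd, ZMod.χ₈_nat_eq_if_mod_eight]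
      rw [if_neg (by omega), if_neg (by omega)]
    · have hpo : Odd p₀ := hp.odd_of_ne_two h2
      rw [jacobiSym.quadratic_reciprocity_one_mod_four' hpo hr4]
      rw [← jacobiSym.legendreSym.to_jacobiSym, legendreSym.eq_neg_one_iff]
      exact_mod_cast hrns h2
  refine ⟨r, hrp, hr, hr4, hr8, hr8', hrns, ?_, hquart, ?_, ?_⟩
  · intro p hp' hpd hne
    have : p ∣ m := ((Nat.Prime.dvd_mul hp').1 hpd).resolve_left
      (fun h => hne ((Nat.prime_dvd_prime_iff_eq hp' hp).1 h))
    have h1 : r ≡ 1 [MOD p] := hr8m.of_dvd (this.mul_left 4)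
    exact_mod_cast (ZMod.natCast_eq_natCast_iff _ _ _).2 h1
  · have : IsSquare (l : ZMod r) := by
      rw [← ZMod.exists_sq_eq_prime_iff_of_mod_four_eq_one (p := l) (q :=
        r) hl4 (by rintro rfl; omega)]
      exact ⟨g, by rw [hrlz, pow_two]⟩
    obtain ⟨s, hs⟩ := this
    exact ⟨s, by rw [hs, pow_two]⟩
  · intro s hs
    have := isSquare_mul_of_not_isSquare hnns
      (fun h => hpow1 ((scholz_reciprocity hl4 hr4 hrl'.symm hAB hB hs).1 h))
    exact_mod_cast this

open NumberField

/-- `K = F(θ)` is a quadratic extension with `θ² = d`. -/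
structure IsQuadExt (F K : Type*) [Field F] [Field K] [Algebra F K] (d : F) (θ : K) : Prop where
  sq : θ ^ 2 = algebraMap F K d
  span : ∀ z : K, ∃ x y : F, z = algebraMap F K x + algebraMap F K y * θ
  not_isSquare : ¬ IsSquare d

namespace IsQuadExt

variable {F K : Type*} [Field F] [Field K] [Algebra F K] {d : F} {θ : K} (h : IsQuadExt F K d θ)

include h

theorem ne_zero : d ≠ 0 := by
  rintro rfl; exact h.not_isSquare IsSquare.zero

theorem eq_zero {x y : F} (hxy : algebraMap F K x + algebraMap F K y * θ = 0) : x = 0 ∧ y = 0 := by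
  have hinj := (algebraMap F K).injective
  by_cases hy : y = 0
  · subst hy
    rw [map_zero, zero_mul, add_zero] at hxy
    exact ⟨hinj (by rw [hxy, map_zero]), rfl⟩
  · exfalso
    apply h.not_isSquare
    refine ⟨x / y, hinj ?_⟩
    have hy' : algebraMap F K y ≠ 0 := by rwa [Ne, map_eq_zero]
    have hθ : θ = -(algebraMap F K x / algebraMap F K y) := by
      field_simp; linear_combination hxy
    rw [← h.sq, hθ, map_mul, map_div₀]; ring

/-- The basis `1, θ`. -/
noncomputable def basis : Module.Basis (Fin 2) F K :=
  Module.Basis.mk (v := ![1, θ])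
    (by
      rw [LinearIndependent.pair_iff]
      intro x y hxy
      apply h.eq_zero
      rw [← hxy, Algebra.smul_def, Algebra.smul_def, mul_one])
    (by
      intro z _
      obtain ⟨x, y, rfl⟩ := h.span z
      rw [Matrix.range_cons, Matrix.range_cons, Matrix.range_empty, Set.union_empty,
        Set.singleton_union, Submodule.mem_span_pair]
      exact ⟨x, y, by rw [Algebra.smul_def, Algebra.smul_def, mul_one]⟩)

theorem finrank_eq : Module.finrank F K = 2 := by
  rw [Module.finrank_eq_card_basis h.basis, Fintype.card_fin]

theorem basis_zero : h.basis 0 = 1 := by simp [basis]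

theorem basis_one : h.basis 1 = θ := by simp [basis]

theorem repr_eq (x y : F) :
    h.basis.repr (algebraMap F K x + algebraMap F K y * θ) =
      Finsupp.single 0 x + Finsupp.single 1 y := by
  have : algebraMap F K x + algebraMap F K y * θ = x • h.basis 0 + y • h.basis 1 := by
    rw [h.basis_zero, h.basis_one, Algebra.smul_def, Algebra.smul_def, mul_one]
  rw [this, map_add, map_smul, map_smul, Module.Basis.repr_self, Module.Basis.repr_self]
  simp

theorem leftMulMatrix_eq (x y : F) :
    Algebra.leftMulMatrix h.basis (algebraMap F K x + algebraMap F K y * θ) = !![x, d * y; y,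
      x] := by
  have h0 : (algebraMap F K x + algebraMap F K y * θ) * h.basis 0 =
      algebraMap F K x + algebraMap F K y * θ := by rw [h.basis_zero, mul_one]
  have h1 : (algebraMap F K x + algebraMap F K y * θ) * h.basis 1 =
      algebraMap F K (d * y) + algebraMap F K x * θ := by
    rw [h.basis_one, map_mul, ← h.sq]; ring
  ext i j
  rw [Algebra.leftMulMatrix_eq_repr_mul]
  fin_cases j
  · simp only [Fin.zero_eta]
    rw [h0, h.repr_eq]
    fin_cases i <;> simp
  · simp only [Fin.mk_one]
    rw [h1, h.repr_eq]
    fin_cases i <;> simp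

theorem norm_eq (x y : F) :
    Algebra.norm F (algebraMap F K x + algebraMap F K y * θ) = x ^ 2 - d * y ^ 2 := by
  rw [Algebra.norm_eq_matrix_det h.basis, h.leftMulMatrix_eq, Matrix.det_fin_two_of]
  ring

theorem trace_eq (x y : F) :
    Algebra.trace F K (algebraMap F K x + algebraMap F K y * θ) = 2 * x := by
  rw [Algebra.trace_eq_matrix_trace h.basis, h.leftMulMatrix_eq, Matrix.trace_fin_two_of]
  ring

theorem exists_norm_eq (z : K) : ∃ x y : F, Algebra.norm F z = x ^ 2 - d * y ^ 2 := by
  obtain ⟨x, y, rfl⟩ := h.span z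
  exact ⟨x, y, h.norm_eq x y⟩

/-- An element whose norm is a square in `F` lies in `F` up to squares. -/
theorem exists_algebraMap_eq_mul_sq {z : K} (hz : z ≠ 0) {c : F} (hc : Algebra.norm F z = c ^ 2)
    (h2 : (2 : F) ≠ 0) : ∃ a : F, a ≠ 0 ∧ ∃ w : K, w ≠ 0 ∧ algebraMap F K a = z * w ^ 2 := by
  obtain ⟨x, y, hxy⟩ := h.span z
  have hN : x ^ 2 - d * y ^ 2 = c ^ 2 := by rw [← h.norm_eq, ← hxy, hc]
  have hc0 : c ≠ 0 := by
    rintro rfl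
    have : Algebra.norm F z = 0 := by rw [hc, zero_pow two_ne_zero]
    have hfin : FiniteDimensional F K := Module.Finite.of_basis h.basis
    exact hz (Algebra.norm_eq_zero_iff.1 this)
  obtain ⟨e, he, hxe⟩ : ∃ e : F, e ^ 2 = c ^ 2 ∧ 2 * (x + e) ≠ 0 := by
    by_cases hxc : x + c = 0
    · refine ⟨-c, by ring, fun h' => ?_⟩
      have : 2 * (2 * c) = 0 := by linear_combination 2 * hxc - h'
      exact hc0 (by simpa [h2] using this)
    · exact ⟨c, rfl, mul_ne_zero h2 hxc⟩
  have hsq : (z + algebraMap F K e) ^ 2 = algebraMap F K (2 * (x + e)) * z := by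
    have h1 := congrArg (algebraMap F K) (hN.trans he.symm)
    simp only [map_mul, map_add, map_sub, map_pow, map_ofNat] at h1 ⊢
    rw [hxy]
    linear_combination algebraMap F K y ^ 2 * h.sq - h1
  have hne : algebraMap F K (2 * (x + e)) ≠ 0 := by rwa [Ne, map_eq_zero]
  refine ⟨2 * (x + e), hxe, (z + algebraMap F K e) / z, ?_, ?_⟩
  · intro h0
    rw [div_eq_zero_iff, or_iff_left hz] at h0
    rw [h0, zero_pow two_ne_zero] at hsq
    exact mul_ne_zero hne hz hsq.symm
  · rw [div_pow, hsq]; field_simp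

end IsQuadExt

theorem Ideal.eq_of_sq_eq_sq {R : Type*} [CommRing R] [IsDedekindDomain R] {I J : Ideal R}
    (hI : I ≠ 0) (hJ : J ≠ 0) (h : I ^ 2 = J ^ 2) : I = J := by
  classical
  rw [← associated_iff_eq,
    UniqueFactorizationMonoid.associated_iff_normalizedFactors_eq_normalizedFactors hI hJ]
  have := congrArg UniqueFactorizationMonoid.normalizedFactors h
  rw [UniqueFactorizationMonoid.normalizedFactors_pow,
    UniqueFactorizationMonoid.normalizedFactors_pow] at this
  exact nsmul_right_injective two_ne_zero this

theorem Ideal.exists_eq_prod_mul_sq {R : Type*} [CommRing R] [IsDedekindDomain R] (I : Ideal R)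
    (hI : I ≠ 0) : ∃ (J : Finset (Ideal R)) (C : Ideal R), (∀ p ∈ J, Prime p) ∧ C ≠ 0 ∧
      I = (∏ p ∈ J, p) * C ^ 2 := by
  classical
  induction I using UniqueFactorizationMonoid.induction_on_prime with
  | h₁ => exact absurd rfl hI
  | h₂ x hx => exact ⟨∅, 1, by simp, one_ne_zero, by
    rw [Finset.prod_empty, one_mul, one_pow, Ideal.one_eq_top, Ideal.isUnit_iff.1 hx]⟩
  | h₃ a p ha hp ih =>
    obtain ⟨J, C, hJ, hC, rfl⟩ := ih ha
    by_cases hpJ : p ∈ J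
    · refine ⟨J.erase p, p * C, fun q hq => hJ q (Finset.mem_of_mem_erase hq),
        mul_ne_zero hp.ne_zero hC, ?_⟩
      rw [← Finset.mul_prod_erase J _ hpJ]; ring
    · refine ⟨insert p J, C, ?_, hC, ?_⟩
      · intro q hq
        rcases Finset.mem_insert.1 hq with rfl | hq
        · exact hp
        · exact hJ q hq
      · rw [Finset.prod_insert hpJ, mul_assoc]

theorem Ideal.mem_iff_odd_multiplicity {R : Type*} [CommRing R] [IsDedekindDomain R]
    {J : Finset (Ideal R)} {C p : Ideal R} (hJ : ∀ p ∈ J, Prime p) (hC : C ≠ 0) (hp : Prime p) :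
    p ∈ J ↔ Odd (multiplicity p ((∏ q ∈ J, q) * C ^ 2)) := by
  classical
  have hprod : ∏ q ∈ J, q ≠ 0 := Finset.prod_ne_zero_iff.2 fun q hq => (hJ q hq).ne_zero
  have hC2 : C ^ 2 ≠ 0 := pow_ne_zero 2 hC
  rw [multiplicity_mul hp (FiniteMultiplicity.of_prime_left hp (mul_ne_zero hprod hC2)),
    FiniteMultiplicity.multiplicity_pow hp (FiniteMultiplicity.of_prime_left hp hC)]
  have hpq : ∀ q ∈ J, p ∣ q → p = q := fun q hq hd =>
    associated_iff_eq.1 (hp.associated_of_dvd (hJ q hq) hd)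
  by_cases hpJ : p ∈ J
  · rw [← Finset.mul_prod_erase J _ hpJ] at hprod ⊢
    rw [multiplicity_mul hp (FiniteMultiplicity.of_prime_left hp hprod)]
    have h0 : multiplicity p (∏ q ∈ J.erase p, q) = 0 := by
      rw [multiplicity_eq_zero, Prime.dvd_finsetProd_iff hp]
      rintro ⟨q, hq, hd⟩
      exact Finset.ne_of_mem_erase hq (hpq q (Finset.mem_of_mem_erase hq) hd).symm
    have h1 : multiplicity p p = 1 := multiplicity_self
    rw [h0, h1]
    simp only [hpJ, true_iff]
    exact ⟨multiplicity p C, by ring⟩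
  · have h0 : multiplicity p (∏ q ∈ J, q) = 0 := by
      rw [multiplicity_eq_zero, Prime.dvd_finsetProd_iff hp]
      rintro ⟨q, hq, hd⟩
      exact hpJ ((hpq q hq hd) ▸ hq)
    rw [h0, zero_add]
    simp only [hpJ, false_iff, Nat.not_odd_iff_even]
    exact even_two_mul _

section

variable {F K : Type*} [Field F] [Field K] [NumberField F] [NumberField K] [Algebra F K]

theorem even_multiplicity_of_map_eq_sq {a : Ideal (𝓞 F)} (ha : a ≠ 0) {Z A : Ideal (𝓞 K)}
    (hZ : Z ≠ 0) (hA : A ≠ 0) (haA : a.map (algebraMap (𝓞 F) (𝓞 K)) * Z ^ 2 = A ^ 2)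
    {p : Ideal (𝓞 F)} (hp : Prime p) {P : Ideal (𝓞 K)} (hP : Prime P)
    (hPp : P ∣ p.map (algebraMap (𝓞 F) (𝓞 K))) (hPp2 : ¬ P ^ 2 ∣ p.map (algebraMap (𝓞 F) (𝓞 K))) :
    Even (multiplicity p a) := by
  have hfin := FiniteMultiplicity.of_prime_left hp ha
  obtain ⟨b, hab, hb⟩ := hfin.exists_eq_pow_mul_and_not_dvd
  set f := algebraMap (𝓞 F) (𝓞 K)
  set k := multiplicity p a
  have hPb : ¬ P ∣ b.map f := by
    intro hPb
    apply hb
    rw [Ideal.dvd_iff_le] at hPb hPp ⊢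
    have hpm : p.IsMaximal := Ideal.IsPrime.isMaximal (Ideal.isPrime_of_prime hp) hp.ne_zero
    have hPprime : P.IsPrime := Ideal.isPrime_of_prime hP
    have : p = P.comap f :=
      hpm.eq_of_le (Ideal.IsPrime.ne_top (Ideal.comap_isPrime f P))
        (Ideal.map_le_iff_le_comap.1 hPp)
    rw [this]
    exact Ideal.map_le_iff_le_comap.1 hPb
  have hm1 : multiplicity P (p.map f) = 1 :=
    multiplicity_eq_of_dvd_of_not_dvd (by rwa [pow_one]) hPp2
  have hm0 : multiplicity P (b.map f) = 0 := multiplicity_eq_zero.2 hPb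
  have hA2 : A ^ 2 ≠ 0 := pow_ne_zero 2 hA
  rw [hab, Ideal.map_mul, Ideal.map_pow] at haA
  have h1 := congrArg (multiplicity P) haA
  have hne : (p.map f ^ k * b.map f) * Z ^ 2 ≠ 0 := by rw [haA]; exact hA2
  have hne1 := left_ne_zero_of_mul hne
  have hpm0 : p.map f ≠ 0 := by
    rw [Ideal.zero_eq_bot, Ne, Ideal.map_eq_bot_iff_of_injective
      (FaithfulSMul.algebraMap_injective (𝓞 F) (𝓞 K))]
    exact hp.ne_zero
  rw [multiplicity_mul hP (FiniteMultiplicity.of_prime_left hP hne),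
    multiplicity_mul hP (FiniteMultiplicity.of_prime_left hP hne1),
    FiniteMultiplicity.multiplicity_pow hP (FiniteMultiplicity.of_prime_left hP hpm0),
    FiniteMultiplicity.multiplicity_pow hP (FiniteMultiplicity.of_prime_left hP hZ),
    FiniteMultiplicity.multiplicity_pow hP (FiniteMultiplicity.of_prime_left hP hA), hm1, hm0] at h1
  exact ⟨multiplicity P A - multiplicity P Z, by omega⟩

theorem exists_span_eq_pow_card (I : Ideal (𝓞 F)) :
    ∃ x : 𝓞 F, Ideal.span {x} = I ^ Nat.card (ClassGroup (𝓞 F)) := by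
  by_cases hI : I = 0
  · exact ⟨0, by rw [hI, zero_pow Nat.card_pos.ne']; simp⟩
  · have hI' : I ∈ nonZeroDivisors (Ideal (𝓞 F)) := mem_nonZeroDivisors_of_ne_zero hI
    set N := Nat.card (ClassGroup (𝓞 F))
    have h1 : ClassGroup.mk0 (⟨I ^ N, pow_mem hI' N⟩ : nonZeroDivisors (Ideal (𝓞 F))) = 1 := by
      have : (⟨I ^ N, pow_mem hI' N⟩ : nonZeroDivisors (Ideal (𝓞 F))) = ⟨I, hI'⟩ ^ N := rfl
      rw [this, map_pow, pow_card_eq_one']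
    rw [ClassGroup.mk0_eq_one_iff] at h1
    obtain ⟨x, hx⟩ := h1.principal
    exact ⟨x, hx.symm⟩

/-- A generator of the class-number power of an ideal. -/
noncomputable def powGen (I : Ideal (𝓞 F)) : 𝓞 F := (exists_span_eq_pow_card I).choose

theorem span_powGen (I : Ideal (𝓞 F)) :
    Ideal.span {powGen I} = I ^ Nat.card (ClassGroup (𝓞 F)) :=
  (exists_span_eq_pow_card I).choose_spec

theorem powGen_ne_zero {I : Ideal (𝓞 F)} (hI : I ≠ 0) : powGen I ≠ 0 := by
  intro h
  have := span_powGen I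
  rw [h, Ideal.span_singleton_eq_bot.2 rfl] at this
  exact pow_ne_zero _ hI this.symm

/-- An element whose odd prime divisors lie in `S` is, up to squares, a unit times a product of
generators. -/
theorem exists_eq_unit_mul_prod (hodd : Odd (Nat.card (ClassGroup (𝓞 F)))) (S : Finset (Ideal
    (𝓞 F)))
    {a : 𝓞 F} (ha : a ≠ 0)
    (heven : ∀ p : Ideal (𝓞 F), Prime p → p ∉ S → Even (multiplicity p (Ideal.span {a}))) :
    ∃ u : (𝓞 F)ˣ, ∃ J ∈ S.powerset, ∃ w : F, w ≠ 0 ∧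
      (a : F) = (u : 𝓞 F) * (∏ p ∈ J, (powGen p : F)) * w ^ 2 := by
  have ha' : Ideal.span {a} ≠ 0 := by
    rw [Ideal.zero_eq_bot, Ne, Ideal.span_singleton_eq_bot]; exact ha
  obtain ⟨J, C, hJ, hC, hJC⟩ := Ideal.exists_eq_prod_mul_sq (Ideal.span {a}) ha'
  have hJS : J ⊆ S := by
    intro p hp
    by_contra hpS
    have := heven p (hJ p hp) hpS
    rw [hJC] at this
    exact Nat.not_odd_iff_even.2 this ((Ideal.mem_iff_odd_multiplicity hJ hC (hJ p hp)).1 hp)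
  obtain ⟨m, hm⟩ := hodd
  set h := Nat.card (ClassGroup (𝓞 F))
  have hspan : Ideal.span {a ^ h} = Ideal.span {(∏ p ∈ J, powGen p) * powGen C ^ 2} := by
    rw [← Ideal.span_singleton_pow, hJC, mul_pow, ← Ideal.span_singleton_mul_span_singleton,
      ← Ideal.span_singleton_pow, span_powGen, ← Ideal.prod_span_singleton,
      ← Finset.prod_pow, ← pow_mul, ← pow_mul, mul_comm 2]
    congr 1
    exact Finset.prod_congr rfl fun p _ => (span_powGen p).symm
  obtain ⟨u, hu⟩ := (Ideal.span_singleton_eq_span_singleton.1 hspan).symm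
  have haF : (a : F) ≠ 0 := by rwa [Ne, RingOfIntegers.coe_eq_zero_iff]
  have hCF : (powGen C : F) ≠ 0 := by
    rw [Ne, RingOfIntegers.coe_eq_zero_iff]; exact powGen_ne_zero hC
  refine ⟨u, J, Finset.mem_powerset.2 hJS, powGen C / (a : F) ^ m,
    div_ne_zero hCF (pow_ne_zero _ haF),
    ?_⟩
  have h1 := congrArg (algebraMap (𝓞 F) F) hu
  simp only [map_mul, map_pow, map_prod] at h1
  have h2 : (a : F) ^ h = (a : F) * ((a : F) ^ m) ^ 2 := by rw [hm]; ring
  rw [h2] at h1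
  rw [div_pow, ← mul_div_assoc, eq_div_iff (pow_ne_zero 2 (pow_ne_zero _ haF)), ← h1]
  ring

end

namespace NumberField.RingOfIntegers

variable {F : Type*} [Field F]

theorem val_zero : ((0 : 𝓞 F) : F) = 0 := rfl

theorem val_one : ((1 : 𝓞 F) : F) = 1 := rfl

theorem val_neg (x : 𝓞 F) : ((-x : 𝓞 F) : F) = -(x : F) := rfl

theorem val_add (x y : 𝓞 F) : ((x + y : 𝓞 F) : F) = (x : F) + y := rfl

theorem val_sub (x y : 𝓞 F) : ((x - y : 𝓞 F) : F) = (x : F) - y := rfl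

theorem val_mul (x y : 𝓞 F) : ((x * y : 𝓞 F) : F) = (x : F) * y := rfl

theorem val_pow (x : 𝓞 F) (k : ℕ) : ((x ^ k : 𝓞 F) : F) = (x : F) ^ k :=
  map_pow (algebraMap (𝓞 F) F) x k

theorem val_natCast (k : ℕ) : ((k : 𝓞 F) : F) = k := map_natCast (algebraMap (𝓞 F) F) k

theorem val_intCast (k : ℤ) : ((k : 𝓞 F) : F) = k := map_intCast (algebraMap (𝓞 F) F) k

theorem val_ne_zero {x : 𝓞 F} (hx : x ≠ 0) : (x : F) ≠ 0 := coe_ne_zero_iff.2 hx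

end NumberField.RingOfIntegers

section

open RingOfIntegers

variable {F K : Type*} [Field F] [Field K] [NumberField F] [NumberField K] [Algebra F K]

theorem exists_norm_eq_unit_mul_sq (hodd : Odd (Nat.card (ClassGroup (𝓞 F)))) {α : 𝓞 K} (hα : α ≠ 0)
    {A : Ideal (𝓞 K)} (hA : Ideal.span {α} = A ^ 2) :
    ∃ u : (𝓞 F)ˣ, ∃ c : F, c ≠ 0 ∧ Algebra.norm F (α : K) = ((u : 𝓞 F) : F) * c ^ 2 := by
  obtain ⟨m, hm⟩ := hodd
  set N := Nat.card (ClassGroup (𝓞 F))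
  set ν : Ideal (𝓞 K) →*₀ Ideal (𝓞 F) := Ideal.relNorm (𝓞 F)
  set x := Algebra.intNorm (𝓞 F) (𝓞 K) α
  have hx : (x : F) = Algebra.norm F (α : K) := Algebra.algebraMap_intNorm (A := 𝓞 F) (K :=
    F) (L := K) (B := 𝓞 K) α
  have hx0 : Algebra.norm F (α : K) ≠ 0 := by
    have : Module.Finite F K := inferInstance
    rw [Algebra.norm_ne_zero_iff, Ne, RingOfIntegers.coe_eq_zero_iff]; exact hα
  have h1 : Ideal.span {x} = ν A ^ 2 := by
    rw [← map_pow, ← hA]; exact (Ideal.relNorm_singleton (𝓞 F) α).symm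
  have h2 : Ideal.span {powGen (ν A) ^ 2} = Ideal.span {x ^ N} := by
    rw [← Ideal.span_singleton_pow, ← Ideal.span_singleton_pow, h1, span_powGen, ← pow_mul,
      ← pow_mul,
      mul_comm]
  obtain ⟨u, hu⟩ := Ideal.span_singleton_eq_span_singleton.1 h2
  have h3 := congrArg (algebraMap (𝓞 F) F) hu
  simp only [map_mul, map_pow] at h3
  have h4 : (x : F) ^ N = x * ((x : F) ^ m) ^ 2 := by rw [hm]; ring
  rw [h4, hx] at h3
  have h5 : (powGen (ν A) : F) ≠ 0 := by
    intro h0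
    change algebraMap _ F _ = 0 at h0
    rw [h0] at h3
    have := mul_ne_zero hx0 (pow_ne_zero 2 (pow_ne_zero m hx0))
    rw [← h3] at this
    simp at this
  refine ⟨u, powGen (ν A) / Algebra.norm F (α : K) ^ m, div_ne_zero h5 (pow_ne_zero _ hx0), ?_⟩
  rw [div_pow, ← mul_div_assoc, eq_div_iff (pow_ne_zero 2 (pow_ne_zero _ hx0)), ← h3]
  ring

theorem exists_smul_sq_eq_mul_prod {d : F} {θ : K} (h : IsQuadExt F K d θ) {D : 𝓞 F} (hD : (D :
    F) = d)
    (hodd : Odd (Nat.card (ClassGroup (𝓞 F)))) {𝔩 : Ideal (𝓞 F)}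
    (hD𝔩 : Odd (multiplicity 𝔩 (Ideal.span {D}))) (S : Finset (Ideal (𝓞 F)))
    (hunr : ∀ p : Ideal (𝓞 F), Prime p → p ∉ S → p ≠ 𝔩 → ∃ P : Ideal (𝓞 K), Prime P ∧
      P ∣ p.map (algebraMap (𝓞 F) (𝓞 K)) ∧ ¬ P ^ 2 ∣ p.map (algebraMap (𝓞 F) (𝓞 K)))
    {U : Finset F} (hU : ∀ u : (𝓞 F)ˣ, ∃ η ∈ U, ∃ w : F, w ≠ 0 ∧ ((u : 𝓞 F) : F) = η * w ^ 2)
    {γ : 𝓞 K} (hγ : γ ≠ 0) {C : Ideal (𝓞 K)} (hC : Ideal.span {γ} = C ^ 2) {c : F}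
    (hc : Algebra.norm F (γ : K) = c ^ 2) :
    ∃ η ∈ U, ∃ J ∈ S.powerset, ∃ w : K, w ≠ 0 ∧
      (γ : K) * w ^ 2 = algebraMap F K (η * ∏ p ∈ J, (powGen p : F)) := by
  have hγK : (γ : K) ≠ 0 := by rwa [Ne, RingOfIntegers.coe_eq_zero_iff]
  have hd0 := h.ne_zero
  have hD0 : D ≠ 0 := by rintro rfl; exact hd0 hD.symm
  have hinj : Function.Injective (algebraMap (𝓞 F) (𝓞 K)) := FaithfulSMul.algebraMap_injective _ _
  obtain ⟨a₁, ha₁, w₁, hw₁, haw⟩ := h.exists_algebraMap_eq_mul_sq hγK hc two_ne_zero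
  obtain ⟨x, y, hy, hxy⟩ := IsFractionRing.div_surjective (A := 𝓞 F) a₁
  obtain ⟨r, t, ht, hrt⟩ := IsFractionRing.div_surjective (A := 𝓞 K) w₁
  have hy0 : y ≠ 0 := nonZeroDivisors.ne_zero hy
  have ht0 : t ≠ 0 := nonZeroDivisors.ne_zero ht
  have hyF : (y : F) ≠ 0 := by rwa [Ne, RingOfIntegers.coe_eq_zero_iff]
  have htK : (t : K) ≠ 0 := by rwa [Ne, RingOfIntegers.coe_eq_zero_iff]
  have hr0 : r ≠ 0 := by
    rintro rfl
    exact hw₁ (by rw [← hrt, map_zero, zero_div])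
  have hx0 : x ≠ 0 := by
    rintro rfl
    exact ha₁ (by rw [← hxy, map_zero, zero_div])
  have hrK : (r : K) ≠ 0 := by rwa [Ne, RingOfIntegers.coe_eq_zero_iff]
  have hcomm : ∀ z : 𝓞 F, algebraMap F K (z : F) = ((algebraMap (𝓞 F) (𝓞 K) z : 𝓞 K) : K) :=
    fun z => rfl
  have hyK : ((algebraMap (𝓞 F) (𝓞 K) y : 𝓞 K) : K) ≠ 0 := by
    rw [← hcomm, Ne, map_eq_zero]; exact hyF
  have hxyF : ((x * y : 𝓞 F) : F) = a₁ * (y : F) ^ 2 := by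
    have : (x : F) / y = a₁ := hxy
    rw [← this, val_mul]; field_simp
  have key : algebraMap (𝓞 F) (𝓞 K) (x * y) * t ^ 2 = γ * (r * algebraMap (𝓞 F) (𝓞 K) y) ^ 2 := by
    apply RingOfIntegers.ext
    have hrt' : (r : K) / t = w₁ := hrt
    rw [val_mul, val_mul, val_pow, val_pow, val_mul, ← hcomm, ← hcomm, hxyF, map_mul, haw,
      map_pow, ← hrt']
    field_simp
  have heven : ∀ p : Ideal (𝓞 F), Prime p → p ∉ S → p ≠ 𝔩 →
      Even (multiplicity p (Ideal.span {x * y})) := by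
    intro p hp hpS hp𝔩
    obtain ⟨P, hP, hPp, hPp2⟩ := hunr p hp hpS hp𝔩
    refine even_multiplicity_of_map_eq_sq (Z := Ideal.span {t})
      (A := C * Ideal.span {r * algebraMap (𝓞 F) (𝓞 K) y}) ?_ ?_ ?_ ?_ hp hP hPp hPp2
    · rw [Ideal.zero_eq_bot, Ne, Ideal.span_singleton_eq_bot]; exact mul_ne_zero hx0 hy0
    · rwa [Ideal.zero_eq_bot, Ne, Ideal.span_singleton_eq_bot]
    · refine mul_ne_zero ?_ ?_
      · rintro rfl
        rw [zero_pow two_ne_zero, Ideal.zero_eq_bot, Ideal.span_singleton_eq_bot] at hC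
        exact hγ hC
      · rw [Ideal.zero_eq_bot, Ne, Ideal.span_singleton_eq_bot]
        exact mul_ne_zero hr0 (by rwa [Ne, map_eq_zero_iff _ hinj])
    · rw [Ideal.map_span, Set.image_singleton, Ideal.span_singleton_pow,
        Ideal.span_singleton_mul_span_singleton, key, mul_pow C, ← hC, Ideal.span_singleton_pow,
        Ideal.span_singleton_mul_span_singleton]
  have hθint : IsIntegral ℤ θ := by
    apply IsIntegral.of_pow two_pos
    rw [h.sq, ← hD]
    exact (RingOfIntegers.isIntegral_coe D).algebraMap
  obtain ⟨Θ, hΘ⟩ : ∃ Θ : 𝓞 K, (Θ : K) = θ := ⟨⟨θ, hθint⟩, rfl⟩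
  have hΘ2 : algebraMap (𝓞 F) (𝓞 K) D = Θ ^ 2 := by
    apply RingOfIntegers.ext
    rw [← hcomm, hD, val_pow, hΘ, h.sq]
  have hθ0 : θ ≠ 0 := by
    rintro rfl
    have := h.sq
    rw [zero_pow two_ne_zero, eq_comm, map_eq_zero] at this
    exact hd0 this
  have hΘ0 : Θ ≠ 0 := by rintro rfl; exact hθ0 hΘ.symm
  have hevenD : ∀ p : Ideal (𝓞 F), Prime p → p ∉ S → p ≠ 𝔩 →
      Even (multiplicity p (Ideal.span {D})) := by
    intro p hp hpS hp𝔩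
    obtain ⟨P, hP, hPp, hPp2⟩ := hunr p hp hpS hp𝔩
    refine even_multiplicity_of_map_eq_sq (Z := 1)
      (A := Ideal.span {Θ}) ?_ one_ne_zero ?_ ?_ hp hP hPp hPp2
    · rwa [Ideal.zero_eq_bot, Ne, Ideal.span_singleton_eq_bot]
    · rwa [Ideal.zero_eq_bot, Ne, Ideal.span_singleton_eq_bot]
    · rw [Ideal.map_span, Set.image_singleton, Ideal.span_singleton_pow, hΘ2, one_pow, mul_one]
  obtain ⟨b, hb0, v, hv, hbv, hbeven⟩ : ∃ b : 𝓞 F, b ≠ 0 ∧ ∃ v : K, v ≠ 0 ∧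
      algebraMap F K b = γ * v ^ 2 ∧
      ∀ p : Ideal (𝓞 F), Prime p → p ∉ S → Even (multiplicity p (Ideal.span {b})) := by
    have hxyK : algebraMap F K ((x * y : 𝓞 F) : F) = γ * (w₁ * algebraMap F K y) ^ 2 := by
      rw [hxyF, map_mul, map_pow, haw]; ring
    have hw₁y : w₁ * algebraMap F K y ≠ 0 := mul_ne_zero hw₁ hyK
    by_cases hpar : Even (multiplicity 𝔩 (Ideal.span {x * y}))
    · refine ⟨x * y, mul_ne_zero hx0 hy0, _, hw₁y, hxyK, ?_⟩
      intro p hp hpS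
      by_cases hp𝔩 : p = 𝔩
      · rw [hp𝔩]; exact hpar
      · exact heven p hp hpS hp𝔩
    · refine ⟨x * y * D, mul_ne_zero (mul_ne_zero hx0 hy0) hD0, w₁ * algebraMap F K y * θ,
        mul_ne_zero hw₁y hθ0, ?_, ?_⟩
      · rw [val_mul, hD, map_mul, hxyK, ← h.sq]; ring
      · intro p hp hpS
        rw [← Ideal.span_singleton_mul_span_singleton, multiplicity_mul hp
          (FiniteMultiplicity.of_prime_left hp ?_)]
        · by_cases hp𝔩 : p = 𝔩
          · rw [hp𝔩]; exact (Nat.not_even_iff_odd.1 hpar).add_odd hD𝔩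
          · exact (heven p hp hpS hp𝔩).add (hevenD p hp hpS hp𝔩)
        · rw [Ideal.span_singleton_mul_span_singleton, Ideal.zero_eq_bot, Ne,
            Ideal.span_singleton_eq_bot]
          exact mul_ne_zero (mul_ne_zero hx0 hy0) hD0
  obtain ⟨u, J, hJ, w, hw, hbw⟩ := exists_eq_unit_mul_prod hodd S hb0 hbeven
  obtain ⟨η, hη, z, hz, huz⟩ := hU u
  have hwK : algebraMap F K w ≠ 0 := by rwa [Ne, map_eq_zero]
  have hzK : algebraMap F K z ≠ 0 := by rwa [Ne, map_eq_zero]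
  refine ⟨η, hη, J, hJ, v / (algebraMap F K w * algebraMap F K z),
    div_ne_zero hv (mul_ne_zero hwK hzK), ?_⟩
  rw [hbw, huz] at hbv
  rw [div_pow, ← mul_div_assoc, ← hbv, div_eq_iff (pow_ne_zero 2 (mul_ne_zero hwK hzK))]
  simp only [map_mul, map_pow, map_prod]
  ring

theorem card_twoTorsion_mul_le {d : F} {θ : K} (h : IsQuadExt F K d θ) {D : 𝓞 F} (hD : (D : F) = d)
    (hodd : Odd (Nat.card (ClassGroup (𝓞 F)))) {𝔩 : Ideal (𝓞 F)}
    (hD𝔩 : Odd (multiplicity 𝔩 (Ideal.span {D}))) (S : Finset (Ideal (𝓞 F)))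
    (hunr : ∀ p : Ideal (𝓞 F), Prime p → p ∉ S → p ≠ 𝔩 → ∃ P : Ideal (𝓞 K), Prime P ∧
      P ∣ p.map (algebraMap (𝓞 F) (𝓞 K)) ∧ ¬ P ^ 2 ∣ p.map (algebraMap (𝓞 F) (𝓞 K)))
    {U T : Finset F} (hU : ∀ u : (𝓞 F)ˣ, ∃ η ∈ U, ∃ w : F, w ≠ 0 ∧ ((u : 𝓞 F) : F) = η * w ^ 2)
    (hT : ∀ u : (𝓞 F)ˣ, (∃ x y : F, ((u : 𝓞 F) : F) = x ^ 2 - d * y ^ 2) →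
      ∃ η ∈ T, ∃ w : F, w ≠ 0 ∧ ((u : 𝓞 F) : F) = η * w ^ 2)
    {ι : Type*} [Finite ι] (e : ι → (𝓞 K)ˣ)
    (he : ∀ i j, (∃ t : K, ((e i : 𝓞 K) : K) = ((e j : 𝓞 K) : K) * t ^ 2) → i = j) :
    Nat.card {x : ClassGroup (𝓞 K) // x ^ 2 = 1} * Nat.card ι ≤ T.card * U.card * 2 ^ S.card := by
  classical
  have hcl : ∀ x : {x : ClassGroup (𝓞 K) // x ^ 2 = 1}, ∃ A : Ideal (𝓞 K),
      ∃ hA : A ∈ nonZeroDivisors (Ideal (𝓞 K)), ∃ α : 𝓞 K, α ≠ 0 ∧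
      ClassGroup.mk0 ⟨A, hA⟩ = x.1 ∧ Ideal.span {α} = A ^ 2 := by
    rintro ⟨x, hx⟩
    obtain ⟨⟨A, hA⟩, rfl⟩ := ClassGroup.mk0_surjective x
    have h1 : ClassGroup.mk0 (⟨A ^ 2, pow_mem hA 2⟩ : nonZeroDivisors (Ideal (𝓞 K))) = 1 := by
      rw [← hx, ← map_pow]; rfl
    rw [ClassGroup.mk0_eq_one_iff] at h1
    obtain ⟨α, hα⟩ := h1.principal
    refine ⟨A, hA, α, ?_, rfl, hα.symm⟩
    rintro rfl
    have : A ^ 2 = 0 := by rw [Ideal.zero_eq_bot]; simpa using hα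
    exact pow_ne_zero 2 (nonZeroDivisors.ne_zero hA) this
  choose A hA α hα0 hAx hαA using hcl
  have hunit : ∀ i, ((e i : 𝓞 K) : K) ≠ 0 := fun i => by
    rw [Ne, RingOfIntegers.coe_eq_zero_iff]; exact (e i).ne_zero
  set γ : {x : ClassGroup (𝓞 K) // x ^ 2 = 1} × ι → 𝓞 K := fun p => α p.1 * e p.2
  have hγ0 : ∀ p, γ p ≠ 0 := fun p => mul_ne_zero (hα0 _) (e p.2).ne_zero
  have hγA : ∀ p, Ideal.span {γ p} = A p.1 ^ 2 := by
    intro p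
    rw [← hαA, Ideal.span_singleton_mul_right_unit (e p.2).isUnit]
  have htype : ∀ p, ∃ η : T, ∃ c : F, Algebra.norm F (γ p : K) = η * c ^ 2 := by
    intro p
    obtain ⟨u, c, hc, huc⟩ := exists_norm_eq_unit_mul_sq hodd (hγ0 p) (hγA p)
    obtain ⟨x, y, hxy⟩ := h.exists_norm_eq (γ p : K)
    obtain ⟨η, hη, w, hw, huw⟩ := hT u ⟨x / c, y / c, by
      field_simp
      rw [← hxy, huc]⟩
    exact ⟨⟨η, hη⟩, w * c, by rw [huc, huw]; ring⟩
  choose τ c hτ using htype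
  let base : T → 𝓞 K := fun t => if ht : ∃ p, τ p = t then γ ht.choose else 1
  have hbase : ∀ p, ∃ q, base (τ p) = γ q ∧ τ q = τ p := by
    intro p
    have ht : ∃ q, τ q = τ p := ⟨p, rfl⟩
    exact ⟨ht.choose, by simp only [base]; rw [dif_pos ht], ht.choose_spec⟩
  have hsec : ∀ p, ∃ ηJ : U × S.powerset, ∃ w : K, w ≠ 0 ∧
      ((γ p * base (τ p) : 𝓞 K) : K) * w ^ 2 =
        algebraMap F K (ηJ.1 * ∏ q ∈ ηJ.2.1, (powGen q : F)) := by
    intro p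
    obtain ⟨q, hq, hτq⟩ := hbase p
    rw [hq]
    have hspan : Ideal.span {γ p * γ q} = (A p.1 * A q.1) ^ 2 := by
      rw [← Ideal.span_singleton_mul_span_singleton, hγA, hγA, mul_pow]
    have hnorm : Algebra.norm F ((γ p * γ q : 𝓞 K) : K) = ((τ p : F) * c p * c q) ^ 2 := by
      rw [val_mul, map_mul, hτ p, hτ q, hτq]; ring
    obtain ⟨η, hη, J, hJ, w, hw, hew⟩ := exists_smul_sq_eq_mul_prod h hD hodd hD𝔩 S hunr hU
      (mul_ne_zero (hγ0 p) (hγ0 q)) hspan hnorm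
    exact ⟨⟨⟨η, hη⟩, ⟨J, hJ⟩⟩, w, hw, hew⟩
  choose σ w hw hσ using hsec
  have hinj : Function.Injective fun p => (τ p, σ p) := by
    rintro p q hpq
    obtain ⟨hτpq, hσpq⟩ := Prod.ext_iff.1 hpq
    simp only at hτpq hσpq
    have hp := hσ p
    rw [hσpq, ← hσ q, hτpq, val_mul (γ p), val_mul (γ q)] at hp
    have hb0 : (base (τ q) : K) ≠ 0 := by
      obtain ⟨q', hq', -⟩ := hbase q
      rw [hq', Ne, RingOfIntegers.coe_eq_zero_iff]
      exact hγ0 q'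
    have hpq' : (γ p : K) * w p ^ 2 = γ q * w q ^ 2 :=
      mul_right_cancel₀ hb0 (by linear_combination hp)
    have hw0 := hw p
    have hγt : (γ p : K) = γ q * (w q / w p) ^ 2 := by
      field_simp; exact hpq'
    set t := w q / w p
    have ht0 : t ≠ 0 := div_ne_zero (hw q) hw0
    obtain ⟨x, y, hy, hxy⟩ := IsFractionRing.div_surjective (A := 𝓞 K) t
    have hy0 : y ≠ 0 := nonZeroDivisors.ne_zero hy
    have hyK : (y : K) ≠ 0 := by rwa [Ne, RingOfIntegers.coe_eq_zero_iff]
    have hx0 : x ≠ 0 := by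
      rintro rfl
      exact ht0 (by rw [← hxy, map_zero, zero_div])
    have hγxy : γ p * y ^ 2 = γ q * x ^ 2 := by
      apply RingOfIntegers.ext
      have hxy' : (x : K) / y = t := hxy
      rw [val_mul (γ p), val_mul (γ q), val_pow, val_pow, hγt, ← hxy']
      field_simp
    have hx' : Ideal.span {x} ≠ 0 := by rwa [Ideal.zero_eq_bot, Ne, Ideal.span_singleton_eq_bot]
    have hy' : Ideal.span {y} ≠ 0 := by rwa [Ideal.zero_eq_bot, Ne, Ideal.span_singleton_eq_bot]
    have hid : (Ideal.span {y} * A p.1) = (Ideal.span {x} * A q.1) := by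
      apply Ideal.eq_of_sq_eq_sq (mul_ne_zero hy' (nonZeroDivisors.ne_zero (hA _)))
        (mul_ne_zero hx' (nonZeroDivisors.ne_zero (hA _)))
      rw [mul_pow, mul_pow, ← hγA, ← hγA, Ideal.span_singleton_pow, Ideal.span_singleton_pow,
        Ideal.span_singleton_mul_span_singleton, Ideal.span_singleton_mul_span_singleton,
        mul_comm, hγxy, mul_comm]
    have h1 : p.1 = q.1 := by
      apply Subtype.ext
      rw [← hAx, ← hAx, ClassGroup.mk0_eq_mk0_iff]
      exact ⟨y, x, hy0, hx0, hid⟩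
    have h2 : p.2 = q.2 := by
      apply he
      refine ⟨t, ?_⟩
      have hα : (α q.1 : K) ≠ 0 := by rw [Ne, RingOfIntegers.coe_eq_zero_iff]; exact hα0 _
      simp only [γ, h1, val_mul] at hγt
      exact mul_left_cancel₀ hα (by linear_combination hγt)
    exact Prod.ext h1 h2
  have := Nat.card_le_card_of_injective _ hinj
  rw [Nat.card_prod, Nat.card_prod, Nat.card_prod] at this
  rwa [Nat.card_eq_fintype_card (α := T), Nat.card_eq_fintype_card (α := U),
    Nat.card_eq_fintype_card (α := S.powerset), Fintype.card_coe, Fintype.card_coe,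
      Fintype.card_coe,
    Finset.card_powerset, ← mul_assoc] at this

end

section

open RingOfIntegers

variable {F K : Type*} [Field F] [Field K] [NumberField F] [NumberField K] [Algebra F K]

theorem exists_prime_not_sq_dvd_map {ω : 𝓞 K} {b c : 𝓞 F}
    (hω : ω ^ 2 - algebraMap (𝓞 F) (𝓞 K) b * ω + algebraMap (𝓞 F) (𝓞 K) c = 0)
    (hspan : ∀ z : K, ∃ x y : F, z = algebraMap F K x + algebraMap F K y * ω)
    {p : Ideal (𝓞 F)} (hp : Prime p) (hD : b ^ 2 - 4 * c ∉ p) :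
    ∃ P : Ideal (𝓞 K), Prime P ∧ P ∣ p.map (algebraMap (𝓞 F) (𝓞 K)) ∧
      ¬ P ^ 2 ∣ p.map (algebraMap (𝓞 F) (𝓞 K)) := by
  have hpm : p.IsMaximal := Ideal.IsPrime.isMaximal (Ideal.isPrime_of_prime hp) hp.ne_zero
  obtain ⟨P, hPm, hPp⟩ := Ideal.exists_maximal_ideal_liesOver_of_isIntegral (S := 𝓞 K) p
  have hover : p = P.comap (algebraMap (𝓞 F) (𝓞 K)) := hPp.over
  have hle : p.map (algebraMap (𝓞 F) (𝓞 K)) ≤ P := Ideal.map_le_iff_le_comap.2 hover.le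
  have hP0 : P ≠ ⊥ := by
    rintro rfl
    apply hp.ne_zero
    rw [hover, Ideal.zero_eq_bot, eq_bot_iff]
    intro x hx
    rw [Ideal.mem_comap, Ideal.mem_bot, map_eq_zero_iff _
      (FaithfulSMul.algebraMap_injective _ _)] at hx
    exact hx
  refine ⟨P, Ideal.prime_of_isPrime hP0 hPm.isPrime, Ideal.dvd_iff_le.2 hle, fun hdvd => ?_⟩
  have h1 := pow_sub_one_dvd_differentIdeal (𝓞 F) P 2 hp.ne_zero hdvd
  rw [show 2 - 1 = 1 from rfl, pow_one, Ideal.dvd_iff_le] at h1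
  have hadj : Algebra.adjoin F {algebraMap (𝓞 K) K ω} = ⊤ := by
    rw [eq_top_iff]
    rintro z -
    obtain ⟨x, y, rfl⟩ := hspan z
    exact add_mem (Subalgebra.algebraMap_mem _ x) (mul_mem (Subalgebra.algebraMap_mem _ y)
      (Algebra.subset_adjoin rfl))
  have h2 := h1 (aeval_derivative_mem_differentIdeal (𝓞 F) F K ω hadj)
  set g : Polynomial (𝓞 F) := Polynomial.X ^ 2 - Polynomial.C b * Polynomial.X + Polynomial.C c
  have hg : Polynomial.aeval ω g = 0 := by simp [g, hω]
  obtain ⟨q, hq⟩ := minpoly.isIntegrallyClosed_dvd (Algebra.IsIntegral.isIntegral ω) hg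
  have h3 : Polynomial.aeval ω (Polynomial.derivative g) ∈ P := by
    rw [hq, Polynomial.derivative_mul, map_add, map_mul, map_mul, minpoly.aeval, zero_mul, add_zero]
    exact Ideal.mul_mem_right _ _ h2
  have h4 : Polynomial.aeval ω (Polynomial.derivative g) = 2 * ω - algebraMap (𝓞 F) (𝓞 K) b := by
    simp only [g, Polynomial.derivative_add, Polynomial.derivative_X_sq,
      Polynomial.derivative_C_mul, Polynomial.derivative_X, Polynomial.derivative_C, mul_one,
        add_zero,
      map_sub, map_mul, Polynomial.aeval_X, Polynomial.aeval_C, map_ofNat]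
  rw [h4] at h3
  apply hD
  rw [hover, Ideal.mem_comap]
  have h5 : algebraMap (𝓞 F) (𝓞 K) (b ^ 2 - 4 * c) = (2 * ω - algebraMap (𝓞 F) (𝓞 K) b) *
      (2 * ω - algebraMap (𝓞 F) (𝓞 K) b) := by
    simp only [map_sub, map_pow, map_mul, map_ofNat]
    linear_combination -4 * hω
  rw [h5]
  exact Ideal.mul_mem_right _ _ h3

end

section

/-- Representatives of the units modulo squares. -/
noncomputable def unitFamily (K : Type*) [Field K] [NumberField K] :
    (Fin (Units.rank K) → Fin 2) × Fin 2 → (𝓞 K)ˣ :=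
  fun p => (-1) ^ (p.2 : ℕ) * ∏ i, Units.fundSystem K i ^ (p.1 i : ℕ)

theorem exists_unit_eq_mul_sq {K : Type*} [Field K] {u v : (𝓞 K)ˣ} {t : K} (h : ((u : 𝓞 K) : K) =
    ((v : 𝓞 K) : K) * t ^ 2) :
    ∃ w : (𝓞 K)ˣ, u = v * w ^ 2 := by
  have h1 : t ^ 2 = (((u * v⁻¹ : (𝓞 K)ˣ) : 𝓞 K) : K) := by
    have : (((v⁻¹ : (𝓞 K)ˣ) : 𝓞 K) : K) * ((v : 𝓞 K) : K) = 1 := by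
      rw [← RingOfIntegers.val_mul, Units.inv_mul, RingOfIntegers.val_one]
    rw [Units.val_mul, RingOfIntegers.val_mul, h]
    linear_combination -t ^ 2 * this
  have ht : IsIntegral ℤ t := IsIntegral.of_pow two_pos (by
    rw [h1]; exact RingOfIntegers.isIntegral_coe _)
  obtain ⟨T, rfl⟩ : ∃ T : 𝓞 K, (T : K) = t := ⟨⟨t, ht⟩, rfl⟩
  have h2 : T ^ 2 = ((u * v⁻¹ : (𝓞 K)ˣ) : 𝓞 K) := by
    apply RingOfIntegers.ext
    rw [RingOfIntegers.val_pow]; exact h1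
  have h3 : IsUnit T := by
    rw [← isUnit_pow_iff two_ne_zero, h2]; exact Units.isUnit _
  obtain ⟨w, rfl⟩ := h3
  refine ⟨w, ?_⟩
  rw [← Units.val_pow_eq_pow_val, Units.val_inj] at h2
  rw [h2, mul_comm, inv_mul_cancel_right]

theorem neg_one_pow_mem_torsion {K : Type*} [Field K] (k : ℕ) : (-1 :
    (𝓞 K)ˣ) ^ k ∈ Units.torsion K := by
  apply pow_mem
  rw [Units.torsion, CommGroup.mem_torsion, isOfFinOrder_iff_pow_eq_one]
  exact ⟨2, two_pos, by norm_num⟩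

theorem unitFamily_injective {K : Type*} [Field K] [NumberField K] (φ : K →+* ℝ) (i j) {t : K}
    (h : ((unitFamily K i : 𝓞 K) : K) = ((unitFamily K j : 𝓞 K) : K) * t ^ 2) : i = j := by
  obtain ⟨w, hw⟩ := exists_unit_eq_mul_sq h
  have h2 : i.1 = j.1 := by
    obtain ⟨⟨ζ, g⟩, hg, -⟩ := Units.exist_unique_eq_mul_prod K w
    have e1 := Units.fun_eq_repr K (x := unitFamily K i) (f := fun k => ((i.1 k : ℕ) : ℤ))
      (neg_one_pow_mem_torsion (i.2 : ℕ)) (by simp only [unitFamily, zpow_natCast])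
    have e2 := Units.fun_eq_repr K (x := unitFamily K i) (f := fun k => ((j.1 k : ℕ) : ℤ) + g k * 2)
      (mul_mem (neg_one_pow_mem_torsion (j.2 : ℕ)) (pow_mem ζ.2 2)) (by
        rw [hw, hg]
        simp only [unitFamily, zpow_natCast, zpow_add, zpow_mul, Finset.prod_mul_distrib, mul_pow,
          ← Finset.prod_pow, zpow_ofNat]
        exact mul_mul_mul_comm _ _ _ _)
    funext k
    have h4 := congrFun (e1.trans e2.symm) k
    apply Fin.ext
    beta_reduce at h4
    omega
  have h3 : i.2 = j.2 := by
    rw [unitFamily, unitFamily, h2] at h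
    by_contra hne
    have hpos : ∀ x : (𝓞 K)ˣ, 0 < φ ((x : 𝓞 K) : K) ^ 2 := fun x => by
      have : φ ((x : 𝓞 K) : K) ≠ 0 := by
        rw [Ne, map_eq_zero]; exact RingOfIntegers.val_ne_zero x.ne_zero
      positivity
    have h5 := congrArg φ h
    rw [Units.val_mul, Units.val_mul, RingOfIntegers.val_mul, RingOfIntegers.val_mul, map_mul,
      map_mul,
      map_mul, map_pow] at h5
    have h6 := hpos (∏ k, Units.fundSystem K k ^ (j.1 k : ℕ))
    have hx : ∀ k : Fin 2, φ ((((-1) ^ (k : ℕ) : (𝓞 K)ˣ) : 𝓞 K) : K) = (-1) ^ (k : ℕ) := by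
      intro k
      rw [Units.val_pow_eq_pow_val, RingOfIntegers.val_pow, map_pow, Units.val_neg, Units.val_one,
        RingOfIntegers.val_neg, RingOfIntegers.val_one, map_neg, map_one]
    rw [hx, hx] at h5
    set y := φ (((∏ k, Units.fundSystem K k ^ (j.1 k : ℕ) : (𝓞 K)ˣ) : 𝓞 K) : K)
    have hy : y ≠ 0 := by rintro h0; rw [h0] at h6; simp at h6
    have h7 : (-1 : ℝ) ^ (i.2 : ℕ) = (-1) ^ (j.2 : ℕ) * φ t ^ 2 := by
      apply mul_right_cancel₀ hy; linear_combination h5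
    generalize i.2 = a at *
    generalize j.2 = b at *
    have h8 := sq_nonneg (φ t)
    fin_cases a <;> fin_cases b <;> simp at hne h7 <;> nlinarith
  exact Prod.ext h2 h3

theorem card_unitFamily_index {K : Type*} [Field K] [NumberField K] [IsTotallyReal K] :
    Nat.card ((Fin (Units.rank K) → Fin 2) × Fin 2) = 2 ^ Module.finrank ℚ K := by
  rw [Nat.card_prod, Nat.card_fun, Nat.card_fin, Nat.card_fin, ← pow_succ, Units.rank,
    Nat.sub_add_cancel Fintype.card_pos,
    InfinitePlace.card_eq_nrRealPlaces_add_nrComplexPlaces, IsTotallyReal.nrComplexPlaces_eq_zero,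
    add_zero, IsTotallyReal.finrank]

end

theorem Nat.mod_four_eq_one_of_forall_prime {B : ℕ} (hB : B ≠ 0)
    (h : ∀ p : ℕ, p.Prime → p ∣ B → p % 4 = 1) : B % 4 = 1 := by
  induction B using induction_on_primes with
  | zero => exact absurd rfl hB
  | one => rfl
  | prime_mul p a hp ih =>
    have h1 := h p hp (dvd_mul_right _ _)
    have h2 := ih (right_ne_zero_of_mul hB) fun q hq hqa => h q hq (hqa.mul_left p)
    rw [Nat.mul_mod, h1, h2]

theorem mod_four_eq_one_of_sq_add_one {l A B : ℕ} (h : A ^ 2 + 1 = l * B ^ 2) (hB : B % 2 = 1) :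
    B % 4 = 1 := by
  apply Nat.mod_four_eq_one_of_forall_prime (by rintro rfl; simp at hB)
  intro p hp hpB
  have : Fact p.Prime := ⟨hp⟩
  have h1 : (A : ZMod p) ^ 2 = -1 := by
    have h2 := congrArg (Nat.cast : ℕ → ZMod p) h
    push_cast at h2
    rw [(ZMod.natCast_eq_zero_iff B p).2 hpB] at h2
    linear_combination h2
  have h2 := ZMod.mod_four_ne_three_of_sq_eq_neg_one h1
  have h3 : p % 2 = 1 := by
    rcases hp.eq_two_or_odd with rfl | h3
    · omega
    · exact h3
  omega

section

open IntermediateField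

variable {l : ℕ} {ε₀ : ℝ}

theorem Rat.exists_int_of_isIntegral {q : ℚ} (h : IsIntegral ℤ (q : ℝ)) : ∃ a : ℤ, q = a := by
  have h1 : IsIntegral ℤ q := by
    rw [← isIntegral_algebraMap_iff (algebraMap ℚ ℝ).injective]; exact h
  obtain ⟨a, ha⟩ := IsIntegrallyClosed.isIntegral_iff.1 h1
  exact ⟨a, ha.symm⟩

theorem IsFundamentalUnit.exists_eq (hl : l.Prime) (hl8 : l % 8 = 1) (hε : IsFundamentalUnit l ε₀)
    (hεnorm : ∃ u v : ℚ, ε₀ = (u : ℝ) + (v : ℝ) * Real.sqrt (l : ℝ) ∧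
      (u : ℝ) ^ 2 - (v : ℝ) ^ 2 * (l : ℝ) = -1) :
    ∃ A B : ℕ, ε₀ = A + B * √(l : ℝ) ∧ A ^ 2 + 1 = l * B ^ 2 ∧ 4 ∣ A ∧ B % 4 = 1 ∧ 0 < A := by
  obtain ⟨u, v, huv, hnorm⟩ := hεnorm
  obtain ⟨h1, -, hintg, hintg', -⟩ := hε
  have hs : √(l : ℝ) ^ 2 = l := Real.sq_sqrt (Nat.cast_nonneg l)
  have hε0 : ε₀ ≠ 0 := by positivity
  have hinv : ε₀⁻¹ = -((u : ℝ) - v * √(l : ℝ)) := by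
    apply inv_eq_of_mul_eq_one_right
    rw [huv]; linear_combination -hnorm + v ^ 2 * hs
  have hlt : ε₀⁻¹ < 1 := inv_lt_one_of_one_lt₀ h1
  have hpos : 0 < ε₀⁻¹ := by positivity
  have hu : ((2 * u : ℚ) : ℝ) = ε₀ - ε₀⁻¹ := by rw [hinv, huv]; push_cast; ring
  have hv : 2 * (v : ℝ) * √(l : ℝ) = ε₀ + ε₀⁻¹ := by rw [hinv, huv]; ring
  obtain ⟨a, ha⟩ := Rat.exists_int_of_isIntegral (q := 2 * u) (by rw [hu]; exact hintg.sub hintg')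
  have hnormQ : u ^ 2 - v ^ 2 * l = -1 := by exact_mod_cast hnorm
  have hml : (2 * v * l) ^ 2 = ((l * (a ^ 2 + 4) : ℤ) : ℚ) := by
    push_cast; rw [← ha]; linear_combination -4 * l * hnormQ
  obtain ⟨m, hm⟩ : ∃ m : ℤ, 2 * v * l = m := by
    have : IsIntegral ℤ (2 * v * l) := IsIntegral.of_pow two_pos (by
      rw [hml]; exact isIntegral_algebraMap)
    obtain ⟨m, hm⟩ := IsIntegrallyClosed.isIntegral_iff.1 this
    exact ⟨m, hm.symm⟩
  rw [hm] at hml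
  have hm2 : m ^ 2 = l * (a ^ 2 + 4) := by exact_mod_cast hml
  obtain ⟨b, rfl⟩ : (l : ℤ) ∣ m :=
    (Nat.prime_iff_prime_int.1 hl).dvd_of_dvd_pow ⟨_, hm2⟩
  have hl0 : (l : ℤ) ≠ 0 := by exact_mod_cast hl.ne_zero
  have hl0' : (l : ℚ) ≠ 0 := by exact_mod_cast hl.ne_zero
  have hab : l * b ^ 2 = a ^ 2 + 4 := mul_left_cancel₀ hl0 (by linear_combination hm2)
  have hb : 2 * v = b := by
    apply mul_right_cancel₀ hl0'; rw [hm]; push_cast; ring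
  have hl8' : (l : ℤ) % 8 = 1 := by exact_mod_cast congrArg (Nat.cast : ℕ → ℤ) hl8
  have key : ∀ l a b : ZMod 8, l = 1 → l * b ^ 2 = a ^ 2 + 4 → (a.val % 2 = 0 ∧ b.val % 2 = 0) := by
    decide
  have key2 : ∀ l a b : ZMod 8, l = 1 → a ^ 2 + 1 = l * b ^ 2 →
    (a.val % 4 = 0 ∧ b.val % 2 = 1) := by
    decide
  have hlz : ((l : ℤ) : ZMod 8) = 1 := by
    rw [show (1 : ZMod 8) = ((1 : ℤ) : ZMod 8) by norm_num, ZMod.intCast_eq_intCast_iff]; exact hl8'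
  have hval : ∀ x : ℤ, ((x : ZMod 8).val : ℤ) = x % 8 := fun x => ZMod.val_intCast x
  have h2 := key (l : ℤ) a b hlz (by exact_mod_cast congrArg (Int.cast : ℤ → ZMod 8) hab)
  have ha2 : a % 2 = 0 := by have := hval a; omega
  have hb2 : b % 2 = 0 := by have := hval b; omega
  have hapos : 0 < a := by
    have : (0 : ℝ) < ((2 * u : ℚ) : ℝ) := by rw [hu]; linarith
    rw [ha] at this; exact_mod_cast this
  have hbpos : 0 < b := by
    have h3 : 0 < 2 * (v : ℝ) * √(l : ℝ) := by rw [hv]; linarith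
    have h4 : 0 < 2 * (v : ℝ) := pos_of_mul_pos_left h3 (Real.sqrt_nonneg _)
    have : ((2 * v : ℚ) : ℝ) = b := by rw [hb]; push_cast; rfl
    push_cast at this
    rw [this] at h4; exact_mod_cast h4
  obtain ⟨A, hA⟩ : ∃ A : ℕ, a = 2 * A := ⟨(a / 2).toNat, by omega⟩
  obtain ⟨B, hB⟩ : ∃ B : ℕ, b = 2 * B := ⟨(b / 2).toNat, by omega⟩
  have hAB : A ^ 2 + 1 = l * B ^ 2 := by
    rw [hA, hB] at hab
    zify; linarith
  have h3 := key2 (l : ℤ) (A : ℤ) (B : ℤ) hlz (by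
    exact_mod_cast congrArg (Nat.cast : ℕ → ZMod 8) hAB)
  have hA4 := hval A
  have hB2 := hval B
  refine ⟨A, B, ?_, hAB, by omega, mod_four_eq_one_of_sq_add_one hAB (by omega), by omega⟩
  have hu' : u = A := by rw [hA] at ha; push_cast at ha; linarith
  have hv' : v = B := by rw [hB] at hb; push_cast at hb; linarith
  rw [huv, hu', hv']; push_cast; rfl

theorem IsFundamentalUnit.exists_zpow (hε : IsFundamentalUnit l ε₀) {x : ℝ}
    (hx : x ∈ IntermediateField.adjoin ℚ ({√(l : ℝ)} : Set ℝ)) (hx0 : 0 < x) (hintg : IsIntegral ℤ x)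
    (hintg' : IsIntegral ℤ x⁻¹) : ∃ j : ℤ, x = ε₀ ^ j := by
  obtain ⟨h1, hmem, hi, hi', hmin⟩ := hε
  have hzi : ∀ j : ℤ, IsIntegral ℤ (ε₀ ^ j) := by
    intro j
    cases j with
    | ofNat m => exact hi.pow m
    | negSucc m => rw [zpow_negSucc, ← inv_pow]; exact hi'.pow _
  obtain ⟨j, hj1, hj2⟩ := exists_mem_Ico_zpow hx0 h1
  refine ⟨j, ?_⟩
  by_contra hne
  have hjpos : 0 < ε₀ ^ j := by positivity
  have h3 := hmin (x * ε₀ ^ (-j))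
    (by
      rw [zpow_neg, ← div_eq_mul_inv, one_lt_div hjpos]
      exact lt_of_le_of_ne hj1 (Ne.symm hne))
    (mul_mem hx (zpow_mem hmem _)) (hintg.mul (hzi _))
    (by rw [mul_inv, ← zpow_neg]; exact hintg'.mul (hzi _))
  rw [zpow_neg, ← div_eq_mul_inv, le_div_iff₀ hjpos, mul_comm,
    ← zpow_add_one₀ (by positivity)] at h3
  linarith

end

/-- `k = ℚ(√l)` with `s = √l`, and `A + B√l` its fundamental unit, of norm `-1`. -/
structure IsRealQuad (l A B : ℕ) (k : Type*) [Field k] [Algebra ℚ k] (s : k) : Prop where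
  prime : l.Prime
  mod_eight : l % 8 = 1
  quad : IsQuadExt ℚ k (l : ℚ) s
  norm_eq : A ^ 2 + 1 = l * B ^ 2
  four_dvd : 4 ∣ A
  mod_four : B % 4 = 1
  units : ∀ u : (𝓞 k)ˣ, ∃ η : k, (η = 1 ∨ η = -1 ∨ η = A + B * s ∨ η = -(A + B * s)) ∧
    ∃ w : k, w ≠ 0 ∧ ((u : 𝓞 k) : k) = η * w ^ 2

theorem IsFundamentalUnit.isRealQuad {l A B : ℕ} {ε₀ : ℝ} (hε : IsFundamentalUnit l ε₀)
    (hl : l.Prime) (hl8 : l % 8 = 1) (hAB : ε₀ = A + B * √(l : ℝ)) (hnorm : A ^ 2 + 1 = l * B ^ 2)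
    (hA4 : 4 ∣ A) (hB4 : B % 4 = 1) :
    IsRealQuad l A B (IntermediateField.adjoin ℚ ({√(l : ℝ)} : Set ℝ))
      ⟨√(l : ℝ), IntermediateField.mem_adjoin_simple_self ℚ _⟩ where
  prime := hl
  mod_eight := hl8
  norm_eq := hnorm
  four_dvd := hA4
  mod_four := hB4
  quad :=
    { sq := by
        apply Subtype.ext
        change √(l : ℝ) ^ 2 = ((l : ℚ) : ℝ)
        rw [Real.sq_sqrt (Nat.cast_nonneg l)]; push_cast; rfl
      span := by
        rintro ⟨z, hz⟩
        have hintg : IsIntegral ℚ √(l : ℝ) := IsIntegral.of_pow two_pos (by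
          rw [Real.sq_sqrt (Nat.cast_nonneg l)]
          exact isIntegral_algebraMap (x := (l : ℚ)))
        rw [← IntermediateField.mem_toSubalgebra,
          IntermediateField.adjoin_simple_toSubalgebra_of_isAlgebraic hintg.isAlgebraic] at hz
        have key : ∀ z ∈ Algebra.adjoin ℚ {√(l : ℝ)}, ∃ x y : ℚ, z = x + y * √(l : ℝ) := by
          intro z hz
          induction hz using Algebra.adjoin_induction with
          | mem x hx => exact ⟨0, 1, by rw [Set.mem_singleton_iff.1 hx]; simp⟩
          | algebraMap r => exact ⟨r, 0, by simp⟩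
          | add x y _ _ hx hy =>
            obtain ⟨a, b, rfl⟩ := hx
            obtain ⟨c, d, rfl⟩ := hy
            exact ⟨a + c, b + d, by push_cast; ring⟩
          | mul x y _ _ hx hy =>
            obtain ⟨a, b, rfl⟩ := hx
            obtain ⟨c, d, rfl⟩ := hy
            refine ⟨a * c + b * d * l, a * d + b * c, ?_⟩
            push_cast
            linear_combination b * d * Real.sq_sqrt (Nat.cast_nonneg (α := ℝ) l)
        obtain ⟨x, y, hxy⟩ := key z hz
        exact ⟨x, y, Subtype.ext hxy⟩
      not_isSquare := by
        rw [Rat.isSquare_natCast_iff]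
        exact hl.prime.not_isSquare }
  units u := by
    set x : ℝ := (((u : 𝓞 (IntermediateField.adjoin ℚ ({√(l : ℝ)} : Set ℝ))) :
      IntermediateField.adjoin ℚ ({√(l : ℝ)} : Set ℝ)) : ℝ) with hx
    have hmem : x ∈ IntermediateField.adjoin ℚ ({√(l : ℝ)} : Set ℝ) := Subtype.prop _
    have hε0 : 0 < ε₀ := lt_trans one_pos hε.1
    have hinv : x * (((u⁻¹ : (𝓞 (IntermediateField.adjoin ℚ ({√(l : ℝ)} : Set ℝ)))ˣ) :
      𝓞 (IntermediateField.adjoin ℚ ({√(l : ℝ)} : Set ℝ))) :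
      IntermediateField.adjoin ℚ ({√(l : ℝ)} : Set ℝ)) = 1 := by
      rw [hx, ← MulMemClass.coe_mul, ← RingOfIntegers.val_mul, Units.mul_inv]; rfl
    have hx0 : x ≠ 0 := left_ne_zero_of_mul_eq_one hinv
    have hintg : ∀ z : 𝓞 (IntermediateField.adjoin ℚ ({√(l : ℝ)} : Set ℝ)),
        IsIntegral ℤ ((z : IntermediateField.adjoin ℚ ({√(l : ℝ)} : Set ℝ)) : ℝ) := fun z =>
      (RingOfIntegers.isIntegral_coe z).map (IntermediateField.val _)
    have hi : IsIntegral ℤ x := hintg _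
    have hi' : IsIntegral ℤ x⁻¹ := by rw [inv_eq_of_mul_eq_one_right hinv]; exact hintg _
    obtain ⟨σ, hσ, j, hj⟩ : ∃ σ : ℝ, (σ = 1 ∨ σ = -1) ∧ ∃ j : ℤ, x = σ * ε₀ ^ j := by
      rcases lt_or_gt_of_ne hx0 with h | h
      · obtain ⟨j, hj⟩ := hε.exists_zpow (neg_mem hmem) (neg_pos.2 h) hi.neg
          (by rw [inv_neg]; exact hi'.neg)
        exact ⟨-1, Or.inr rfl, j, by rw [← hj]; ring⟩
      · obtain ⟨j, hj⟩ := hε.exists_zpow hmem h hi hi'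
        exact ⟨1, Or.inl rfl, j, by rw [← hj]; ring⟩
    have hpow : ∀ m : ℤ, ∃ w : IntermediateField.adjoin ℚ ({√(l : ℝ)} : Set ℝ), w ≠ 0 ∧
        (w : ℝ) = ε₀ ^ m := fun m =>
      ⟨⟨ε₀ ^ m, zpow_mem hε.2.1 m⟩, fun h0 => by
        have := congrArg Subtype.val h0
        exact (zpow_pos hε0 m).ne' this, rfl⟩
    rcases Int.even_or_odd' j with ⟨m, rfl | rfl⟩
    · obtain ⟨w, hw, hwm⟩ := hpow m
      have hsq : ε₀ ^ (2 * m) = (w : ℝ) ^ 2 := by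
        rw [hwm, ← zpow_natCast, ← zpow_mul, mul_comm]; rfl
      rw [hsq] at hj
      rcases hσ with rfl | rfl
      · exact ⟨1, Or.inl rfl, w, hw, Subtype.ext hj⟩
      · exact ⟨-1, Or.inr (Or.inl rfl), w, hw, Subtype.ext hj⟩
    · obtain ⟨w, hw, hwm⟩ := hpow m
      have hsq : ε₀ ^ (2 * m + 1) = ε₀ * (w : ℝ) ^ 2 := by
        rw [hwm, ← zpow_natCast, ← zpow_mul, zpow_add_one₀ hε0.ne', mul_comm, mul_comm m]; rfl
      rw [hsq, hAB] at hj
      rcases hσ with rfl | rfl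
      · exact ⟨_, Or.inr (Or.inr (Or.inl rfl)), w, hw, Subtype.ext (hj.trans (one_mul _))⟩
      · refine ⟨_, Or.inr (Or.inr (Or.inr rfl)), w, hw, Subtype.ext (hj.trans ?_)⟩
        rw [← mul_assoc, neg_one_mul]; rfl

theorem odd_card_of_card_twoTorsion_le {G : Type*} [CommGroup G] [Finite G]
    (h : Nat.card {x : G // x ^ 2 = 1} ≤ 1) : Odd (Nat.card G) := by
  rw [← Nat.not_even_iff_odd, even_iff_two_dvd]
  intro h2
  have : Fact (Nat.Prime 2) := ⟨Nat.prime_two⟩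
  obtain ⟨x, hx⟩ := exists_prime_orderOf_dvd_card' 2 h2
  have hx2 : x ^ 2 = 1 := by rw [← hx, pow_orderOf_eq_one]
  have : Subsingleton {x : G // x ^ 2 = 1} := (Finite.card_le_one_iff_subsingleton).1 h
  have h1 : x = 1 := congrArg Subtype.val
    (Subsingleton.elim (⟨x, hx2⟩ : {x : G // x ^ 2 = 1}) ⟨1, one_pow 2⟩)
  rw [h1, orderOf_one] at hx
  omega

namespace IsQuadExt

open RingOfIntegers

variable {F K : Type*} [Field F] [Field K] [NumberField F] [NumberField K] [Algebra F K] {d : F}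
  {θ : K}
  (h : IsQuadExt F K d θ)

include h

omit [NumberField F] in
theorem isTotallyReal [IsTotallyReal F] (hd : ∀ φ : F →+* ℂ, 0 ≤ (φ d).re) : IsTotallyReal K where
  isReal w := by
    rw [InfinitePlace.isReal_iff]
    set φ := w.embedding
    have hF : ∀ x : F, starRingEnd ℂ (φ (algebraMap F K x)) = φ (algebraMap F K x) := fun x =>
      RingHom.congr_fun (IsTotallyReal.complexEmbedding_isReal (φ.comp (algebraMap F K))) x
    have hθ : starRingEnd ℂ (φ θ) = φ θ := by
      have h1 : φ θ ^ 2 = φ (algebraMap F K d) := by rw [← map_pow, h.sq]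
      have h2 := hF d
      have h3 := hd (φ.comp (algebraMap F K))
      rw [RingHom.comp_apply] at h3
      rw [Complex.conj_eq_iff_re] at h2
      set r := (φ (algebraMap F K d)).re
      have h4 : (φ θ - (√r : ℂ)) * (φ θ + (√r : ℂ)) = 0 := by
        have : ((√r : ℝ) : ℂ) ^ 2 = r := by rw [← Complex.ofReal_pow, Real.sq_sqrt h3]
        linear_combination h1 - h2 - this
      rcases mul_eq_zero.1 h4 with h5 | h5
      · rw [sub_eq_zero.1 h5, Complex.conj_ofReal]
      · rw [eq_neg_of_add_eq_zero_left h5, map_neg, Complex.conj_ofReal]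
    apply RingHom.ext
    intro z
    obtain ⟨x, y, rfl⟩ := h.span z
    change starRingEnd ℂ (φ _) = φ _
    rw [map_add, map_mul, map_add, map_mul, hF, hF, hθ]

theorem exists_prime_not_sq_dvd_of_four_mul_not_mem {D : 𝓞 F} (hD : (D : F) = d) {p : Ideal (𝓞 F)}
    (hp : Prime p) (hDp : 4 * D ∉ p) :
    ∃ P : Ideal (𝓞 K), Prime P ∧ P ∣ p.map (algebraMap (𝓞 F) (𝓞 K)) ∧
      ¬ P ^ 2 ∣ p.map (algebraMap (𝓞 F) (𝓞 K)) := by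
  have hintg : IsIntegral ℤ θ := IsIntegral.of_pow two_pos (by
    rw [h.sq, ← hD]; exact (RingOfIntegers.isIntegral_coe D).algebraMap)
  obtain ⟨ω, rfl⟩ : ∃ ω : 𝓞 K, (ω : K) = θ := ⟨⟨θ, hintg⟩, rfl⟩
  refine exists_prime_not_sq_dvd_map (ω := ω) (b := 0) (c := -D) ?_ h.span hp (by simpa using hDp)
  apply RingOfIntegers.ext
  have : ((algebraMap (𝓞 F) (𝓞 K) D : 𝓞 K) : K) = algebraMap F K D := rfl
  rw [map_zero, zero_mul, sub_zero, map_neg, val_add, val_neg, val_pow, h.sq, this, hD, val_zero,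
    add_neg_cancel]

theorem exists_prime_not_sq_dvd_of_eq {D b c : 𝓞 F} (hD : (D : F) = d) (hbc : D = b ^ 2 - 4 * c)
    {p : Ideal (𝓞 F)} (hp : Prime p) (hDp : D ∉ p) :
    ∃ P : Ideal (𝓞 K), Prime P ∧ P ∣ p.map (algebraMap (𝓞 F) (𝓞 K)) ∧
      ¬ P ^ 2 ∣ p.map (algebraMap (𝓞 F) (𝓞 K)) := by
  set b' : 𝓞 K := algebraMap (𝓞 F) (𝓞 K) b
  set c' : 𝓞 K := algebraMap (𝓞 F) (𝓞 K) c
  have hDK : θ ^ 2 = (b' : K) ^ 2 - 4 * c' := by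
    rw [h.sq, ← hD, hbc]
    change algebraMap (𝓞 K) K (algebraMap (𝓞 F) (𝓞 K) (b ^ 2 - 4 * c)) = _
    simp only [map_sub, map_mul, map_pow, map_ofNat]; rfl
  have hquad : ((b' + θ) / 2) ^ 2 - b' * ((b' + θ) / 2) + c' = 0 := by
    linear_combination hDK / 4
  have hintg : IsIntegral ℤ ((b' + θ) / 2) := by
    refine isIntegral_trans (A := 𝓞 K) _ ?_
    refine ⟨Polynomial.X ^ 2 - Polynomial.C b' * Polynomial.X + Polynomial.C c', ?_, ?_⟩
    · monicity!
    · rw [← Polynomial.aeval_def]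
      simp only [map_add, map_sub, map_mul, map_pow, Polynomial.aeval_X, Polynomial.aeval_C]
      exact hquad
  obtain ⟨ω, hω⟩ : ∃ ω : 𝓞 K, (ω : K) = (b' + θ) / 2 := ⟨⟨_, hintg⟩, rfl⟩
  rw [← hω] at hquad
  refine exists_prime_not_sq_dvd_map (ω := ω) (b := b) (c := c) ?_ ?_ hp (by rwa [← hbc])
  · apply RingOfIntegers.ext
    rw [val_add, val_sub, val_pow, val_mul]
    exact hquad
  · intro z
    obtain ⟨x, y, rfl⟩ := h.span z
    refine ⟨x - y * b, 2 * y, ?_⟩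
    have : ((b' : 𝓞 K) : K) = algebraMap F K b := rfl
    rw [hω, this]
    simp only [map_sub, map_mul, map_ofNat]
    ring

end IsQuadExt

theorem exists_ringHom_real (K : Type*) [Field K] [NumberField K] [IsTotallyReal K] :
    Nonempty (K →+* ℝ) := by
  obtain ⟨w⟩ : Nonempty (InfinitePlace K) := inferInstance
  exact ⟨InfinitePlace.embedding_of_isReal (IsTotallyReal.isReal w)⟩

theorem Rat.units_eq (u : (𝓞 ℚ)ˣ) : ((u : 𝓞 ℚ) : ℚ) = 1 ∨ ((u : 𝓞 ℚ) : ℚ) = -1 := by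
  have h1 := Rat.ringOfIntegersEquiv_apply_coe (u : 𝓞 ℚ)
  rcases Int.isUnit_iff.1 (u.isUnit.map Rat.ringOfIntegersEquiv) with h | h
  · left; rw [h, Int.cast_one] at h1; exact h1.symm
  · right; rw [h, Int.cast_neg, Int.cast_one] at h1; exact h1.symm

theorem Rat.prime_natCast {l : ℕ} (hl : l.Prime) : Prime (l : 𝓞 ℚ) := by
  rw [← MulEquiv.prime_iff Rat.ringOfIntegersEquiv]
  simpa using Nat.prime_iff_prime_int.1 hl

theorem odd_multiplicity_self {R : Type*} [CommRing R] [IsDedekindDomain R] {p : Ideal R}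
    (hp : Prime p) : Odd (multiplicity p p) := by
  have : multiplicity p p = 1 :=
    multiplicity_eq_of_dvd_of_not_dvd (by rw [pow_one]) (by
      rintro ⟨c, hc⟩
      have h1 : p * 1 = p * (p * c) := by rw [← mul_assoc, ← pow_two, ← hc, mul_one]
      exact hp.not_isUnit (IsUnit.of_mul_eq_one _ (mul_left_cancel₀ hp.ne_zero h1).symm))
  rw [this]; exact odd_one

namespace IsRealQuad

variable {l A B : ℕ} {k : Type*} [Field k] [NumberField k] {s : k} (h : IsRealQuad l A B k s)

include h

theorem isTotallyReal : IsTotallyReal k :=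
  h.quad.isTotallyReal fun φ => by
    rw [map_natCast, Complex.natCast_re]; exact Nat.cast_nonneg l

theorem odd_card_classGroup : Odd (Nat.card (ClassGroup (𝓞 k))) := by
  classical
  have := h.isTotallyReal
  obtain ⟨φ⟩ := exists_ringHom_real k
  have hlp := Rat.prime_natCast h.prime
  have hprime : Prime (Ideal.span {(l : 𝓞 ℚ)}) :=
    Ideal.prime_of_isPrime (by rw [Ne, Ideal.span_singleton_eq_bot]; exact hlp.ne_zero)
      ((Ideal.span_singleton_prime hlp.ne_zero).2 hlp)
  have hD : ((l : 𝓞 ℚ) : ℚ) = l := RingOfIntegers.val_natCast l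
  obtain ⟨m, hm⟩ : ∃ m : ℕ, l = 4 * m + 1 := ⟨l / 4, by have := h.mod_eight; omega⟩
  apply odd_card_of_card_twoTorsion_le
  have hU : ∀ u : (𝓞 ℚ)ˣ, ∃ η ∈ ({1, -1} : Finset ℚ), ∃ w : ℚ,
    w ≠ 0 ∧ ((u : 𝓞 ℚ) : ℚ) = η * w ^ 2 := by
    intro u
    refine ⟨(u : 𝓞 ℚ), ?_, 1, one_ne_zero, by ring⟩
    simpa using Rat.units_eq u
  have hbound := card_twoTorsion_mul_le h.quad hD
    (by
      have : Nat.card (ClassGroup (𝓞 ℚ)) = 1 := by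
        rw [Nat.card_eq_fintype_card]; exact Rat.classNumber_eq
      rw [this]; exact odd_one)
    (𝔩 := Ideal.span {(l : 𝓞 ℚ)}) (odd_multiplicity_self hprime) ∅
    (by
      intro p hp _ hpl
      refine h.quad.exists_prime_not_sq_dvd_of_eq hD (b := 1) (c := -(m : 𝓞 ℚ)) ?_ hp ?_
      · rw [hm]; push_cast; ring
      · intro hmem
        have hle : Ideal.span {(l : 𝓞 ℚ)} ≤ p := by
          rwa [Ideal.span_singleton_le_iff_mem]
        have hmax : (Ideal.span {(l : 𝓞 ℚ)}).IsMaximal :=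
          Ideal.IsPrime.isMaximal (Ideal.isPrime_of_prime hprime) hprime.ne_zero
        exact hpl (hmax.eq_of_le (Ideal.isPrime_of_prime hp).ne_top hle).symm)
    hU (fun u _ => hU u) (unitFamily k) (fun i j ⟨t, ht⟩ => unitFamily_injective φ i j ht)
  rw [card_unitFamily_index, h.quad.finrank_eq] at hbound
  have hc : ({1, -1} : Finset ℚ).card = 2 := by rw [Finset.card_pair]; norm_num
  rw [hc, Finset.card_empty] at hbound
  omega

end IsRealQuad

/-- `a` is a value of the quadratic form `X² - D Y²` over the field of fractions of `R`. -/
def Represents {R : Type*} [CommRing R] (D a : R) : Prop :=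
  ∃ x y z : R, z ≠ 0 ∧ z ^ 2 * a = x ^ 2 - D * y ^ 2

namespace Represents

variable {R S : Type*} [CommRing R] [CommRing S] {D a : R}

theorem map (h : Represents D a) {f : R →+* S} (hf : Function.Injective f) :
    Represents (f D) (f a) := by
  obtain ⟨x, y, z, hz, h⟩ := h
  refine ⟨f x, f y, f z, by rwa [Ne, map_eq_zero_iff f hf], ?_⟩
  rw [← map_pow, ← map_mul, h, map_sub, map_mul, map_pow, map_pow]

theorem exists_primitive [IsDomain R] [WfDvdMonoid R] (h : Represents D a) {π : R} (hπ : Prime π) :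
    ∃ x y z : R, (¬ π ∣ x ∨ ¬ π ∣ y ∨ ¬ π ∣ z) ∧ z ^ 2 * a = x ^ 2 - D * y ^ 2 := by
  obtain ⟨x, y, z, hz, h⟩ := h
  obtain ⟨m, z', hz', rfl⟩ := WfDvdMonoid.max_power_factor hz hπ.irreducible
  clear hz
  induction m generalizing x y with
  | zero => exact ⟨x, y, z', Or.inr (Or.inr hz'), by simpa using h⟩
  | succ m ih =>
    by_cases hxy : π ∣ x ∧ π ∣ y
    · obtain ⟨⟨x', rfl⟩, ⟨y', rfl⟩⟩ := hxy
      apply ih x' y'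
      apply mul_left_cancel₀ (pow_ne_zero 2 hπ.ne_zero)
      linear_combination h
    · exact ⟨x, y, _, by tauto, h⟩

theorem exists_dvd_sub_sq [IsDomain R] [WfDvdMonoid R] {π E : R} (h : Represents (π * E) a)
    (hπ : Prime π) (hmax : (Ideal.span {π}).IsMaximal) (hE : ¬ π ∣ E) : ∃ t : R, π ∣ a - t ^ 2 := by
  obtain ⟨x, y, z, hprim, h⟩ := h.exists_primitive hπ
  by_cases hz : π ∣ z
  · exfalso
    have hx : π ∣ x := hπ.dvd_of_dvd_pow (n := 2) (by
      rw [show x ^ 2 = z ^ 2 * a + π * (E * y ^ 2) by linear_combination -h]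
      exact dvd_add ((dvd_pow hz two_ne_zero).mul_right _) (dvd_mul_right _ _))
    have hy : π ∣ y := by
      have h1 : π * π ∣ π * (E * y ^ 2) := by
        rw [show π * (E * y ^ 2) = x ^ 2 - z ^ 2 * a by linear_combination h, ← pow_two]
        exact dvd_sub (pow_dvd_pow_of_dvd hx 2) ((pow_dvd_pow_of_dvd hz 2).mul_right _)
      have h2 := (mul_dvd_mul_iff_left hπ.ne_zero).1 h1
      exact hπ.dvd_of_dvd_pow ((hπ.dvd_or_dvd h2).resolve_left hE)
    tauto
  · rw [← Ideal.mem_span_singleton] at hz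
    obtain ⟨w, i, hi, hw⟩ := hmax.exists_inv hz
    obtain ⟨j, rfl⟩ := Ideal.mem_span_singleton.1 hi
    refine ⟨x * w, a * j * (2 - π * j) - E * y ^ 2 * w ^ 2, ?_⟩
    linear_combination w ^ 2 * h - a * (w * z + 1 - π * j) * hw

theorem isSquare_toZMod {p : ℕ} [Fact p.Prime] {E a : ℤ_[p]} (h : Represents (p * E) a)
    (hE : ¬ (p : ℤ_[p]) ∣ E) : IsSquare (PadicInt.toZMod a) := by
  obtain ⟨t, w, ht⟩ := h.exists_dvd_sub_sq PadicInt.prime_p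
    (by rw [← PadicInt.maximalIdeal_eq_span_p]; infer_instance) hE
  refine ⟨PadicInt.toZMod t, ?_⟩
  rw [eq_add_of_sub_eq ht]
  simp [pow_two]

theorem zmod_eight {D a : ℤ_[2]} (h : Represents D a) :
    ∃ x y z : ZMod 8, (x ^ 2 = 1 ∨ y ^ 2 = 1 ∨ z ^ 2 = 1) ∧
      z ^ 2 * (PadicInt.toZModPow 3 a : ZMod (2 ^ 3)) =
        x ^ 2 - (PadicInt.toZModPow 3 D : ZMod (2 ^ 3)) * y ^ 2 := by
  have key : ∀ x : ℤ_[2], ¬ ((2 : ℕ) : ℤ_[2]) ∣ x →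
    (PadicInt.toZModPow 3 x : ZMod (2 ^ 3)) ^ 2 = 1 := by
    intro x hx
    have h1 : ∀ u : ZMod (2 ^ 3), IsUnit u → u ^ 2 = 1 := by decide
    apply h1
    apply IsUnit.map
    rw [← PadicInt.norm_lt_one_iff_dvd, not_lt] at hx
    exact PadicInt.isUnit_iff.2 (le_antisymm (PadicInt.norm_le_one x) hx)
  obtain ⟨x, y, z, hxyz, h⟩ := h.exists_primitive PadicInt.prime_p
  refine ⟨PadicInt.toZModPow 3 x, PadicInt.toZModPow 3 y, PadicInt.toZModPow 3 z,
    hxyz.imp (key x) (Or.imp (key y) (key z)), ?_⟩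
  have := congrArg (PadicInt.toZModPow 3) h
  rwa [map_mul, map_pow, map_sub, map_mul, map_pow, map_pow] at this

end Represents

namespace PadicInt

variable {p : ℕ} [Fact p.Prime]

theorem exists_sq_eq_of_norm_lt {τ m : ℤ_[p]} (h : ‖m ^ 2 - τ‖ < ‖2 * m‖ ^ 2) :
    ∃ σ : ℤ_[p], σ ^ 2 = τ ∧ ‖σ - m‖ < ‖2 * m‖ := by
  have hF : ∀ x : ℤ_[p], Polynomial.aeval x (Polynomial.X ^ 2 - Polynomial.C τ) = x ^ 2 - τ :=
    fun x => by simp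
  have hF' : ∀ x : ℤ_[p],
      Polynomial.aeval x (Polynomial.derivative (Polynomial.X ^ 2 - Polynomial.C τ)) = 2 * x :=
        fun x => by
    simp [one_add_one_eq_two]
  obtain ⟨σ, h1, h2, -⟩ := hensels_lemma (F := (Polynomial.X ^ 2 - Polynomial.C τ)) (a := m)
    (by rwa [hF, hF'])
  rw [hF, sub_eq_zero] at h1
  rw [hF'] at h2
  exact ⟨σ, h1, h2⟩

theorem toZMod_eq_zero_iff {x : ℤ_[p]} : toZMod x = 0 ↔ ‖x‖ < 1 := by
  rw [← RingHom.mem_ker, ker_toZMod, maximalIdeal_eq_span_p, Ideal.mem_span_singleton,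
    norm_lt_one_iff_dvd]

theorem toZMod_eq_zero_iff_dvd {x : ℤ_[p]} : toZMod x = 0 ↔ (p : ℤ_[p]) ∣ x := by
  rw [toZMod_eq_zero_iff, norm_lt_one_iff_dvd]

theorem exists_sq_eq_of_toZMod (hp : p ≠ 2) {τ : ℤ_[p]} {s : ZMod p} (hs : s ^ 2 = toZMod τ)
    (hs0 : s ≠ 0) : ∃ σ : ℤ_[p], σ ^ 2 = τ ∧ toZMod σ = s := by
  obtain ⟨m, rfl⟩ := ZMod.natCast_zmod_surjective s
  have h2 : (2 : ZMod p) ≠ 0 := by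
    rw [← Nat.cast_two, Ne, ZMod.natCast_eq_zero_iff,
      Nat.prime_dvd_prime_iff_eq Fact.out Nat.prime_two]
    exact hp
  have hnorm1 : ‖(2 * m : ℤ_[p])‖ = 1 := by
    apply le_antisymm (PadicInt.norm_le_one _) (not_lt.1 _)
    rw [← toZMod_eq_zero_iff, map_mul, map_ofNat, map_natCast]
    exact mul_ne_zero h2 hs0
  obtain ⟨σ, h1, h3⟩ := exists_sq_eq_of_norm_lt (τ := τ) (m := (m : ℤ_[p])) (by
    rw [hnorm1, one_pow, ← toZMod_eq_zero_iff, map_sub, map_pow, map_natCast, hs, sub_self])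
  rw [hnorm1, ← toZMod_eq_zero_iff, map_sub, map_natCast, sub_eq_zero] at h3
  exact ⟨σ, h1, h3⟩

theorem exists_sq_eq_natCast {l : ℕ} (hl : l % 8 = 1) : ∃ σ : ℤ_[2], σ ^ 2 = l := by
  obtain ⟨σ, h, -⟩ := exists_sq_eq_of_norm_lt (p := 2) (τ := l) (m := 1) (by
    have h8 : (8 : ℤ) ∣ 1 - l := by omega
    have h1 : ‖(((1 - l : ℤ)) : ℤ_[2])‖ ≤ (2 : ℝ) ^ (-3 : ℤ) := by
      have := (norm_int_le_pow_iff_dvd (p := 2) (k := 1 - l) (n := 3)).2 (by norm_num; exact h8)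
      simpa using this
    push_cast at h1
    have h2 : ‖(2 : ℤ_[2])‖ = 2⁻¹ := by simpa using norm_p (p := 2)
    rw [mul_one, h2, one_pow]
    refine h1.trans_lt ?_
    norm_num)
  exact ⟨σ, h⟩

end PadicInt

namespace IsQuadExt

variable {F K : Type*} [Field F] [Field K] [Algebra F K] {d : F} {θ : K} (h : IsQuadExt F K d θ)

include h

theorem exists_ringHom {L : Type*} [Field L] (ψ : F →+* L) {σ : L} (hσ : σ ^ 2 = ψ d) :
    ∃ Ψ : K →+* L, Ψ.comp (algebraMap F K) = ψ ∧ Ψ θ = σ := by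
  let := ψ.toAlgebra
  let f : K →ₗ[F] L := h.basis.constr F ![1, σ]
  have hf : ∀ x y : F, f (algebraMap F K x + algebraMap F K y * θ) = ψ x + ψ y * σ := by
    intro x y
    have : algebraMap F K x + algebraMap F K y * θ = x • h.basis 0 + y • h.basis 1 := by
      rw [h.basis_zero, h.basis_one, Algebra.smul_def, Algebra.smul_def, mul_one]
    rw [this, map_add, map_smul, map_smul, Module.Basis.constr_basis, Module.Basis.constr_basis,
      Algebra.smul_def, Algebra.smul_def]
    simp [RingHom.algebraMap_toAlgebra]
  have h1 : f 1 = 1 := by simpa using hf 1 0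
  have hmul : ∀ z w : K, f (z * w) = f z * f w := by
    intro z w
    obtain ⟨x, y, rfl⟩ := h.span z
    obtain ⟨x', y', rfl⟩ := h.span w
    have : (algebraMap F K x + algebraMap F K y * θ) * (algebraMap F K x' + algebraMap F K y' * θ) =
        algebraMap F K (x * x' + d * y * y') + algebraMap F K (x * y' + x' * y) * θ := by
      simp only [map_add, map_mul, ← h.sq]; ring
    rw [this, hf, hf, hf]
    simp only [map_add, map_mul, ← hσ]; ring
  let Ψ : K →ₐ[F] L := AlgHom.ofLinearMap f h1 hmul
  refine ⟨Ψ, RingHom.ext fun x => Ψ.commutes x, ?_⟩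
  change f θ = σ
  simpa using hf 0 1

end IsQuadExt

theorem exists_ringHom_padicInt {K : Type*} [Field K] [NumberField K] {p : ℕ} [Fact p.Prime]
    (ψ : K →+* ℚ_[p]) :
    ∃ φ : 𝓞 K →+* ℤ_[p], Function.Injective φ ∧ ∀ x, ((φ x : ℤ_[p]) : ℚ_[p]) = ψ x := by
  have key : ∀ x : 𝓞 K, ∃ y : ℤ_[p], (y : ℚ_[p]) = ψ x := by
    intro x
    have h1 : IsIntegral ℤ (ψ x) := (RingOfIntegers.isIntegral_coe x).map (ψ.toIntAlgHom)
    have h2 : IsIntegral ℤ_[p] (ψ x) := h1.tower_top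
    obtain ⟨y, hy⟩ := IsIntegrallyClosed.isIntegral_iff.1 h2
    exact ⟨y, hy⟩
  choose f hf using key
  have hinj : Function.Injective ((↑) : ℤ_[p] → ℚ_[p]) := Subtype.coe_injective
  refine ⟨⟨⟨⟨f, hinj ?_⟩, fun x y => hinj ?_⟩, hinj ?_, fun x y => hinj ?_⟩, ?_, hf⟩
  · rw [hf, RingOfIntegers.val_one, map_one, PadicInt.coe_one]
  · rw [hf, RingOfIntegers.val_mul, map_mul, PadicInt.coe_mul, hf, hf]
  · change ((f 0 : ℤ_[p]) : ℚ_[p]) = _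
    rw [hf, RingOfIntegers.val_zero, map_zero, PadicInt.coe_zero]
  · change ((f (x + y) : ℤ_[p]) : ℚ_[p]) = ((f x + f y : ℤ_[p]) : ℚ_[p])
    rw [hf, RingOfIntegers.val_add, map_add, PadicInt.coe_add, hf, hf]
  · intro x y hxy
    change f x = f y at hxy
    have := congrArg ((↑) : ℤ_[p] → ℚ_[p]) hxy
    rw [hf, hf] at this
    exact RingOfIntegers.ext (ψ.injective this)

open NumberField RingOfIntegers

section

variable {G : Type*} [CommGroup G] [Finite G]

theorem index_range_sq : (powMonoidHom 2 : G →* G).range.index = Nat.card {x : G // x ^ 2 = 1} := by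
  have h1 := (powMonoidHom 2 : G →* G).ker.card_mul_index
  have h2 := (powMonoidHom 2 : G →* G).range.card_mul_index
  rw [Subgroup.index_ker] at h1
  have h3 : Nat.card (powMonoidHom 2 : G →* G).ker = Nat.card {x : G // x ^ 2 = 1} := rfl
  rw [← h3]
  exact Nat.eq_of_mul_eq_mul_left Nat.card_pos (h2.trans (h1.symm.trans (mul_comm _ _)))

omit [Finite G] in
theorem mem_range_sq {x : G} : x ∈ (powMonoidHom 2 : G →* G).range ↔ IsSquare x := by
  rw [MonoidHom.mem_range, isSquare_iff_exists_sq]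
  exact ⟨fun ⟨y, hy⟩ => ⟨y, hy.symm⟩, fun ⟨y, hy⟩ => ⟨y, hy.symm⟩⟩

theorem card_twoTorsion_ne_one {x : G} (hx : ¬ IsSquare x) : Nat.card {x : G // x ^ 2 = 1} ≠ 1 := by
  rw [← index_range_sq]
  intro h
  rw [Subgroup.index_eq_one] at h
  exact hx (mem_range_sq.1 (h ▸ Subgroup.mem_top x))

theorem isSquare_mul_of_card_twoTorsion (h : Nat.card {x : G // x ^ 2 = 1} = 2) {x y : G}
    (hx : ¬ IsSquare x) (hy : ¬ IsSquare y) : IsSquare (x * y) := by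
  rw [← index_range_sq] at h
  rw [← mem_range_sq] at hx hy ⊢
  exact (Subgroup.mul_mem_iff_of_index_two h).2 (iff_of_false hx hy)

end

namespace IsQuadExt

variable {F K : Type*} [Field F] [Field K] [NumberField F] [NumberField K] [Algebra F K] {d : F}
  {θ : K} (h : IsQuadExt F K d θ) {D : 𝓞 F} (hD : (D : F) = d)

omit [NumberField K] in
theorem _root_.represents_of_eq {D a : 𝓞 F} {x y : F} (h : (a : F) = x ^ 2 - D * y ^ 2) :
    Represents D a := by
  obtain ⟨x₁, z₁, hz₁, rfl⟩ := IsFractionRing.div_surjective (A := 𝓞 F) x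
  obtain ⟨y₁, z₂, hz₂, rfl⟩ := IsFractionRing.div_surjective (A := 𝓞 F) y
  have h1 : algebraMap (𝓞 F) F z₁ ≠ 0 := IsFractionRing.to_map_ne_zero_of_mem_nonZeroDivisors hz₁
  have h2 : algebraMap (𝓞 F) F z₂ ≠ 0 := IsFractionRing.to_map_ne_zero_of_mem_nonZeroDivisors hz₂
  refine ⟨x₁ * z₂, y₁ * z₁, z₁ * z₂, mul_ne_zero (nonZeroDivisors.ne_zero hz₁)
    (nonZeroDivisors.ne_zero hz₂), ?_⟩
  apply FaithfulSMul.algebraMap_injective (𝓞 F) F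
  change algebraMap _ F a = _ at h
  simp only [map_mul, map_pow, map_sub, h]
  change _ = _ - algebraMap _ F D * _
  field_simp

include h hD

theorem exists_represents_of_isSquare {I : nonZeroDivisors (Ideal (𝓞 K))}
    (hsq : IsSquare (ClassGroup.mk0 I)) {a : 𝓞 F}
    (ha : Ideal.span {a} = Ideal.relNorm (𝓞 F) (I : Ideal (𝓞 K)) ^ Nat.card (ClassGroup (𝓞 F))) :
    ∃ η : (𝓞 F)ˣ, Represents D (a * η) := by
  obtain ⟨c, hc⟩ := hsq
  obtain ⟨J, rfl⟩ := ClassGroup.mk0_surjective c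
  rw [← map_mul, ClassGroup.mk0_eq_mk0_iff] at hc
  obtain ⟨α, β, hα, hβ, hαβ⟩ := hc
  set N := Nat.card (ClassGroup (𝓞 F))
  set ν : Ideal (𝓞 K) →*₀ Ideal (𝓞 F) := Ideal.relNorm (𝓞 F)
  have hnorm : ∀ x : 𝓞 K, algebraMap (𝓞 F) F (Algebra.intNorm (𝓞 F) (𝓞 K) x) =
      Algebra.norm F (x : K) :=
    fun x => Algebra.algebraMap_intNorm (A := 𝓞 F) (K := F) (L := K) (B := 𝓞 K) x
  have hν : ∀ x : 𝓞 K, ν (Ideal.span {x}) = Ideal.span {Algebra.intNorm (𝓞 F) (𝓞 K) x} :=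
    fun x => Ideal.relNorm_singleton (𝓞 F) x
  have h1 := congrArg (fun X => ν X ^ N) hαβ
  simp only [Submonoid.coe_mul, map_mul, mul_pow, hν] at h1
  rw [← ha, ← span_powGen (ν J), Ideal.span_singleton_pow, Ideal.span_singleton_pow,
    Ideal.span_singleton_mul_span_singleton, Ideal.span_singleton_mul_span_singleton,
    Ideal.span_singleton_mul_span_singleton] at h1
  obtain ⟨η, hη⟩ := Ideal.span_singleton_eq_span_singleton.1 h1
  have hα0 : Algebra.norm F (α : K) ≠ 0 := by
    rw [Algebra.norm_ne_zero_iff, Ne, RingOfIntegers.coe_eq_zero_iff]; exact hα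
  have hαK : (α : K) ≠ 0 := by rwa [Ne, RingOfIntegers.coe_eq_zero_iff]
  set z : K := ((β : K) / α) ^ N * algebraMap F K (powGen (ν J) : F)
  have hz : Algebra.norm F z * Algebra.norm F (α : K) ^ N =
      Algebra.norm F (β : K) ^ N * (powGen (ν J) : F) ^ 2 := by
    rw [← h.finrank_eq, ← Algebra.norm_algebraMap, ← map_pow (Algebra.norm F),
      ← map_pow (Algebra.norm F),
      ← map_mul (Algebra.norm F), ← map_mul (Algebra.norm F)]
    congr 1
    simp only [z]
    rw [div_pow]
    have := pow_ne_zero N hαK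
    field_simp
  obtain ⟨x, y, hxy⟩ := h.exists_norm_eq z
  refine ⟨η, represents_of_eq (x := x) (y := y) ?_⟩
  rw [hD, ← hxy, ← mul_left_inj' (pow_ne_zero N hα0), hz]
  have h2 := congrArg (algebraMap (𝓞 F) F) hη
  simp only [map_mul, map_pow, hnorm] at h2
  rw [val_mul]
  change algebraMap (𝓞 F) F a * algebraMap (𝓞 F) F η * _ = _ *
    (algebraMap (𝓞 F) F (powGen (ν J))) ^ 2
  linear_combination h2

end IsQuadExt

theorem Ideal.absNorm_ker {A : Type*} [CommRing A] [IsDedekindDomain A] [Module.Free ℤ A] {p : ℕ}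
    [Fact p.Prime] (f : A →+* ZMod p) : Ideal.absNorm (RingHom.ker f) = p := by
  have e := RingHom.quotientKerEquivOfSurjective (ZMod.ringHom_surjective f)
  rw [Ideal.absNorm_apply, Submodule.cardQuot_apply, Nat.card_congr e.toEquiv, Nat.card_zmod]

theorem Ideal.mul_eq_span_of_absNorm_eq {F : Type*} [Field F] [NumberField F]
    (hF : Module.finrank ℚ F = 2) {p : ℕ} (hp : p.Prime) {I J : Ideal (𝓞 F)} (hI :
    Ideal.absNorm I = p)
    (hJ : Ideal.absNorm J = p) (hIJ : I ≠ J) : I * J = Ideal.span {(p : 𝓞 F)} := by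
  have hmax : ∀ I : Ideal (𝓞 F), Ideal.absNorm I = p → I.IsMaximal := fun I hI =>
    (Ideal.isPrime_of_irreducible_absNorm (hI ▸ hp)).isMaximal (by
      rintro rfl; rw [Ideal.absNorm_bot] at hI; exact hp.ne_zero hI.symm)
  have hcop : IsCoprime I J := by
    have := hmax I hI
    have := hmax J hJ
    exact Ideal.isCoprime_of_isMaximal hIJ
  have hmem : ∀ I : Ideal (𝓞 F), Ideal.absNorm I = p → (p : 𝓞 F) ∈ I := fun I hI =>
    hI ▸ Ideal.absNorm_mem I
  have hle : Ideal.span {(p : 𝓞 F)} ≤ I * J := by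
    rw [Ideal.mul_eq_inf_of_isCoprime hcop, Ideal.span_singleton_le_iff_mem]
    exact ⟨hmem I hI, hmem J hJ⟩
  obtain ⟨C, hC⟩ := Ideal.dvd_iff_le.2 hle
  have h1 := congrArg Ideal.absNorm hC
  rw [map_mul, map_mul, hI, hJ, Ideal.absNorm_span_natCast, RingOfIntegers.rank, hF,
    ← pow_two] at h1
  have h2 : Ideal.absNorm C = 1 :=
    Nat.eq_of_mul_eq_mul_left (pow_pos hp.pos 2) (by rw [mul_one]; exact h1.symm)
  rw [Ideal.absNorm_eq_one_iff] at h2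
  rw [hC, h2, Ideal.mul_top]

namespace IsQuadExt

variable {F K : Type*} [Field F] [Field K] [NumberField F] [NumberField K] [Algebra F K] {d : F}
  {θ : K} (h : IsQuadExt F K d θ) {D : 𝓞 F} (hD : (D : F) = d)

include h hD

theorem exists_relNorm_eq_ker {p : ℕ} [Fact p.Prime] (hp : p ≠ 2) {ψ : F →+* ℚ_[p]}
    {φ : 𝓞 F →+* ℤ_[p]} (hφ : ∀ x, ((φ x : ℤ_[p]) : ℚ_[p]) = ψ x) {w : ZMod p}
    (hw : w ^ 2 = PadicInt.toZMod (φ D)) (hw0 : w ≠ 0) :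
    ∃ R : nonZeroDivisors (Ideal (𝓞 K)),
      Ideal.relNorm (𝓞 F) (R : Ideal (𝓞 K)) = RingHom.ker (PadicInt.toZMod.comp φ) := by
  obtain ⟨τ, hτ, -⟩ := PadicInt.exists_sq_eq_of_toZMod hp hw hw0
  obtain ⟨Ψ, hΨ, -⟩ := h.exists_ringHom ψ (σ := (τ : ℚ_[p])) (by
    rw [← hD, ← hφ, ← hτ, PadicInt.coe_pow])
  obtain ⟨Φ, -, hΦ⟩ := exists_ringHom_padicInt Ψ
  have hcomp : Φ.comp (algebraMap (𝓞 F) (𝓞 K)) = φ := by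
    refine RingHom.ext fun x => Subtype.coe_injective ?_
    change ((Φ (algebraMap (𝓞 F) (𝓞 K) x) : ℤ_[p]) : ℚ_[p]) = φ x
    rw [hφ, ← hΨ, RingHom.comp_apply, hΦ]
    rfl
  set R := RingHom.ker (PadicInt.toZMod.comp Φ)
  have hRp : Ideal.absNorm R = p := Ideal.absNorm_ker _
  have hpp : p.Prime := Fact.out
  have hR : R ≠ ⊥ := by
    intro h0
    rw [h0, Ideal.absNorm_bot] at hRp
    exact hpp.ne_zero hRp.symm
  refine ⟨⟨R, mem_nonZeroDivisors_of_ne_zero hR⟩, ?_⟩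
  have h1 : Ideal.absNorm (Ideal.relNorm (𝓞 F) R) = p := by rw [Ideal.absNorm_relNorm, hRp]
  have hmax : (Ideal.relNorm (𝓞 F) R).IsMaximal :=
    (Ideal.isPrime_of_irreducible_absNorm (h1 ▸ hpp)).isMaximal (by rwa [Ne,
    Ideal.relNorm_eq_bot_iff])
  refine hmax.eq_of_le (RingHom.ker_ne_top _) ?_
  refine (Ideal.relNorm_le_comap (𝓞 F) R).trans fun x hx => ?_
  rw [Ideal.mem_comap, RingHom.mem_ker, RingHom.comp_apply] at hx
  rw [RingHom.mem_ker, RingHom.comp_apply, ← hcomp]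
  exact hx

end IsQuadExt

namespace IsRealQuad

variable {l A B : ℕ} {k : Type*} [Field k] [NumberField k] {s : k} (h : IsRealQuad l A B k s)
  {S : 𝓞 k} (hS : (S : k) = s)

include h

theorem exists_coe_eq : ∃ S : 𝓞 k, (S : k) = s := by
  have hintg : IsIntegral ℤ s := IsIntegral.of_pow two_pos (by
    rw [h.quad.sq, map_natCast]
    exact_mod_cast isIntegral_algebraMap (R := ℤ) (A := k) (x := (l : ℤ)))
  exact ⟨⟨s, hintg⟩, rfl⟩

include hS

theorem sq_eq : S ^ 2 = (l : 𝓞 k) := by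
  apply RingOfIntegers.ext
  rw [val_pow, val_natCast, hS, h.quad.sq, map_natCast]

theorem exists_two_mul_eq (z : 𝓞 k) : ∃ a b : ℤ, 2 * z = a + b * S ∧
    4 * Algebra.norm ℤ z = a ^ 2 - l * b ^ 2 := by
  obtain ⟨x, y, hxy⟩ := h.quad.span z
  have h1 : ((Algebra.norm ℤ z : ℤ) : ℚ) = x ^ 2 - l * y ^ 2 := by
    rw [← h.quad.norm_eq, ← hxy]
    exact Algebra.coe_norm_int z
  have h2 : ((Algebra.trace ℤ (𝓞 k) z : ℤ) : ℚ) = 2 * x := by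
    rw [← h.quad.trace_eq x y, ← hxy]
    exact Algebra.coe_trace_int z
  set N := Algebra.norm ℤ z
  set a := Algebra.trace ℤ (𝓞 k) z
  have hl0 : (l : ℚ) ≠ 0 := Nat.cast_ne_zero.2 h.prime.ne_zero
  obtain ⟨m, hm⟩ : ∃ m : ℤ, l * (2 * y) = m := by
    have : IsIntegral ℤ (l * (2 * y) : ℚ) := by
      refine IsIntegral.of_pow two_pos ?_
      rw [show (l * (2 * y) : ℚ) ^ 2 = ((l * (a ^ 2 - 4 * N) : ℤ) : ℚ) by
        push_cast; rw [h1, h2]; ring]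
      exact isIntegral_algebraMap (R := ℤ)
    obtain ⟨m, hm⟩ := IsIntegrallyClosed.isIntegral_iff.1 this
    exact ⟨m, hm.symm⟩
  have h3 : m ^ 2 = l * (a ^ 2 - 4 * N) := by
    have : (m : ℚ) ^ 2 = l * (a ^ 2 - 4 * N) := by rw [← hm, h1, h2]; ring
    exact_mod_cast this
  obtain ⟨b, rfl⟩ := (Nat.prime_iff_prime_int.1 h.prime).dvd_of_dvd_pow ⟨_, h3⟩
  push_cast at hm
  have hb : 2 * y = b := mul_left_cancel₀ hl0 hm
  refine ⟨a, b, ?_, ?_⟩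
  · apply RingOfIntegers.ext
    rw [val_mul, val_add, val_mul, val_intCast, val_intCast, hxy, hS]
    have h2' := congrArg (algebraMap ℚ k) h2
    have hb' := congrArg (algebraMap ℚ k) hb
    simp only [map_mul, map_ofNat, map_intCast] at h2' hb'
    rw [h2', ← hb']
    change algebraMap (𝓞 k) k 2 * _ = _
    rw [map_ofNat]
    ring
  · have : (4 * N : ℚ) = a ^ 2 - l * b ^ 2 := by rw [h1, h2, ← hb]; ring
    exact_mod_cast this

theorem four_mul_norm_eq {z : 𝓞 k} {a b : ℤ} (hz : 2 * z = a + b * S) :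
    4 * Algebra.norm ℤ z = a ^ 2 - l * b ^ 2 := by
  obtain ⟨a', b', h1, h2⟩ := h.exists_two_mul_eq hS z
  have h3 : algebraMap ℚ k (a - a') + algebraMap ℚ k (b - b') * s = 0 := by
    have := congrArg (algebraMap (𝓞 k) k) (hz.symm.trans h1)
    simp only [map_add, map_mul, map_intCast] at this
    change (a : k) + b * (S : k) = a' + b' * (S : k) at this
    rw [hS] at this
    simp only [map_sub, map_intCast]
    linear_combination this
  obtain ⟨h4, h5⟩ := h.quad.eq_zero h3
  rw [sub_eq_zero, Int.cast_inj] at h4 h5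
  rw [h4, h5, h2]

theorem norm_int_add_mul (a b : ℤ) : Algebra.norm ℤ ((a : 𝓞 k) + b * S) = a ^ 2 - l * b ^ 2 := by
  have := h.four_mul_norm_eq hS (z := (a : 𝓞 k) + b * S) (a := 2 * a) (b :=
    2 * b) (by push_cast; ring)
  linarith

theorem norm_fundamental : Algebra.norm ℤ ((A : 𝓞 k) + B * S) = -1 := by
  have h1 := h.norm_int_add_mul hS A B
  have h2 : (A : ℤ) ^ 2 + 1 = l * B ^ 2 := by exact_mod_cast h.norm_eq
  push_cast at h1
  rw [h1]; linarith

theorem norm_sqrt : Algebra.norm ℤ S = -l := by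
  have := h.norm_int_add_mul hS 0 1
  simpa using this

omit hS in
theorem norm_natCast (n : ℕ) : Algebra.norm ℤ (n : 𝓞 k) = n ^ 2 := by
  obtain ⟨S, hS⟩ := h.exists_coe_eq
  have := h.norm_int_add_mul hS n 0
  simpa using this

theorem sqrt_dvd_intCast {m : ℤ} : S ∣ (m : 𝓞 k) ↔ (l : ℤ) ∣ m := by
  constructor
  · intro hm
    have h1 := map_dvd (Algebra.norm ℤ) hm
    have h2 := h.norm_int_add_mul hS m 0
    rw [Int.cast_zero, zero_mul, add_zero] at h2
    rw [h.norm_sqrt hS, h2, neg_dvd] at h1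
    exact (Nat.prime_iff_prime_int.1 h.prime).dvd_of_dvd_pow (n := 2) (by simpa using h1)
  · rintro ⟨c, rfl⟩
    refine ⟨S * c, ?_⟩
    push_cast
    rw [← h.sq_eq hS]; ring

theorem prime_sqrt : Prime S := by
  have h0 : S ≠ 0 := by
    rintro rfl
    have := h.norm_sqrt hS
    rw [Algebra.norm_zero] at this
    have := h.prime.ne_zero
    omega
  apply Ideal.prime_of_irreducible_absNorm_span h0
  rw [Ideal.absNorm_span_singleton, h.norm_sqrt hS, Int.natAbs_neg, Int.natAbs_natCast]
  exact h.prime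

theorem isMaximal_span_sqrt : (Ideal.span {S}).IsMaximal := by
  have h1 := h.prime_sqrt hS
  have : (Ideal.span {S}).IsPrime := (Ideal.span_singleton_prime h1.ne_zero).2 h1
  exact this.isMaximal (by rw [Ne, Ideal.span_singleton_eq_bot]; exact h1.ne_zero)

theorem not_sqrt_dvd_natCast_mul_fundamental {n : ℕ} (hn : n.Coprime l) :
    ¬ S ∣ (n : 𝓞 k) * (A + B * S) := by
  intro hd
  rcases (h.prime_sqrt hS).dvd_or_dvd hd with h1 | h1
  · have : ((n : ℤ) : 𝓞 k) = n := by push_cast; rfl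
    rw [← this, h.sqrt_dvd_intCast hS, Int.natCast_dvd_natCast] at h1
    exact h.prime.one_lt.ne' (Nat.eq_one_of_dvd_coprimes hn h1 dvd_rfl)
  · have := map_dvd (Algebra.norm ℤ) h1
    rw [h.norm_sqrt hS, h.norm_fundamental hS, dvd_neg, neg_dvd] at this
    exact h.prime.one_lt.ne' (by exact_mod_cast Int.eq_one_of_dvd_one (by positivity) this)

theorem exists_norm_eq_pow_four {n : ℕ} (hn : n.Coprime l) {a : 𝓞 k}
    (ha : Represents ((n : 𝓞 k) * ((A + B * S) * S)) a) :
    ∃ v : ZMod l, ((Algebra.norm ℤ a : ℤ) : ZMod l) = v ^ 4 := by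
  have : Fact l.Prime := ⟨h.prime⟩
  rw [show (n : 𝓞 k) * ((A + B * S) * S) = S * (n * (A + B * S)) by ring] at ha
  obtain ⟨t, ht⟩ := ha.exists_dvd_sub_sq (h.prime_sqrt hS) (h.isMaximal_span_sqrt hS)
    (h.not_sqrt_dvd_natCast_mul_fundamental hS hn)
  obtain ⟨c, e, hc, -⟩ := h.exists_two_mul_eq hS t
  obtain ⟨c', e', hc', hN⟩ := h.exists_two_mul_eq hS a
  have h1 : S ∣ ((2 * c' - c ^ 2 : ℤ) : 𝓞 k) := by
    have : ((2 * c' - c ^ 2 : ℤ) : 𝓞 k) = 4 * (a - t ^ 2) +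
        S * (2 * c * e + e ^ 2 * S - 2 * e') := by
      push_cast
      linear_combination -2 * hc' + (2 * t + c + e * S) * hc
    rw [this]
    exact dvd_add (ht.mul_left 4) (dvd_mul_right _ _)
  rw [h.sqrt_dvd_intCast hS, ← ZMod.intCast_zmod_eq_zero_iff_dvd] at h1
  have h2 := congrArg (Int.cast : ℤ → ZMod l) hN
  push_cast at h1 h2
  rw [ZMod.natCast_self] at h2
  have h20 : (2 : ZMod l) ≠ 0 := by
    have : ((2 : ℕ) : ZMod l) ≠ 0 := by
      rw [Ne, ZMod.natCast_eq_zero_iff]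
      intro h2l
      have := (Nat.prime_dvd_prime_iff_eq h.prime Nat.prime_two).1 h2l
      have := h.mod_eight
      omega
    exact_mod_cast this
  refine ⟨c / 2, ?_⟩
  rw [div_pow, eq_div_iff (pow_ne_zero 4 h20)]
  linear_combination 4 * h2 + (2 * c' + c ^ 2) * h1

end IsRealQuad

namespace IsRealQuad

variable {l A B : ℕ} {k : Type*} [Field k] [NumberField k] {s : k} (h : IsRealQuad l A B k s)
  {S : 𝓞 k} (hS : (S : k) = s)

include h hS

theorem exists_unit_rep (u : (𝓞 k)ˣ) : ∃ η : 𝓞 k,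
    (η = 1 ∨ η = -1 ∨ η = A + B * S ∨ η = -(A + B * S)) ∧
    (∃ w : k, w ≠ 0 ∧ ((u : 𝓞 k) : k) = η * w ^ 2) ∧
    ∀ D a : 𝓞 k, Represents D (a * u) → Represents D (a * η) := by
  obtain ⟨η', hη', w, hw, hu⟩ := h.units u
  obtain ⟨η, hη, hηη'⟩ : ∃ η : 𝓞 k, (η = 1 ∨ η = -1 ∨ η = A + B * S ∨ η = -(A + B * S)) ∧
      (η : k) = η' := by
    have hε : (((A : 𝓞 k) + B * S : 𝓞 k) : k) = A + B * s := by
      rw [val_add, val_mul, val_natCast, val_natCast, hS]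
    rcases hη' with rfl | rfl | rfl | rfl
    · exact ⟨1, by simp, val_one⟩
    · exact ⟨-1, by simp, by rw [val_neg, val_one]⟩
    · exact ⟨_, by simp, hε⟩
    · exact ⟨-(A + B * S), by simp only [or_true], by rw [val_neg, hε]⟩
  subst hηη'
  refine ⟨η, hη, ⟨w, hw, hu⟩, ?_⟩
  rintro D a ⟨x, y, z, hz, hxyz⟩
  obtain ⟨w₁, w₂, hw₂, rfl⟩ := IsFractionRing.div_surjective (A := 𝓞 k) w
  have hw₁ : w₁ ≠ 0 := by rintro rfl; simp at hw
  have h2 : algebraMap (𝓞 k) k w₂ ≠ 0 := IsFractionRing.to_map_ne_zero_of_mem_nonZeroDivisors hw₂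
  have key : u * w₂ ^ 2 = η * w₁ ^ 2 := by
    apply FaithfulSMul.algebraMap_injective (𝓞 k) k
    change algebraMap _ _ (u : 𝓞 k) = algebraMap _ _ η * _ at hu
    simp only [map_mul, map_pow, hu]
    field_simp
  refine ⟨x * w₂, y * w₂, z * w₁, mul_ne_zero hz hw₁, ?_⟩
  linear_combination w₂ ^ 2 * hxyz - z ^ 2 * a * key

theorem exists_ringHom_padicInt_of_sq {p : ℕ} [Fact p.Prime] {σ : ℤ_[p]} (hσ : σ ^ 2 = l) :
    ∃ (ψ : k →+* ℚ_[p]) (φ : 𝓞 k →+* ℤ_[p]), Function.Injective φ ∧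
      (∀ x, ((φ x : ℤ_[p]) : ℚ_[p]) = ψ x) ∧ φ S = σ := by
  obtain ⟨ψ, -, hψ⟩ := h.quad.exists_ringHom (algebraMap ℚ ℚ_[p]) (σ := (σ : ℚ_[p])) (by
    rw [← PadicInt.coe_pow, hσ, map_natCast, PadicInt.coe_natCast])
  obtain ⟨φ, hφ, hφψ⟩ := exists_ringHom_padicInt ψ
  refine ⟨ψ, φ, hφ, hφψ, Subtype.coe_injective ?_⟩
  change ((φ S : ℤ_[p]) : ℚ_[p]) = σ
  rw [hφψ, ← hψ, ← hS]

theorem exists_ringHom_padicInt_of_toZMod {p : ℕ} [Fact p.Prime] (hp : p ≠ 2) {s₀ : ZMod p}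
    (hs : s₀ ^ 2 = l) (hs0 : s₀ ≠ 0) :
    ∃ (ψ : k →+* ℚ_[p]) (φ : 𝓞 k →+* ℤ_[p]), Function.Injective φ ∧
      (∀ x, ((φ x : ℤ_[p]) : ℚ_[p]) = ψ x) ∧ PadicInt.toZMod (φ S) = s₀ := by
  obtain ⟨σ, hσ, rfl⟩ := PadicInt.exists_sq_eq_of_toZMod hp (τ := l) (by rw [hs, map_natCast]) hs0
  obtain ⟨ψ, φ, h1, h2, h3⟩ := h.exists_ringHom_padicInt_of_sq hS hσ
  exact ⟨ψ, φ, h1, h2, by rw [h3]⟩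

theorem isSquare_toZMod_of_represents {p n : ℕ} [Fact p.Prime] (hn : Squarefree n) (hpn : p ∣ n)
    (hnl : n.Coprime l) {φ : 𝓞 k →+* ℤ_[p]} (hφ : Function.Injective φ) {a : 𝓞 k}
    (ha : Represents ((n : 𝓞 k) * ((A + B * S) * S)) a) : IsSquare (PadicInt.toZMod (φ a)) := by
  obtain ⟨m, rfl⟩ := hpn
  have hpm : ¬ p ∣ m := fun hpm =>
    (Fact.out : p.Prime).one_lt.ne' (Nat.isUnit_iff.1 (hn p (mul_dvd_mul_left p hpm)))
  have hpl : ¬ p ∣ l := fun hpl => (Fact.out : p.Prime).one_lt.ne'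
    (Nat.eq_one_of_dvd_coprimes hnl (dvd_mul_right p m) hpl)
  have hrep := ha.map hφ
  have hD : φ (((p * m : ℕ) : 𝓞 k) * ((A + B * S) * S)) = p * (m * ((A + B * φ S) * φ S)) := by
    push_cast
    simp only [map_mul, map_add, map_natCast]
    ring
  rw [hD] at hrep
  apply hrep.isSquare_toZMod
  rw [← PadicInt.toZMod_eq_zero_iff_dvd]
  simp only [map_mul, map_add, map_natCast]
  set t := PadicInt.toZMod (φ S)
  have ht : t ^ 2 = l := by
    have := congrArg (fun x => PadicInt.toZMod (φ x)) (h.sq_eq hS)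
    simpa using this
  have hAB := congrArg (Nat.cast : ℕ → ZMod p) h.norm_eq
  push_cast at hAB
  have hm0 : (m : ZMod p) ≠ 0 := by rwa [Ne, ZMod.natCast_eq_zero_iff]
  have hl0 : (l : ZMod p) ≠ 0 := by rwa [Ne, ZMod.natCast_eq_zero_iff]
  refine mul_ne_zero hm0 (mul_ne_zero ?_ ?_)
  · intro h0
    have : (1 : ZMod p) = 0 := by linear_combination hAB - (A - B * t) * h0 - B ^ 2 * ht
    exact one_ne_zero this
  · intro h0
    rw [h0, zero_pow two_ne_zero] at ht
    exact hl0 ht.symm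

theorem norm_eq_mul {p : ℕ} [Fact p.Prime] (hp : p ≠ 2) {f g : 𝓞 k →+* ZMod p} (hfg : g S = -f S)
    (a : 𝓞 k) : ((Algebra.norm ℤ a : ℤ) : ZMod p) = f a * g a := by
  obtain ⟨c, e, hc, hN⟩ := h.exists_two_mul_eq hS a
  have h1 := congrArg f hc
  have h2 := congrArg g hc
  have h3 := congrArg f (h.sq_eq hS)
  have h4 := congrArg (Int.cast : ℤ → ZMod p) hN
  push_cast at h4
  simp only [map_mul, map_add, map_intCast, map_ofNat, map_pow, map_natCast, hfg] at h1 h2 h3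
  have h20 : (2 : ZMod p) ≠ 0 := by
    rw [← Nat.cast_two, Ne, ZMod.natCast_eq_zero_iff,
      Nat.prime_dvd_prime_iff_eq Fact.out Nat.prime_two]
    exact hp
  apply mul_left_cancel₀ (pow_ne_zero 2 h20)
  linear_combination h4 - 2 * g a * h1 - (c + e * f S) * h2 + e ^ 2 * h3

theorem isMaximal_span_natCast {p : ℕ} [Fact p.Prime] (hp : p ≠ 2) (hns : ¬ IsSquare (l : ZMod p)) :
    Prime (p : 𝓞 k) ∧ (Ideal.span {(p : 𝓞 k)}).IsMaximal := by
  have hp0 : (p : 𝓞 k) ≠ 0 := Nat.cast_ne_zero.2 (Fact.out : p.Prime).ne_zero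
  have h20 : (2 : ZMod p) ≠ 0 := by
    rw [← Nat.cast_two, Ne, ZMod.natCast_eq_zero_iff,
      Nat.prime_dvd_prime_iff_eq Fact.out Nat.prime_two]
    exact hp
  have key : ∀ x : 𝓞 k, (p : ℤ) ∣ Algebra.norm ℤ x → (p : 𝓞 k) ∣ x := by
    intro x hx
    obtain ⟨c, e, hc, hN⟩ := h.exists_two_mul_eq hS x
    rw [← ZMod.intCast_zmod_eq_zero_iff_dvd] at hx
    have h4 := congrArg (Int.cast : ℤ → ZMod p) hN
    push_cast at h4
    rw [hx, mul_zero] at h4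
    have he : (e : ZMod p) = 0 := by
      by_contra he
      exact hns ⟨c / e, by field_simp; linear_combination h4⟩
    have hc0 : (c : ZMod p) = 0 := by
      rw [he] at h4
      exact pow_eq_zero_iff two_ne_zero |>.1 (by linear_combination -h4)
    rw [ZMod.intCast_zmod_eq_zero_iff_dvd] at he hc0
    obtain ⟨e', rfl⟩ := he
    obtain ⟨c', rfl⟩ := hc0
    obtain ⟨m, hm⟩ : ∃ m : ℕ, p = 2 * m + 1 := (Fact.out : p.Prime).odd_of_ne_two hp
    have hm' := congrArg (Nat.cast : ℕ → 𝓞 k) hm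
    push_cast at hm' hc
    exact ⟨x - m * (c' + e' * S), by linear_combination (-m : 𝓞 k) * hc - x * hm'⟩
  have hprime : Prime (p : 𝓞 k) := by
    refine ⟨hp0, ?_, ?_⟩
    · intro hu
      have := (hu.map (Algebra.norm ℤ))
      rw [h.norm_natCast, Int.isUnit_iff_natAbs_eq] at this
      have hp1 := (Fact.out : p.Prime).one_lt
      rw [Int.natAbs_pow, Int.natAbs_natCast] at this
      nlinarith
    · intro x y hxy
      have := map_dvd (Algebra.norm ℤ) hxy
      rw [h.norm_natCast, map_mul] at this
      rcases (Nat.prime_iff_prime_int.1 (Fact.out : p.Prime)).dvd_or_dvd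
        ((dvd_pow_self _ two_ne_zero).trans this) with h1 | h1
      · exact Or.inl (key x h1)
      · exact Or.inr (key y h1)
  refine ⟨hprime, ?_⟩
  have : (Ideal.span {(p : 𝓞 k)}).IsPrime := (Ideal.span_singleton_prime hp0).2 hprime
  exact this.isMaximal (by rwa [Ne, Ideal.span_singleton_eq_bot])

theorem isSquare_norm_of_represents {p n : ℕ} [Fact p.Prime] (hp : p ≠ 2) (hn : Squarefree n)
    (hpn : p ∣ n) (hnl : n.Coprime l) {a : 𝓞 k}
    (ha : Represents ((n : 𝓞 k) * ((A + B * S) * S)) a) :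
    IsSquare ((Algebra.norm ℤ a : ℤ) : ZMod p) := by
  have hpl : ¬ p ∣ l := fun hpl => (Fact.out : p.Prime).one_lt.ne'
    (Nat.eq_one_of_dvd_coprimes hnl hpn hpl)
  have hl0 : (l : ZMod p) ≠ 0 := by rwa [Ne, ZMod.natCast_eq_zero_iff]
  by_cases hs : IsSquare (l : ZMod p)
  · obtain ⟨s₀, hs₀⟩ := hs
    rw [← pow_two] at hs₀
    have hs0 : s₀ ≠ 0 := by rintro rfl; exact hl0 (by simpa using hs₀)
    obtain ⟨-, φ, hφ, -, hφS⟩ := h.exists_ringHom_padicInt_of_toZMod hS hp hs₀.symm hs0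
    obtain ⟨-, φ', hφ', -, hφS'⟩ := h.exists_ringHom_padicInt_of_toZMod hS hp
      (s₀ := -s₀) (by rw [neg_sq, hs₀]) (neg_ne_zero.2 hs0)
    rw [h.norm_eq_mul hS hp (f := PadicInt.toZMod.comp φ) (g := PadicInt.toZMod.comp φ')
      (by simp [hφS, hφS'])]
    exact (h.isSquare_toZMod_of_represents hS hn hpn hnl hφ ha).mul
      (h.isSquare_toZMod_of_represents hS hn hpn hnl hφ' ha)
  · obtain ⟨hprime, hmax⟩ := h.isMaximal_span_natCast hS hp hs
    obtain ⟨m, rfl⟩ := hpn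
    rw [show ((p * m : ℕ) : 𝓞 k) * ((A + B * S) * S) = p * (m * ((A + B * S) * S)) by
      push_cast; ring] at ha
    have hpm : ¬ p ∣ m := fun hpm =>
      (Fact.out : p.Prime).one_lt.ne' (Nat.isUnit_iff.1 (hn p (mul_dvd_mul_left p hpm)))
    obtain ⟨t, y, hy⟩ := ha.exists_dvd_sub_sq hprime hmax (by
      intro hd
      have := map_dvd (Algebra.norm ℤ) hd
      rw [map_mul, map_mul, h.norm_fundamental hS, h.norm_sqrt hS, h.norm_natCast,
        h.norm_natCast] at this
      have h2 : p ^ 2 ∣ m ^ 2 * l := by exact_mod_cast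
        (by simpa using this : (p : ℤ) ^ 2 ∣ m ^ 2 * l)
      rcases ((Fact.out : p.Prime).dvd_mul).1 ((dvd_pow_self _ two_ne_zero).trans h2) with h3 | h3
      · exact hpm ((Fact.out : p.Prime).dvd_of_dvd_pow h3)
      · exact hpl h3)
    obtain ⟨c, e, hc, hN⟩ := h.exists_two_mul_eq hS t
    obtain ⟨c', e', hc', -⟩ := h.exists_two_mul_eq hS y
    have h1 := h.four_mul_norm_eq hS (z := 2 * a) (a := c ^ 2 + l * e ^ 2 + 2 * p * c')
      (b := 2 * c * e + 2 * p * e') (by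
        push_cast
        linear_combination 4 * hy + (2 * t + c + e * S) * hc + 2 * p * hc' + e ^ 2 * h.sq_eq hS)
    have h2 := h.norm_natCast 2
    rw [map_mul, show (2 : 𝓞 k) = (2 : ℕ) by norm_num, h2] at h1
    have h3 := congrArg (Int.cast : ℤ → ZMod p) h1
    have h4 := congrArg (Int.cast : ℤ → ZMod p) hN
    push_cast at h3 h4
    rw [ZMod.natCast_self p] at h3
    have h20 : (2 : ZMod p) ≠ 0 := by
      rw [← Nat.cast_two, Ne, ZMod.natCast_eq_zero_iff,
        Nat.prime_dvd_prime_iff_eq Fact.out Nat.prime_two]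
      exact hp
    refine ⟨(Algebra.norm ℤ t : ℤ), mul_left_cancel₀ (pow_ne_zero 4 h20) ?_⟩
    linear_combination h3 - (4 * (Algebra.norm ℤ t : ℤ) + c ^ 2 - l * e ^ 2) * h4

theorem exists_ringHom_zmod_eight : ∃ f : 𝓞 k →+* ZMod 8,
    (f (A + B * S) = A + 1 ∨ f (A + B * S) = A - 1) ∧
    (f ((A + B * S) * S) = 1 ∨ f ((A + B * S) * S) = 5) ∧
    ∀ D a : 𝓞 k, Represents D a → ∃ x y z : ZMod 8, (x ^ 2 = 1 ∨ y ^ 2 = 1 ∨ z ^ 2 = 1) ∧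
      z ^ 2 * f a = x ^ 2 - f D * y ^ 2 := by
  obtain ⟨σ, hσ⟩ := PadicInt.exists_sq_eq_natCast h.mod_eight
  obtain ⟨-, φ, hφ, -, hφS⟩ := h.exists_ringHom_padicInt_of_sq hS hσ
  let f : 𝓞 k →+* ZMod 8 := RingHom.comp (PadicInt.toZModPow 3 : ℤ_[2] →+* ZMod (2 ^ 3)) φ
  have hl8 : ((l : ℕ) : ZMod 8) = 1 := by
    have := h.mod_eight
    rw [← Nat.cast_one, ZMod.natCast_eq_natCast_iff]
    exact this
  have hfS : f S ^ 2 = 1 := by rw [← map_pow, h.sq_eq hS, map_natCast, hl8]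
  have hB : (B : ZMod 8) * f S = 1 ∨ (B : ZMod 8) * f S = -1 := by
    let g : ℤ_[2] →+* ZMod 16 := (PadicInt.toZModPow 4 : ℤ_[2] →+* ZMod (2 ^ 4))
    have hgf : ∀ x : ℤ_[2], ZMod.castHom (by norm_num : 8 ∣ 16) (ZMod 8) (g x) =
        (PadicInt.toZModPow 3 x : ZMod (2 ^ 3)) := fun x =>
      PadicInt.cast_toZModPow 3 4 (by norm_num) x
    have h1 : g (B * σ) ^ 2 = 1 := by
      rw [← map_pow, mul_pow, hσ, mul_comm]
      have : ((l : ℤ_[2]) * B ^ 2) = ((A ^ 2 + 1 : ℕ) : ℤ_[2]) := by rw [h.norm_eq]; push_cast; ring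
      rw [this, map_natCast, ← Nat.cast_one (R := ZMod 16), ZMod.natCast_eq_natCast_iff]
      obtain ⟨a, rfl⟩ := h.four_dvd
      rw [Nat.ModEq]; ring_nf; omega
    have h2 : ∀ x : ZMod 16, x ^ 2 = 1 → ZMod.castHom (by norm_num : 8 ∣ 16) (ZMod 8) x = 1 ∨
      ZMod.castHom (by norm_num : 8 ∣ 16) (ZMod 8) x = -1 := by decide
    have h3 := h2 _ h1
    rw [hgf, map_mul, map_natCast, ← hφS] at h3
    exact h3
  have hA : (A : ZMod 8) = 0 ∨ (A : ZMod 8) = 4 := by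
    obtain ⟨a, rfl⟩ := h.four_dvd
    push_cast
    generalize (a : ZMod 8) = x
    decide +revert
  have hB4 : (B : ZMod 8) = 1 ∨ (B : ZMod 8) = 5 := by
    obtain ⟨b, hb⟩ : ∃ b, B = 4 * b + 1 := ⟨B / 4, by have := h.mod_four; omega⟩
    rw [hb]
    push_cast
    generalize (b : ZMod 8) = x
    decide +revert
  refine ⟨f, ?_, ?_, fun D a ha => (ha.map hφ).zmod_eight⟩
  · rw [map_add, map_mul, map_natCast, map_natCast]
    rcases hB with hB | hB <;> rw [hB]
    · exact Or.inl rfl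
    · exact Or.inr (by ring)
  · rw [map_mul, map_add, map_mul, map_natCast, map_natCast]
    generalize f S = t at hfS hB ⊢
    rcases hA with hA | hA <;> rcases hB4 with hB4 | hB4 <;> rw [hA, hB4] <;> rw [hB4] at hB <;>
      clear hA hB4 <;> decide +revert

end IsRealQuad

theorem isSquare_mul_of_isSquare_pow_mul {F : Type*} [Field F] {x y : F} {N : ℕ} (hN : Odd N)
    (hx : x ≠ 0) (h : IsSquare (x ^ N * y)) : IsSquare (x * y) := by
  obtain ⟨m, rfl⟩ := hN
  obtain ⟨t, ht⟩ := h
  exact ⟨t / x ^ m, by field_simp; rw [← pow_mul, pow_two, ← ht]; ring⟩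

namespace IsRealQuad

variable {l A B : ℕ} {k : Type*} [Field k] [NumberField k] {s : k} (h : IsRealQuad l A B k s)
  {S : 𝓞 k} (hS : (S : k) = s) {K : Type*} [Field K] [NumberField K] [Algebra k K] {θ : K} {n : ℕ}
  (hK : IsQuadExt k K (((n : 𝓞 k) * ((A + B * S) * S) : 𝓞 k) : k) θ) (hn : Squarefree n)
  (hnl : n.Coprime l)

include h hS hK

theorem exists_represents_mul {I : nonZeroDivisors (Ideal (𝓞 K))} (hsq : IsSquare
    (ClassGroup.mk0 I))
    {a : 𝓞 k} (ha : Ideal.span {a} = Ideal.relNorm (𝓞 k) (I : Ideal (𝓞 K))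
      ^ Nat.card (ClassGroup (𝓞 k))) :
    ∃ η : 𝓞 k, (η = 1 ∨ η = -1 ∨ η = A + B * S ∨ η = -(A + B * S)) ∧
      Represents ((n : 𝓞 k) * ((A + B * S) * S)) (a * η) := by
  obtain ⟨u, hu⟩ := hK.exists_represents_of_isSquare rfl hsq ha
  obtain ⟨η, hη, -, hrep⟩ := h.exists_unit_rep hS u
  exact ⟨η, hη, hrep _ _ hu⟩

omit hK in
theorem norm_eq_one_or {η : 𝓞 k} (hη : η = 1 ∨ η = -1 ∨ η = A + B * S ∨ η = -(A + B * S)) :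
    (η = 1 ∨ η = -1) ∧ Algebra.norm ℤ η = 1 ∨
    (η = A + B * S ∨ η = -(A + B * S)) ∧ Algebra.norm ℤ η = -1 := by
  have h1 : Algebra.norm ℤ (-1 : 𝓞 k) = 1 := by simpa using h.norm_int_add_mul hS (-1) 0
  rcases hη with rfl | rfl | rfl | rfl
  · exact Or.inl ⟨Or.inl rfl, map_one _⟩
  · exact Or.inl ⟨Or.inr rfl, h1⟩
  · exact Or.inr ⟨Or.inl rfl, h.norm_fundamental hS⟩
  · refine Or.inr ⟨Or.inr rfl, ?_⟩
    rw [← neg_one_mul, map_mul, h1, h.norm_fundamental hS, one_mul]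

theorem exists_represents_norm {I : nonZeroDivisors (Ideal (𝓞 K))} (hsq : IsSquare
    (ClassGroup.mk0 I))
    {m : ℕ} (hm : Ideal.absNorm (Ideal.relNorm (𝓞 k) (I : Ideal (𝓞 K))) = m) :
    ∃ a : 𝓞 k, Represents ((n : 𝓞 k) * ((A + B * S) * S)) a ∧
      (Algebra.norm ℤ a = m ^ Nat.card (ClassGroup (𝓞 k)) ∨
        Algebra.norm ℤ a = -m ^ Nat.card (ClassGroup (𝓞 k))) := by
  obtain ⟨a, ha⟩ := exists_span_eq_pow_card (Ideal.relNorm (𝓞 k) (I : Ideal (𝓞 K)))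
  obtain ⟨η, hη, hrep⟩ := h.exists_represents_mul hS hK hsq ha
  refine ⟨a * η, hrep, ?_⟩
  have h1 := congrArg Ideal.absNorm ha
  rw [Ideal.absNorm_span_singleton, map_pow, hm] at h1
  have h2 : Algebra.norm ℤ a = m ^ Nat.card (ClassGroup (𝓞 k)) ∨
      Algebra.norm ℤ a = -m ^ Nat.card (ClassGroup (𝓞 k)) := by
    rcases Int.natAbs_eq (Algebra.norm ℤ a) with h2 | h2 <;> rw [h1] at h2 <;> push_cast at h2
    · exact Or.inl h2
    · exact Or.inr h2
  rw [map_mul]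
  rcases h.norm_eq_one_or hS hη with ⟨-, h3⟩ | ⟨-, h3⟩ <;> rw [h3]
  · simpa using h2
  · rcases h2 with h2 | h2 <;> rw [h2] <;> simp

include hnl in
theorem exists_not_isSquare {p₀ r : ℕ} [Fact r.Prime] (hr : IsAuxPrime l n p₀ A B r) {s₀ : ZMod r}
    (hs₀ : s₀ ^ 2 = l) (hn0 : 0 < n) : ∃ (φ : 𝓞 k →+* ZMod r) (R : nonZeroDivisors (Ideal (𝓞 K))),
    φ S = s₀ ∧
      Ideal.relNorm (𝓞 k) (R : Ideal (𝓞 K)) = RingHom.ker φ ∧ ¬ IsSquare (ClassGroup.mk0 R) := by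
  have hlp : Fact l.Prime := ⟨h.prime⟩
  have hr4 := hr.mod_four
  have hr2 : r ≠ 2 := by omega
  have hgt := hr.gt
  have hl0' := h.prime.pos
  have hn0' : (n : ZMod r) ≠ 0 := by
    rw [Ne, ZMod.natCast_eq_zero_iff]
    intro hd
    have := Nat.le_of_dvd hn0 hd
    nlinarith
  have hl0 : (l : ZMod r) ≠ 0 := by
    rw [Ne, ZMod.natCast_eq_zero_iff]
    intro hd
    have := Nat.le_of_dvd hl0' hd
    nlinarith
  have hs0 : s₀ ≠ 0 := by rintro rfl; exact hl0 (by simpa using hs₀.symm)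
  obtain ⟨ψ, φ, -, hψ, hφS⟩ := h.exists_ringHom_padicInt_of_toZMod hS hr2 hs₀ hs0
  obtain ⟨w, hw⟩ := hr.isSquare s₀ hs₀
  have hAB := congrArg (Nat.cast : ℕ → ZMod r) h.norm_eq
  push_cast at hAB hw
  have hε : (A + B * s₀ : ZMod r) ≠ 0 := by
    intro h0
    have : (1 : ZMod r) = 0 := by linear_combination hAB - (A - B * s₀) * h0 - B ^ 2 * hs₀
    exact one_ne_zero this
  obtain ⟨R, hR⟩ := hK.exists_relNorm_eq_ker rfl hr2 hψ (w := w) (by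
    simp only [map_mul, map_add, map_natCast, hφS]
    rw [hw, pow_two]) (by
    rintro rfl
    rw [mul_zero] at hw
    exact mul_ne_zero hn0' (mul_ne_zero hε hs0) hw)
  refine ⟨PadicInt.toZMod.comp φ, R, hφS, hR, fun hsq => ?_⟩
  obtain ⟨a, ha, hN⟩ := h.exists_represents_norm hS hK hsq (m := r) (by rw [hR, Ideal.absNorm_ker])
  obtain ⟨v, hv⟩ := h.exists_norm_eq_pow_four hS hnl ha
  obtain ⟨m, hm⟩ : ∃ m : ℕ, l - 1 = 8 * m := ⟨(l - 1) / 8, by have := h.mod_eight; omega⟩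
  have hq : (l - 1) / 4 = 2 * m := by omega
  have h2 : ((Algebra.norm ℤ a : ℤ) : ZMod l) ^ ((l - 1) / 4) = -1 := by
    have h3 := hr.pow_quarter
    rcases hN with hN | hN <;> rw [hN]
    · push_cast
      rw [← pow_mul, mul_comm, pow_mul, h3, h.odd_card_classGroup.neg_one_pow]
    · push_cast
      rw [hq, (even_two_mul m).neg_pow, ← hq, ← pow_mul, mul_comm, pow_mul, h3,
        h.odd_card_classGroup.neg_one_pow]
  have h11 : (1 : ZMod l) ≠ -1 := by
    intro h11
    have : ((2 : ℕ) : ZMod l) = 0 := by push_cast; linear_combination h11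
    rw [ZMod.natCast_eq_zero_iff, Nat.prime_dvd_prime_iff_eq h.prime Nat.prime_two] at this
    have := h.mod_eight
    omega
  have hv0 : v ≠ 0 := by
    rintro rfl
    have : 0 < (l - 1) / 4 := by have := h.prime.two_le; omega
    rw [hv, zero_pow (by norm_num), zero_pow this.ne'] at h2
    exact one_ne_zero (α := ZMod l) (by linear_combination h2)
  rw [hv, ← pow_mul, hq, show 4 * (2 * m) = l - 1 by omega, ZMod.pow_card_sub_one_eq_one hv0] at h2
  exact h11 h2

include hn hnl in
theorem card_twoTorsion_classGroup_ne_one (hn1 : n ≠ 1) :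
    Nat.card {x : ClassGroup (𝓞 K) // x ^ 2 = 1} ≠ 1 := by
  obtain ⟨p, hp, hpn⟩ := Nat.exists_prime_and_dvd hn1
  obtain ⟨r, hr⟩ := exists_isAuxPrime h.prime (by have := h.mod_eight; omega) hn hnl hp hpn
    (A := A) (B := B) (by exact_mod_cast h.norm_eq) (by
      have := h.mod_four; rw [Int.odd_iff]; omega)
  have : Fact r.Prime := ⟨hr.prime⟩
  obtain ⟨s₀, hs₀⟩ := hr.exists_sqrt
  obtain ⟨-, R, -, -, hR⟩ := h.exists_not_isSquare hS hK hnl hr hs₀ hn.ne_zero.bot_lt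
  exact card_twoTorsion_ne_one hR

include hn hnl in
theorem exists_represents_pow (hc : Nat.card {x : ClassGroup (𝓞 K) // x ^ 2 = 1} = 2) {p₀ r : ℕ}
    (hr : IsAuxPrime l n p₀ A B r) :
    ∃ η : 𝓞 k, (η = 1 ∨ η = -1 ∨ η = A + B * S ∨ η = -(A + B * S)) ∧
      Represents ((n : 𝓞 k) * ((A + B * S) * S)) (r ^ Nat.card (ClassGroup (𝓞 k)) * η) := by
  have : Fact r.Prime := ⟨hr.prime⟩
  obtain ⟨s₀, hs₀⟩ := hr.exists_sqrt
  have hn0 := hn.ne_zero.bot_lt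
  obtain ⟨φ, R, hφ, hR, hRsq⟩ := h.exists_not_isSquare hS hK hnl hr hs₀ hn0
  obtain ⟨φ', R', hφ', hR', hRsq'⟩ := h.exists_not_isSquare hS hK hnl hr (s₀ := -s₀)
    (by rw [neg_sq, hs₀]) hn0
  have hsq := isSquare_mul_of_card_twoTorsion hc hRsq hRsq'
  rw [← map_mul] at hsq
  refine h.exists_represents_mul hS hK hsq ?_
  rw [Submonoid.coe_mul, map_mul, hR, hR',
    Ideal.mul_eq_span_of_absNorm_eq h.quad.finrank_eq hr.prime
    (Ideal.absNorm_ker φ) (Ideal.absNorm_ker φ'), Ideal.span_singleton_pow]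
  intro hker
  have hmem : S - (s₀.val : 𝓞 k) ∈ RingHom.ker φ := by
    rw [RingHom.mem_ker, map_sub, map_natCast, hφ, ZMod.natCast_zmod_val, sub_self]
  rw [hker, RingHom.mem_ker, map_sub, map_natCast, hφ', ZMod.natCast_zmod_val] at hmem
  have h4 : (4 * l : ZMod r) = 0 := by rw [← hs₀]; linear_combination -2 * s₀ * hmem
  have h5 : ((4 * l : ℕ) : ZMod r) = 0 := by exact_mod_cast h4
  rw [ZMod.natCast_eq_zero_iff, hr.prime.dvd_mul] at h5
  have hgt := hr.gt
  have hr4 := hr.mod_four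
  have hl17 : 8 < l := by
    have := h.mod_eight
    have := h.prime.two_le
    omega
  rcases h5 with h5 | h5
  · have := Nat.le_of_dvd (by norm_num) h5
    nlinarith
  · have := Nat.le_of_dvd h.prime.pos h5
    nlinarith

include hn hnl in
theorem exists_represents_norm_mul (hc : Nat.card {x : ClassGroup (𝓞 K) // x ^ 2 = 1} = 2)
    {p₀ p₁ r₀ r₁ : ℕ} (hr₀ : IsAuxPrime l n p₀ A B r₀) (hr₁ : IsAuxPrime l n p₁ A B r₁) :
    ∃ a : 𝓞 k, Represents ((n : 𝓞 k) * ((A + B * S) * S)) a ∧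
      (Algebra.norm ℤ a = (r₀ * r₁ : ℕ) ^ Nat.card (ClassGroup (𝓞 k)) ∨
        Algebra.norm ℤ a = -(r₀ * r₁ : ℕ) ^ Nat.card (ClassGroup (𝓞 k))) := by
  have : Fact r₀.Prime := ⟨hr₀.prime⟩
  have : Fact r₁.Prime := ⟨hr₁.prime⟩
  obtain ⟨s₀, hs₀⟩ := hr₀.exists_sqrt
  obtain ⟨s₁, hs₁⟩ := hr₁.exists_sqrt
  have hn0 := hn.ne_zero.bot_lt
  obtain ⟨φ, R, hφ, hR, hRsq⟩ := h.exists_not_isSquare hS hK hnl hr₀ hs₀ hn0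
  obtain ⟨φ', R', hφ', hR', hRsq'⟩ := h.exists_not_isSquare hS hK hnl hr₁ hs₁ hn0
  have hsq := isSquare_mul_of_card_twoTorsion hc hRsq hRsq'
  rw [← map_mul] at hsq
  exact h.exists_represents_norm hS hK hsq (by
    rw [Submonoid.coe_mul, map_mul, map_mul, hR, hR', Ideal.absNorm_ker, Ideal.absNorm_ker])

end IsRealQuad

namespace IsRealQuad

variable {l A B : ℕ} {k : Type*} [Field k] [NumberField k] {s : k} (h : IsRealQuad l A B k s)
  {S : 𝓞 k} (hS : (S : k) = s) {K : Type*} [Field K] [NumberField K] [Algebra k K] {θ : K} {n : ℕ}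
  (hK : IsQuadExt k K (((n : 𝓞 k) * ((A + B * S) * S) : 𝓞 k) : k) θ) (hn : Squarefree n)
  (hnl : n.Coprime l)

include h hn hnl

theorem exists_isAuxPrime_of_dvd {p : ℕ} (hp : p.Prime) (hpn : p ∣ n) :
    ∃ r, IsAuxPrime l n p A B r :=
  exists_isAuxPrime h.prime (by have := h.mod_eight; omega) hn hnl hp hpn
    (by exact_mod_cast h.norm_eq) (by have := h.mod_four; rw [Int.odd_iff]; omega)

include hS hK

theorem card_ne_two_of_mod_four_eq_one {p p₁ : ℕ} (hp : p.Prime) (hp4 : p % 4 = 1) (hpn : p ∣ n)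
    (hp₁ : p₁.Prime) (hpn₁ : p₁ ∣ n) (hne : p₁ ≠ p) :
    Nat.card {x : ClassGroup (𝓞 K) // x ^ 2 = 1} ≠ 2 := by
  intro hc
  have : Fact p.Prime := ⟨hp⟩
  have hp2 : p ≠ 2 := by omega
  obtain ⟨r₀, hr₀⟩ := h.exists_isAuxPrime_of_dvd hn hnl hp hpn
  obtain ⟨r₁, hr₁⟩ := h.exists_isAuxPrime_of_dvd hn hnl hp₁ hpn₁
  obtain ⟨a, ha, hN⟩ := h.exists_represents_norm_mul hS hK hn hnl hc hr₀ hr₁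
  have hsq := h.isSquare_norm_of_represents hS hp2 hn hpn hnl ha
  have hns := hr₀.not_isSquare hp2
  have hr0 : (r₀ : ZMod p) ≠ 0 := fun h0 => hns (h0 ▸ IsSquare.zero)
  have h1 : IsSquare (-1 : ZMod p) := ZMod.exists_sq_eq_neg_one_iff.2 (by omega)
  have h2 : IsSquare ((r₀ : ZMod p) ^ Nat.card (ClassGroup (𝓞 k)) * 1) := by
    rcases hN with hN | hN <;> rw [hN] at hsq <;> push_cast at hsq <;>
      rw [hr₁.eq_one p hp hpn hne.symm, mul_one] at hsq
    · simpa using hsq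
    · simpa using h1.mul hsq
  exact hns (by simpa using isSquare_mul_of_isSquare_pow_mul h.odd_card_classGroup hr0 h2)

theorem card_ne_two_of_mod_four_eq_three {q₁ q₂ p₁ : ℕ} (hq₁ : q₁.Prime) (hq₂ : q₂.Prime)
    (hq₁4 : q₁ % 4 = 3) (hq₂4 : q₂ % 4 = 3) (hqn₁ : q₁ ∣ n) (hqn₂ : q₂ ∣ n) (hp₁ : p₁.Prime)
    (hpn₁ : p₁ ∣ n) (hne : q₁ ≠ q₂) (hne₁ : p₁ ≠ q₁) (hne₂ : p₁ ≠ q₂) :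
    Nat.card {x : ClassGroup (𝓞 K) // x ^ 2 = 1} ≠ 2 := by
  intro hc
  have : Fact q₁.Prime := ⟨hq₁⟩
  have : Fact q₂.Prime := ⟨hq₂⟩
  have hq2 : q₁ ≠ 2 := by omega
  obtain ⟨r₀, hr₀⟩ := h.exists_isAuxPrime_of_dvd hn hnl hq₁ hqn₁
  obtain ⟨r₁, hr₁⟩ := h.exists_isAuxPrime_of_dvd hn hnl hp₁ hpn₁
  obtain ⟨a, ha, hN⟩ := h.exists_represents_norm_mul hS hK hn hnl hc hr₀ hr₁
  have hsq₁ := h.isSquare_norm_of_represents hS hq2 hn hqn₁ hnl ha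
  have hsq₂ := h.isSquare_norm_of_represents hS (by omega) hn hqn₂ hnl ha
  have hns := hr₀.not_isSquare hq2
  have hr0 : (r₀ : ZMod q₁) ≠ 0 := fun h0 => hns (h0 ▸ IsSquare.zero)
  rcases hN with hN | hN
  · rw [hN] at hsq₁
    push_cast at hsq₁
    rw [hr₁.eq_one q₁ hq₁ hqn₁ hne₁.symm, mul_one] at hsq₁
    rw [← mul_one (_ ^ _)] at hsq₁
    have := isSquare_mul_of_isSquare_pow_mul h.odd_card_classGroup hr0 hsq₁
    rw [mul_one] at this
    exact hns this
  · rw [hN] at hsq₂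
    push_cast at hsq₂
    rw [hr₁.eq_one q₂ hq₂ hqn₂ hne₂.symm, hr₀.eq_one q₂ hq₂ hqn₂ hne.symm, mul_one, one_pow] at hsq₂
    exact (ZMod.exists_sq_eq_neg_one_iff.1 hsq₂) hq₂4

theorem card_ne_two_of_isSquare {p : ℕ} [Fact p.Prime] (hp4 : p % 4 = 1) (hpn : p ∣ n) {s₀ : ZMod p}
    (hs₀ : s₀ ^ 2 = l) (hε : IsSquare (A + B * s₀)) :
    Nat.card {x : ClassGroup (𝓞 K) // x ^ 2 = 1} ≠ 2 := by
  intro hc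
  have hp : p.Prime := Fact.out
  have hp2 : p ≠ 2 := by omega
  have hs0 : s₀ ≠ 0 := by
    rintro rfl
    have : (l : ZMod p) = 0 := by simpa using hs₀.symm
    rw [ZMod.natCast_eq_zero_iff] at this
    exact hp.one_lt.ne' (Nat.eq_one_of_dvd_coprimes hnl hpn this)
  obtain ⟨r, hr⟩ := h.exists_isAuxPrime_of_dvd hn hnl hp hpn
  obtain ⟨η, hη, hrep⟩ := h.exists_represents_pow hS hK hn hnl hc hr
  obtain ⟨-, φ, hφ, -, hφS⟩ := h.exists_ringHom_padicInt_of_toZMod hS hp2 hs₀ hs0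
  have hsq := h.isSquare_toZMod_of_represents hS hn hpn hnl hφ hrep
  have h1 : IsSquare (-1 : ZMod p) := ZMod.exists_sq_eq_neg_one_iff.2 (by omega)
  have hns := hr.not_isSquare hp2
  have hr0 : (r : ZMod p) ≠ 0 := fun h0 => hns (h0 ▸ IsSquare.zero)
  have hφε : PadicInt.toZMod (φ (A + B * S)) = A + B * s₀ := by simp [hφS]
  have hηsq : IsSquare (PadicInt.toZMod (φ η)) ∧ PadicInt.toZMod (φ η) ≠ 0 := by
    have hε0 : (A + B * s₀ : ZMod p) ≠ 0 := by
      intro h0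
      have hAB := congrArg (Nat.cast : ℕ → ZMod p) h.norm_eq
      push_cast at hAB
      have : (1 : ZMod p) = 0 := by linear_combination hAB - (A - B * s₀) * h0 - B ^ 2 * hs₀
      exact one_ne_zero this
    rcases hη with rfl | rfl | rfl | rfl
    · simp
    · simpa using h1
    · rw [hφε]; exact ⟨hε, hε0⟩
    · rw [map_neg, map_neg, hφε]; exact ⟨by simpa using h1.mul hε, neg_ne_zero.2 hε0⟩
  simp only [map_mul, map_pow, map_natCast] at hsq
  have h3 := isSquare_mul_of_isSquare_pow_mul h.odd_card_classGroup hr0 hsq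
  apply hns
  have := h3.div hηsq.1
  rwa [mul_div_cancel_right₀ _ hηsq.2] at this

omit hn hnl in
theorem card_ne_two_of_eight_dvd (hn2 : n = 2) (hA : 8 ∣ A) :
    Nat.card {x : ClassGroup (𝓞 K) // x ^ 2 = 1} ≠ 2 := by
  intro hc
  subst hn2
  have hnl : Nat.Coprime 2 l := (Nat.coprime_primes Nat.prime_two h.prime).2 (by
    have := h.mod_eight; omega)
  obtain ⟨r, hr⟩ := h.exists_isAuxPrime_of_dvd Nat.prime_two.squarefree hnl Nat.prime_two dvd_rfl
  obtain ⟨η, hη, hrep⟩ := h.exists_represents_pow hS hK Nat.prime_two.squarefree hnl hc hr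
  obtain ⟨f, hf1, hf2, hf⟩ := h.exists_ringHom_zmod_eight hS
  obtain ⟨x, y, z, hxyz, heq⟩ := hf _ _ hrep
  have hr5 : (r : ZMod 8) = 5 := by
    have := hr.mod_eight_two rfl
    exact (ZMod.natCast_eq_natCast_iff r 5 8).2 this
  have hpow : (5 : ZMod 8) ^ Nat.card (ClassGroup (𝓞 k)) = 5 := by
    obtain ⟨m, hm⟩ := h.odd_card_classGroup
    rw [hm, pow_succ, pow_mul, show (5 : ZMod 8) ^ 2 = 1 by decide, one_pow, one_mul]
  have hA0 : (A : ZMod 8) = 0 := (ZMod.natCast_eq_zero_iff _ _).2 hA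
  rw [hA0, zero_add, zero_sub] at hf1
  have hfη : f η = 1 ∨ f η = -1 := by
    rcases hη with rfl | rfl | rfl | rfl
    · simp
    · simp
    · exact hf1
    · rw [map_neg, neg_inj, neg_eq_iff_eq_neg]
      exact hf1.symm
  have hfD : f (((2 : ℕ) : 𝓞 k) * ((A + B * S) * S)) = 2 := by
    rw [map_mul, map_natCast]
    rcases hf2 with hf2 | hf2 <;> rw [hf2] <;> decide
  rw [hfD, map_mul, map_pow, map_natCast, hr5, hpow] at heq
  rcases hfη with hfη | hfη <;> rw [hfη] at heq <;> revert hxyz heq <;> clear * - <;>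
    revert x y z <;> decide

theorem exists_represents_neg_pow (hc : Nat.card {x : ClassGroup (𝓞 K) // x ^ 2 = 1} = 2) {q : ℕ}
    [Fact q.Prime] (hq4 : q % 4 = 3) (hqn : q ∣ n) (hl : IsSquare (l : ZMod q)) :
    ∃ r, IsAuxPrime l n q A B r ∧
      Represents ((n : 𝓞 k) * ((A + B * S) * S)) (-r ^ Nat.card (ClassGroup (𝓞 k))) := by
  have hq : q.Prime := Fact.out
  have hq2 : q ≠ 2 := by omega
  obtain ⟨s₀, hs₀⟩ := hl
  rw [← pow_two] at hs₀
  have hs0 : s₀ ≠ 0 := by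
    rintro rfl
    have : (l : ZMod q) = 0 := by simpa using hs₀
    rw [ZMod.natCast_eq_zero_iff] at this
    exact hq.one_lt.ne' (Nat.eq_one_of_dvd_coprimes hnl hqn this)
  obtain ⟨r, hr⟩ := h.exists_isAuxPrime_of_dvd hn hnl hq hqn
  obtain ⟨η, hη, hrep⟩ := h.exists_represents_pow hS hK hn hnl hc hr
  have hns := hr.not_isSquare hq2
  have hr0 : (r : ZMod q) ≠ 0 := fun h0 => hns (h0 ▸ IsSquare.zero)
  rcases h.norm_eq_one_or hS hη with ⟨rfl | rfl, -⟩ | ⟨-, hN⟩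
  · exfalso
    obtain ⟨-, φ, hφ, -, -⟩ := h.exists_ringHom_padicInt_of_toZMod hS hq2 hs₀.symm hs0
    have hsq := h.isSquare_toZMod_of_represents hS hn hqn hnl hφ hrep
    simp only [map_mul, map_pow, map_natCast, map_one] at hsq
    have := isSquare_mul_of_isSquare_pow_mul h.odd_card_classGroup hr0 hsq
    rw [mul_one] at this
    exact hns this
  · exact ⟨r, hr, by rwa [mul_neg_one] at hrep⟩
  · exfalso
    have hsq := h.isSquare_norm_of_represents hS hq2 hn hqn hnl hrep
    rw [map_mul, map_pow, h.norm_natCast, hN, ← pow_mul, mul_comm 2, pow_mul] at hsq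
    push_cast at hsq
    have := hsq.div (IsSquare.sq ((r : ZMod q) ^ Nat.card (ClassGroup (𝓞 k))))
    rw [mul_div_cancel_left₀ _ (pow_ne_zero _ (pow_ne_zero _ hr0))] at this
    exact ZMod.exists_sq_eq_neg_one_iff.1 this hq4

omit hn hnl hK in
theorem exists_ringHom_ne_neg_one {q : ℕ} (hq4 : q % 4 = 3) (hnq : n = q ∨ n = 2 * q) :
    ∃ f : 𝓞 k →+* ZMod 8, ∀ a, Represents ((n : 𝓞 k) * ((A + B * S) * S)) a → f a ≠ -1 := by
  obtain ⟨f, -, hf2, hf⟩ := h.exists_ringHom_zmod_eight hS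
  refine ⟨f, fun a ha hfa => ?_⟩
  obtain ⟨x, y, z, hxyz, heq⟩ := hf _ _ ha
  have hn8 : (n : ZMod 8) = 3 ∨ (n : ZMod 8) = 7 ∨ (n : ZMod 8) = 6 := by
    obtain ⟨m, rfl⟩ : ∃ m, q = 4 * m + 3 := ⟨q / 4, by omega⟩
    rcases hnq with rfl | rfl <;> push_cast <;> generalize (m : ZMod 8) = t <;> clear * - <;>
      decide +revert
  rw [hfa, map_mul, map_natCast] at heq
  rcases hn8 with hn8 | hn8 | hn8 <;> rcases hf2 with hf2 | hf2 <;> rw [hn8, hf2] at heq <;>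
    revert hxyz heq <;> clear * - <;> revert x y z <;> decide

theorem card_ne_two_of_eq_or_eq_two_mul {q : ℕ} [Fact q.Prime] (hq4 : q % 4 = 3)
    (hnq : n = q ∨ n = 2 * q) (hl : IsSquare (l : ZMod q)) :
    Nat.card {x : ClassGroup (𝓞 K) // x ^ 2 = 1} ≠ 2 := by
  intro hc
  have hqn : q ∣ n := by rcases hnq with h | h <;> simp [h]
  obtain ⟨r, hr, hrep⟩ := h.exists_represents_neg_pow hS hK hn hnl hc hq4 hqn hl
  obtain ⟨f, hf⟩ := h.exists_ringHom_ne_neg_one hS hq4 hnq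
  have hr1 : (r : ZMod 8) = 1 := by
    have := hr.mod_eight (by omega)
    rw [← Nat.cast_one]
    exact (ZMod.natCast_eq_natCast_iff r 1 8).2 this
  exact hf _ hrep (by rw [map_neg, map_pow, map_natCast, hr1, one_pow])

theorem card_ne_two_of_isSquare_of_isSquare {q₁ q₂ : ℕ} [Fact q₁.Prime] [Fact q₂.Prime]
    (hq₁4 : q₁ % 4 = 3) (hq₂4 : q₂ % 4 = 3) (hne : q₁ ≠ q₂) (hqn₁ : q₁ ∣ n) (hqn₂ : q₂ ∣ n)
    (hl₁ : IsSquare (l : ZMod q₁)) (hl₂ : IsSquare (l : ZMod q₂)) :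
    Nat.card {x : ClassGroup (𝓞 K) // x ^ 2 = 1} ≠ 2 := by
  intro hc
  obtain ⟨r, hr, hrep⟩ := h.exists_represents_neg_pow hS hK hn hnl hc hq₁4 hqn₁ hl₁
  have hq₂ : q₂.Prime := Fact.out
  obtain ⟨s₀, hs₀⟩ := hl₂
  rw [← pow_two] at hs₀
  have hs0 : s₀ ≠ 0 := by
    rintro rfl
    have : (l : ZMod q₂) = 0 := by simpa using hs₀
    rw [ZMod.natCast_eq_zero_iff] at this
    exact hq₂.one_lt.ne' (Nat.eq_one_of_dvd_coprimes hnl hqn₂ this)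
  obtain ⟨-, φ, hφ, -, -⟩ := h.exists_ringHom_padicInt_of_toZMod hS (by omega) hs₀.symm hs0
  have hsq := h.isSquare_toZMod_of_represents hS hn hqn₂ hnl hφ hrep
  simp only [map_neg, map_pow, map_natCast, hr.eq_one q₂ hq₂ hqn₂ hne.symm, one_pow] at hsq
  exact ZMod.exists_sq_eq_neg_one_iff.1 hsq hq₂4

end IsRealQuad

theorem Ideal.exists_finset_card_le {F : Type*} [Field F] [NumberField F] {p : ℕ} (hp : p.Prime) :
    ∃ T : Finset (Ideal (𝓞 F)), T.card ≤ Module.finrank ℚ F ∧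
      ∀ P : Ideal (𝓞 F), Prime P → (p : 𝓞 F) ∈ P → P ∈ T := by
  classical
  set I := Ideal.span {(p : 𝓞 F)}
  have hI : I ≠ ⊥ := by
    rw [Ne, Ideal.span_singleton_eq_bot]; exact Nat.cast_ne_zero.2 hp.ne_zero
  set M := UniqueFactorizationMonoid.normalizedFactors I
  refine ⟨M.toFinset, (Multiset.toFinset_card_le M).trans ?_, fun P hP hpP => ?_⟩
  · have h1 : (M.map Ideal.absNorm).prod = p ^ Module.finrank ℚ F := by
      rw [← map_multiset_prod, Ideal.prod_normalizedFactors_eq_self hI, Ideal.absNorm_span_natCast,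
        RingOfIntegers.rank]
    have h2 : (M.map fun _ => p).prod ∣ (M.map Ideal.absNorm).prod := by
      apply Multiset.prod_dvd_prod_of_dvd
      intro P hP
      have hd : Ideal.absNorm P ∣ p ^ Module.finrank ℚ F := by
        rw [← h1]
        exact Multiset.dvd_prod (Multiset.mem_map_of_mem _ hP)
      obtain ⟨j, -, hj⟩ := (Nat.dvd_prime_pow hp).1 hd
      rw [hj]
      refine dvd_pow_self p ?_
      rintro rfl
      rw [pow_zero, Ideal.absNorm_eq_one_iff] at hj
      exact ((Ideal.mem_normalizedFactors_iff hI).1 hP).1.ne_top hj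
    rw [Multiset.map_const', Multiset.prod_replicate, h1] at h2
    exact (Nat.pow_dvd_pow_iff_le_right hp.one_lt).1 h2
  · rw [Multiset.mem_toFinset, Ideal.mem_normalizedFactors_iff hI]
    exact ⟨Ideal.isPrime_of_prime hP, by rwa [Ideal.span_singleton_le_iff_mem]⟩

theorem odd_multiplicity_span_mul {R : Type*} [CommRing R] [IsDedekindDomain R] {π E : R}
    (hπ : Prime π) (hE : ¬ π ∣ E) :
    Odd (multiplicity (Ideal.span {π}) (Ideal.span {π * E})) := by
  rw [multiplicity_eq_of_dvd_of_not_dvd (k := 1)]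
  · exact odd_one
  · rw [pow_one, Ideal.dvd_span_singleton]
    exact Ideal.mul_mem_right _ _ (Ideal.mem_span_singleton_self _)
  · rw [Ideal.span_singleton_pow, Ideal.dvd_span_singleton, Ideal.mem_span_singleton,
    one_add_one_eq_two,
      pow_two]
    exact fun hd => hE ((mul_dvd_mul_iff_left hπ.ne_zero).1 hd)

namespace IsRealQuad

variable {l A B : ℕ} {k : Type*} [Field k] [NumberField k] {s : k} (h : IsRealQuad l A B k s)
  {S : 𝓞 k} (hS : (S : k) = s) {K : Type*} [Field K] [NumberField K] [Algebra k K] {θ : K} {n : ℕ}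
  (hK : IsQuadExt k K (((n : 𝓞 k) * ((A + B * S) * S) : 𝓞 k) : k) θ) (hn : Squarefree n)
  (hnl : n.Coprime l)

include h hS

theorem exists_finset_card_le_one {p : ℕ} [Fact p.Prime] (hp : p ≠ 2) (hns : ¬ IsSquare (l :
    ZMod p)) :
    ∃ T : Finset (Ideal (𝓞 k)), T.card ≤ 1 ∧ ∀ P : Ideal (𝓞 k), Prime P → (p : 𝓞 k) ∈ P →
      P ∈ T := by
  obtain ⟨-, hmax⟩ := h.isMaximal_span_natCast hS hp hns
  refine ⟨{Ideal.span {(p : 𝓞 k)}}, by simp, fun P hP hpP => ?_⟩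
  rw [Finset.mem_singleton]
  exact (hmax.eq_of_le (Ideal.isPrime_of_prime hP).ne_top
    (by rwa [Ideal.span_singleton_le_iff_mem])).symm

theorem fundamental_mul_sqrt : ((A : 𝓞 k) + B * S) * S = ((B * l : ℕ) : 𝓞 k) + A * S := by
  push_cast
  linear_combination (B : 𝓞 k) * h.sq_eq hS

theorem mul_mem {P : Ideal (𝓞 k)} (hP : Prime P) (hPS : P ≠ Ideal.span {S})
    (hD : (n : 𝓞 k) * ((A + B * S) * S) ∈ P) : (n : 𝓞 k) ∈ P := by
  have hP' := Ideal.isPrime_of_prime hP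
  rcases hP'.mem_or_mem hD with h1 | h1
  · exact h1
  exfalso
  rcases hP'.mem_or_mem h1 with h2 | h2
  · apply hP'.ne_top
    apply Ideal.eq_top_of_isUnit_mem _ h2
    have hAB := congrArg (Nat.cast : ℕ → 𝓞 k) h.norm_eq
    push_cast at hAB
    refine IsUnit.of_mul_eq_one (B * S - A) ?_
    linear_combination (B : 𝓞 k) ^ 2 * h.sq_eq hS - hAB
  · exact hPS ((h.isMaximal_span_sqrt hS).eq_of_le hP'.ne_top
      (by rwa [Ideal.span_singleton_le_iff_mem])).symm

include hK

theorem isTotallyReal_quadExt : IsTotallyReal K := by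
  have := h.isTotallyReal
  apply hK.isTotallyReal
  intro φ
  have hreal : starRingEnd ℂ (φ s) = φ s :=
    RingHom.congr_fun (IsTotallyReal.complexEmbedding_isReal φ) s
  rw [Complex.conj_eq_iff_re] at hreal
  have h1 : (φ s).re ^ 2 = l := by
    have : φ s ^ 2 = l := by rw [← map_pow, h.quad.sq, map_natCast, map_natCast]
    rw [← hreal] at this
    exact_mod_cast this
  have h2 : φ (((n : 𝓞 k) * ((A + B * S) * S) : 𝓞 k) : k) =
      ((n * (B * l + A * (φ s).re) : ℝ) : ℂ) := by
    rw [h.fundamental_mul_sqrt hS, val_mul, val_add, val_mul, val_natCast, val_natCast,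
      val_natCast, hS]
    push_cast
    simp only [map_mul, map_add, map_natCast]
    rw [hreal]
  rw [h2, Complex.ofReal_re]
  have h3 : (A : ℝ) ^ 2 + 1 = l * B ^ 2 := by exact_mod_cast h.norm_eq
  have h4 : (A * (φ s).re) ^ 2 ≤ (B * l : ℝ) ^ 2 := by
    rw [mul_pow, h1]
    have : (0 : ℝ) ≤ l := Nat.cast_nonneg l
    nlinarith
  have h5 := abs_le_of_sq_le_sq' h4 (by positivity)
  have : (0 : ℝ) ≤ n := Nat.cast_nonneg n
  exact mul_nonneg this (by linarith [h5.1])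

include hnl in
theorem card_mul_four_le {F : Finset (Ideal (𝓞 k))}
    (hF : ∀ P : Ideal (𝓞 k), Prime P → (n : 𝓞 k) ∈ P → P ∈ F)
    (hF2 : n % 4 = 1 ∨ ∀ P : Ideal (𝓞 k), Prime P → (2 : 𝓞 k) ∈ P → P ∈ F)
    {T : Finset (𝓞 k)} (hT : ∀ η, (η = 1 ∨ η = -1 ∨ η = A + B * S ∨ η = -(A + B * S)) →
      Represents ((n : 𝓞 k) * ((A + B * S) * S)) η → η ∈ T) :
    Nat.card {x : ClassGroup (𝓞 K) // x ^ 2 = 1} * 4 ≤ T.card * 2 ^ F.card := by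
  classical
  have := h.isTotallyReal_quadExt hS hK
  obtain ⟨φ⟩ := exists_ringHom_real K
  have hodd : Odd (multiplicity (Ideal.span {S})
      (Ideal.span {(n : 𝓞 k) * ((A + B * S) * S)})) := by
    rw [show (n : 𝓞 k) * ((A + B * S) * S) = S * (n * (A + B * S)) by ring]
    exact odd_multiplicity_span_mul (h.prime_sqrt hS)
      (h.not_sqrt_dvd_natCast_mul_fundamental hS hnl)
  have hbound := card_twoTorsion_mul_le hK rfl h.odd_card_classGroup hodd F
    (U := ({1, -1, (A : 𝓞 k) + B * S, -(A + B * S)} : Finset (𝓞 k)).image (fun x : 𝓞 k => (x : k)))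
    (T := T.image (fun x : 𝓞 k => (x : k)))
    (by
      intro P hP hPF hPS
      rcases hF2 with hn4 | hF2
      · obtain ⟨a, ha⟩ := h.four_dvd
        obtain ⟨m, hm⟩ : ∃ m : ℕ, n * (B * l) = 4 * m + 1 := by
          refine ⟨n * (B * l) / 4, ?_⟩
          have h1 := h.mod_four
          have h2 : l % 4 = 1 := by have := h.mod_eight; omega
          have : n * (B * l) % 4 = 1 := by simp [Nat.mul_mod, hn4, h1, h2]
          omega
        refine hK.exists_prime_not_sq_dvd_of_eq rfl (b := 1) (c := -(m + n * a * S)) ?_ hP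
          fun hD => hPF (hF P hP (h.mul_mem hS hP hPS hD))
        have hm' := congrArg (Nat.cast : ℕ → 𝓞 k) hm
        have ha' := congrArg (Nat.cast : ℕ → 𝓞 k) ha
        rw [h.fundamental_mul_sqrt hS]
        push_cast at hm' ha' ⊢
        linear_combination hm' + n * S * ha'
      · refine hK.exists_prime_not_sq_dvd_of_four_mul_not_mem rfl hP fun hD => ?_
        have hP' := Ideal.isPrime_of_prime hP
        rcases hP'.mem_or_mem hD with h4 | h4
        · rw [show (4 : 𝓞 k) = 2 * 2 by norm_num] at h4
          exact hPF (hF2 P hP ((hP'.mem_or_mem h4).elim id id))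
        · exact hPF (hF P hP (h.mul_mem hS hP hPS h4)))
    (by
      intro u
      obtain ⟨η, hη, ⟨w, hw, hu⟩, -⟩ := h.exists_unit_rep hS u
      exact ⟨η, Finset.mem_image_of_mem _ (by simpa only [Finset.mem_insert,
        Finset.mem_singleton] using hη), w, hw, hu⟩)
    (by
      rintro u ⟨x, y, hxy⟩
      obtain ⟨η, hη, ⟨w, hw, hu⟩, hrep⟩ := h.exists_unit_rep hS u
      have h1 := hrep _ 1 (by rw [one_mul]; exact represents_of_eq hxy)
      rw [one_mul] at h1
      exact ⟨η, Finset.mem_image_of_mem _ (hT η hη h1), w, hw, hu⟩)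
    (unitFamily K) (fun i j ⟨t, ht⟩ => unitFamily_injective φ i j ht)
  have hrank : Module.finrank ℚ K = 4 := by
    rw [← Module.finrank_mul_finrank ℚ k K, h.quad.finrank_eq, hK.finrank_eq]
  rw [card_unitFamily_index, hrank] at hbound
  have hU : (({1, -1, (A : 𝓞 k) + B * S, -(A + B * S)} : Finset (𝓞 k)).image
      (fun x : 𝓞 k => (x : k))).card ≤ 4 := Finset.card_image_le.trans Finset.card_le_four
  have hT' : (T.image (fun x : 𝓞 k => (x : k))).card ≤ T.card := Finset.card_image_le
  have := hbound.trans (Nat.mul_le_mul_right (2 ^ F.card) (Nat.mul_le_mul hT' hU))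
  nlinarith

end IsRealQuad

namespace IsRealQuad

variable {l A B : ℕ} {k : Type*} [Field k] [NumberField k] {s : k} (h : IsRealQuad l A B k s)
  {S : 𝓞 k} (hS : (S : k) = s) {K : Type*} [Field K] [NumberField K] [Algebra k K] {θ : K} {n : ℕ}
  (hK : IsQuadExt k K (((n : 𝓞 k) * ((A + B * S) * S) : 𝓞 k) : k) θ) (hn : Squarefree n)
  (hnl : n.Coprime l)

include h hS

omit h hS in
theorem mem_or_mem_of_mul {p q : ℕ} {P : Ideal (𝓞 k)} (hP : Prime P) (hmem : ((p * q : ℕ) :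
    𝓞 k) ∈ P) :
    (p : 𝓞 k) ∈ P ∨ (q : 𝓞 k) ∈ P := by
  rw [Nat.cast_mul] at hmem
  exact (Ideal.isPrime_of_prime hP).mem_or_mem hmem

include hn hnl in
theorem eq_one_or_of_mod_four_eq_three {q : ℕ} [Fact q.Prime] (hq4 : q % 4 = 3) (hqn : q ∣ n) {η :
    𝓞 k}
    (hη : η = 1 ∨ η = -1 ∨ η = A + B * S ∨ η = -(A + B * S))
    (hrep : Represents ((n : 𝓞 k) * ((A + B * S) * S)) η) : η = 1 ∨ η = -1 := by
  rcases h.norm_eq_one_or hS hη with ⟨h1, -⟩ | ⟨-, hN⟩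
  · exact h1
  · have hsq := h.isSquare_norm_of_represents hS (by omega) hn hqn hnl hrep
    rw [hN] at hsq
    push_cast at hsq
    exact absurd hq4 (ZMod.exists_sq_eq_neg_one_iff.1 hsq)

include hK

theorem card_le_one_of_eq_one (hn1 : n = 1) : Nat.card {x : ClassGroup (𝓞 K) // x ^ 2 = 1} ≤ 1 := by
  classical
  subst hn1
  have hb := h.card_mul_four_le hS hK (Nat.coprime_one_left l) (F := ∅)
    (fun P hP h1 => absurd ((Ideal.eq_top_iff_one P).2 (by simpa using h1))
      (Ideal.isPrime_of_prime hP).ne_top) (Or.inl rfl)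
    (T := {1, -1, (A : 𝓞 k) + B * S, -(A + B * S)})
    (fun η hη _ => by simpa only [Finset.mem_insert, Finset.mem_singleton] using hη)
  have hT : ({1, -1, (A : 𝓞 k) + B * S, -(A + B * S)} : Finset (𝓞 k)).card ≤ 4 :=
    Finset.card_le_four
  rw [Finset.card_empty] at hb
  omega

theorem card_le_two_of_not_isSquare {p : ℕ} [Fact p.Prime] (hp4 : p % 4 = 1) (hnp : n = p)
    (hpl : p ≠ l) (hl : ¬ IsSquare (l : ZMod p)) :
    Nat.card {x : ClassGroup (𝓞 K) // x ^ 2 = 1} ≤ 2 := by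
  classical
  subst hnp
  obtain ⟨F, hFc, hF⟩ := h.exists_finset_card_le_one hS (p := n) (by omega) hl
  have hb := h.card_mul_four_le hS hK ((Nat.coprime_primes Fact.out h.prime).2 hpl) hF (Or.inl hp4)
    (T := {1, -1, (A : 𝓞 k) + B * S, -(A + B * S)})
    (fun η hη _ => by simpa only [Finset.mem_insert, Finset.mem_singleton] using hη)
  have hT : ({1, -1, (A : 𝓞 k) + B * S, -(A + B * S)} : Finset (𝓞 k)).card ≤ 4 :=
    Finset.card_le_four
  have := Nat.mul_le_mul hT (Nat.pow_le_pow_right two_pos hFc)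
  omega

theorem card_le_two_of_not_isSquare_fundamental {p : ℕ} [Fact p.Prime] (hp4 : p % 4 = 1) (hnp :
    n = p)
    (hpl : p ≠ l) {s₀ : ZMod p} (hs₀ : s₀ ^ 2 = l) (hε : ¬ IsSquare (A + B * s₀)) :
    Nat.card {x : ClassGroup (𝓞 K) // x ^ 2 = 1} ≤ 2 := by
  classical
  subst hnp
  have hp : n.Prime := Fact.out
  have hnl := (Nat.coprime_primes hp h.prime).2 hpl
  have hs0 : s₀ ≠ 0 := by
    rintro rfl
    have : (l : ZMod n) = 0 := by simpa using hs₀.symm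
    rw [ZMod.natCast_eq_zero_iff] at this
    exact hp.one_lt.ne' (Nat.eq_one_of_dvd_coprimes hnl dvd_rfl this)
  obtain ⟨F, hFc, hF⟩ := Ideal.exists_finset_card_le (F := k) hp
  rw [h.quad.finrank_eq] at hFc
  obtain ⟨-, φ, hφ, -, hφS⟩ := h.exists_ringHom_padicInt_of_toZMod hS (by omega) hs₀ hs0
  have hφε : PadicInt.toZMod (φ (A + B * S)) = A + B * s₀ := by simp [hφS]
  have h1 : IsSquare (-1 : ZMod n) := ZMod.exists_sq_eq_neg_one_iff.2 (by omega)
  have hb := h.card_mul_four_le hS hK hnl hF (Or.inl hp4) (T := {1, -1}) (by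
    intro η hη hrep
    have hsq := h.isSquare_toZMod_of_represents hS hp.prime.squarefree dvd_rfl hnl hφ hrep
    rcases hη with rfl | rfl | rfl | rfl
    · simp
    · simp
    · rw [hφε] at hsq
      exact absurd hsq hε
    · rw [map_neg, map_neg, hφε] at hsq
      exact absurd (by simpa using h1.mul hsq) hε)
  have hT : ({1, -1} : Finset (𝓞 k)).card ≤ 2 := Finset.card_le_two
  have := Nat.mul_le_mul hT (Nat.pow_le_pow_right two_pos hFc)
  omega

theorem card_le_two_of_not_eight_dvd (hn2 : n = 2) (hA : ¬ 8 ∣ A) :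
    Nat.card {x : ClassGroup (𝓞 K) // x ^ 2 = 1} ≤ 2 := by
  classical
  subst hn2
  have hnl : Nat.Coprime 2 l := (Nat.coprime_primes Nat.prime_two h.prime).2 (by
    have := h.mod_eight; omega)
  obtain ⟨F, hFc, hF⟩ := Ideal.exists_finset_card_le (F := k) Nat.prime_two
  rw [h.quad.finrank_eq] at hFc
  obtain ⟨f, hf1, hf2, hf⟩ := h.exists_ringHom_zmod_eight hS
  have hA4 : (A : ZMod 8) = 4 := by
    have := h.four_dvd
    exact (ZMod.natCast_eq_natCast_iff A 4 8).2 (by rw [Nat.ModEq]; omega)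
  have hfD : f (((2 : ℕ) : 𝓞 k) * ((A + B * S) * S)) = 2 := by
    rw [map_mul, map_natCast]
    rcases hf2 with hf2 | hf2 <;> rw [hf2] <;> decide
  have key : ∀ a, Represents (((2 : ℕ) : 𝓞 k) * ((A + B * S) * S)) a → f a ≠ 3 ∧ f a ≠ 5 := by
    intro a ha
    obtain ⟨x, y, z, hxyz, heq⟩ := hf _ _ ha
    rw [hfD] at heq
    constructor <;> intro hfa <;> rw [hfa] at heq <;> revert hxyz heq <;> clear * - <;>
      revert x y z <;> decide
  rw [hA4] at hf1
  have hb := h.card_mul_four_le hS hK hnl hF (Or.inr (fun P hP h2 =>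
    hF P hP (by exact_mod_cast h2)))
    (T := {1, -1}) (by
    intro η hη hrep
    obtain ⟨h3, h5⟩ := key _ hrep
    rcases hη with rfl | rfl | rfl | rfl
    · simp
    · simp
    · exfalso
      rcases hf1 with hf1 | hf1
      · exact h5 (by rw [hf1]; decide)
      · exact h3 (by rw [hf1]; decide)
    · exfalso
      rw [map_neg] at h3 h5
      rcases hf1 with hf1 | hf1
      · exact h3 (by rw [hf1]; decide)
      · exact h5 (by rw [hf1]; decide))
  have hT : ({1, -1} : Finset (𝓞 k)).card ≤ 2 := Finset.card_le_two
  have := Nat.mul_le_mul hT (Nat.pow_le_pow_right two_pos hFc)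
  omega

include hn hnl

theorem card_le_two_of_eq_or_eq_two_mul {q : ℕ} [Fact q.Prime] (hq4 : q % 4 = 3)
    (hnq : n = q ∨ n = 2 * q) (hl : ¬ IsSquare (l : ZMod q)) :
    Nat.card {x : ClassGroup (𝓞 K) // x ^ 2 = 1} ≤ 2 := by
  classical
  have hqn : q ∣ n := by rcases hnq with h | h <;> simp [h]
  obtain ⟨F₁, hFc₁, hF₁⟩ := h.exists_finset_card_le_one hS (p := q) (by omega) hl
  obtain ⟨F₂, hFc₂, hF₂⟩ := Ideal.exists_finset_card_le (F := k) Nat.prime_two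
  rw [h.quad.finrank_eq] at hFc₂
  obtain ⟨f, hf⟩ := h.exists_ringHom_ne_neg_one hS hq4 hnq
  have hb := h.card_mul_four_le hS hK hnl (F := F₁ ∪ F₂) (by
      intro P hP hnP
      rw [Finset.mem_union]
      rcases hnq with rfl | rfl
      · exact Or.inl (hF₁ P hP hnP)
      · exact (mem_or_mem_of_mul hP hnP).symm.imp (hF₁ P hP) (hF₂ P hP))
    (Or.inr fun P hP h2 => Finset.mem_union_right _ (hF₂ P hP (by exact_mod_cast h2))) (T := {1})
    (by
      intro η hη hrep
      rcases h.eq_one_or_of_mod_four_eq_three hS hn hnl hq4 hqn hη hrep with rfl | rfl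
      · simp
      · exact absurd (by simp) (hf _ hrep))
  have hFc : (F₁ ∪ F₂).card ≤ 3 := (Finset.card_union_le _ _).trans (by omega)
  have := Nat.pow_le_pow_right two_pos hFc
  rw [Finset.card_singleton] at hb
  omega

theorem card_le_two_of_not_isSquare_of_not_isSquare {q₁ q₂ : ℕ} [Fact q₁.Prime] [Fact q₂.Prime]
    (hq₁4 : q₁ % 4 = 3) (hq₂4 : q₂ % 4 = 3) (hnq : n = q₁ * q₂) (hl₁ : ¬ IsSquare (l : ZMod q₁))
    (hl₂ : ¬ IsSquare (l : ZMod q₂)) :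
    Nat.card {x : ClassGroup (𝓞 K) // x ^ 2 = 1} ≤ 2 := by
  classical
  obtain ⟨F₁, hFc₁, hF₁⟩ := h.exists_finset_card_le_one hS (p := q₁) (by omega) hl₁
  obtain ⟨F₂, hFc₂, hF₂⟩ := h.exists_finset_card_le_one hS (p := q₂) (by omega) hl₂
  have hb := h.card_mul_four_le hS hK hnl (F := F₁ ∪ F₂) (by
      intro P hP hnP
      rw [Finset.mem_union]
      subst hnq
      exact (mem_or_mem_of_mul hP hnP).imp (hF₁ P hP) (hF₂ P hP))
    (Or.inl (by rw [hnq, Nat.mul_mod, hq₁4, hq₂4])) (T := {1, -1}) (by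
      intro η hη hrep
      rcases h.eq_one_or_of_mod_four_eq_three hS hn hnl hq₁4 (hnq ▸ dvd_mul_right q₁ q₂) hη hrep
        with
        rfl | rfl <;> simp)
  have hFc : (F₁ ∪ F₂).card ≤ 2 := (Finset.card_union_le _ _).trans (by omega)
  have hT : ({1, -1} : Finset (𝓞 k)).card ≤ 2 := Finset.card_le_two
  have := Nat.mul_le_mul hT (Nat.pow_le_pow_right two_pos hFc)
  omega

theorem card_le_two_of_not_isSquare_of_isSquare {q₁ q₂ : ℕ} [Fact q₁.Prime] [Fact q₂.Prime]
    (hq₁4 : q₁ % 4 = 3) (hq₂4 : q₂ % 4 = 3) (hnq : n = q₁ * q₂) (hl₁ : ¬ IsSquare (l : ZMod q₁))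
    (hl₂ : IsSquare (l : ZMod q₂)) :
    Nat.card {x : ClassGroup (𝓞 K) // x ^ 2 = 1} ≤ 2 := by
  classical
  have hq₂ : q₂.Prime := Fact.out
  have hqn₂ : q₂ ∣ n := hnq ▸ dvd_mul_left q₂ q₁
  obtain ⟨F₁, hFc₁, hF₁⟩ := h.exists_finset_card_le_one hS (p := q₁) (by omega) hl₁
  obtain ⟨F₂, hFc₂, hF₂⟩ := Ideal.exists_finset_card_le (F := k) hq₂
  rw [h.quad.finrank_eq] at hFc₂
  obtain ⟨s₀, hs₀⟩ := hl₂
  rw [← pow_two] at hs₀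
  have hs0 : s₀ ≠ 0 := by
    rintro rfl
    have : (l : ZMod q₂) = 0 := by simpa using hs₀
    rw [ZMod.natCast_eq_zero_iff] at this
    exact hq₂.one_lt.ne' (Nat.eq_one_of_dvd_coprimes hnl hqn₂ this)
  obtain ⟨-, φ, hφ, -, -⟩ := h.exists_ringHom_padicInt_of_toZMod hS (by omega) hs₀.symm hs0
  have hb := h.card_mul_four_le hS hK hnl (F := F₁ ∪ F₂) (by
      intro P hP hnP
      rw [Finset.mem_union]
      subst hnq
      exact (mem_or_mem_of_mul hP hnP).imp (hF₁ P hP) (hF₂ P hP))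
    (Or.inl (by rw [hnq, Nat.mul_mod, hq₁4, hq₂4])) (T := {1}) (by
      intro η hη hrep
      rcases h.eq_one_or_of_mod_four_eq_three hS hn hnl hq₂4 hqn₂ hη hrep with rfl | rfl
      · simp
      · exfalso
        have hsq := h.isSquare_toZMod_of_represents hS hn hqn₂ hnl hφ hrep
        simp only [map_neg, map_one] at hsq
        exact ZMod.exists_sq_eq_neg_one_iff.1 hsq hq₂4)
  have hFc : (F₁ ∪ F₂).card ≤ 3 := (Finset.card_union_le _ _).trans (by omega)
  have := Nat.pow_le_pow_right two_pos hFc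
  rw [Finset.card_singleton] at hb
  omega

end IsRealQuad

theorem legSym_eq_ite_isSquare {l p : ℕ} [Fact l.Prime] [Fact p.Prime] (hl8 : l % 8 = 1)
    (hp : p ≠ 2) (hpl : p ≠ l) : legSym l p = if IsSquare (l : ZMod p) then 1 else -1 := by
  have hp0 : (p : ZMod l) ≠ 0 := by
    rw [Ne, ZMod.natCast_eq_zero_iff, Nat.prime_dvd_prime_iff_eq Fact.out Fact.out]
    exact hpl.symm
  have h2 : (l - 1) / 2 = l / 2 := by omega
  have h := ZMod.exists_sq_eq_prime_iff_of_mod_four_eq_one (p := l) (q := p) (by omega) hp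
  simp only [legSym, h2, Int.cast_natCast, if_neg hp0, ← h, ← ZMod.euler_criterion l hp0]

theorem quartSym_ne_iff_not_isSquare {l p : ℕ} [Fact l.Prime] [Fact p.Prime] (hl8 : l % 8 = 1)
    (hp4 : p % 4 = 1) (hpl : p ≠ l) {A B : ℕ} (hAB : A ^ 2 + 1 = l * B ^ 2) (hB : Odd B)
    {s : ZMod p} (hs : s ^ 2 = l) :
    quartSym l p ≠ quartSym p l ↔ ¬IsSquare (A + B * s) := by
  have hs0 : s ≠ 0 := by
    rintro rfl
    rw [zero_pow two_ne_zero, eq_comm, ZMod.natCast_eq_zero_iff,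
      Nat.prime_dvd_prime_iff_eq Fact.out Fact.out] at hs
    exact hpl hs
  have hscholz := scholz_reciprocity (by omega) hp4 hpl (A := A) (B := B) (by exact_mod_cast hAB)
    (by exact_mod_cast hB) hs
  have hs' : (l : ZMod p) ^ ((p - 1) / 4) = 1 ↔ IsSquare s := by
    rw [ZMod.euler_criterion p hs0, ← hs, ← pow_mul,
      show 2 * ((p - 1) / 4) = p / 2 by omega]
  push_cast at hscholz
  simp only [quartSym, Int.cast_natCast, ← hscholz, hs']
  by_cases h₁ : IsSquare s
  · have : IsSquare ((A + B * s) * s) ↔ IsSquare (A + B * s) := by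
      refine ⟨fun h => ?_, fun h => h.mul h₁⟩
      simpa [hs0] using h.div h₁
    by_cases h₂ : IsSquare (A + B * s) <;> simp [this, h₁, h₂]
  · have : IsSquare ((A + B * s) * s) ↔ ¬IsSquare (A + B * s) := by
      refine ⟨fun h h' => h₁ ?_, fun h => isSquare_mul_of_not_isSquare h h₁⟩
      by_cases h0 : A + B * s = 0
      · have : ((A : ZMod p) ^ 2 + 1) = l * B ^ 2 := by
          exact_mod_cast congrArg (Nat.cast : ℕ → ZMod p) hAB
        exfalso
        refine one_ne_zero (α := ZMod p) ?_
        linear_combination this - (A - B * s) * h0 - B ^ 2 * hs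
      · simpa [h0] using h.div h'
    by_cases h₂ : IsSquare (A + B * s) <;> simp [this, h₁, h₂]

theorem quartSym_two_ne_iff {l : ℕ} [Fact l.Prime] (hl8 : l % 8 = 1) {A B : ℕ}
    (hAB : A ^ 2 + 1 = l * B ^ 2) (hA : 4 ∣ A) :
    quartSym l 2 ≠ (-1 : ℤ) ^ ((l - 1) / 8) ↔ ¬8 ∣ A := by
  have h := quartic_symbol_two hl8 (A := A) (B := B) (by exact_mod_cast hAB) hA
  have : Fact (2 < l) := ⟨by have := (Fact.out : l.Prime).two_le; omega⟩
  have hne : (-1 : ZMod l) ≠ 1 := ZMod.neg_one_ne_one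
  rw [quartSym]
  push_cast
  rcases Nat.even_or_odd ((l - 1) / 8) with he | he <;> by_cases h8 : 8 ∣ A <;>
    simp only [he.neg_one_pow, h8, if_true, if_false, mul_one, mul_neg_one, neg_eq_iff_eq_neg,
      neg_neg] at h ⊢ <;> simp [h, hne]

theorem Squarefree.exists_prime_dvd_ne {n m : ℕ} (hn : Squarefree n) (hm : m ∣ n) (hne : n ≠ m) :
    ∃ p, p.Prime ∧ p ∣ n ∧ ¬p ∣ m := by
  obtain ⟨c, rfl⟩ := hm
  obtain ⟨p, hp, hpc⟩ := Nat.exists_prime_and_dvd (n := c) (by rintro rfl; simp at hne)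
  refine ⟨p, hp, hpc.mul_left m, fun hpm => hp.not_isUnit (hn p (mul_dvd_mul hpm hpc))⟩

namespace IsRealQuad

variable {l A B : ℕ} {k : Type*} [Field k] [NumberField k] {s : k} (h : IsRealQuad l A B k s)
  {S : 𝓞 k} (hS : (S : k) = s) {K : Type*} [Field K] [NumberField K] [Algebra k K] {θ : K} {n : ℕ}
  (hK : IsQuadExt k K (((n : 𝓞 k) * ((A + B * S) * S) : 𝓞 k) : k) θ) (hn : Squarefree n)
  (hnl : n.Coprime l)

include h hS hK hn hnl

theorem exists_form_of_card_eq_two (hc : Nat.card {x : ClassGroup (𝓞 K) // x ^ 2 = 1} = 2) :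
    (∃ p : ℕ, p.Prime ∧ p % 4 = 1 ∧ n = p) ∨ n = 2 ∨
      (∃ q : ℕ, q.Prime ∧ q % 4 = 3 ∧ (n = q ∨ n = 2 * q)) ∨
      ∃ q₁ q₂ : ℕ, q₁.Prime ∧ q₂.Prime ∧ q₁ % 4 = 3 ∧ q₂ % 4 = 3 ∧ q₁ ≠ q₂ ∧ n = q₁ * q₂ := by
  have hn1 : n ≠ 1 := fun h1 => by
    have := h.card_le_one_of_eq_one hS hK h1
    omega
  by_cases hp : ∃ p : ℕ, p.Prime ∧ p % 4 = 1 ∧ p ∣ n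
  · obtain ⟨p, hp, hp4, hpn⟩ := hp
    refine Or.inl ⟨p, hp, hp4, by_contra fun hne => ?_⟩
    obtain ⟨p₁, hp₁, hpn₁, hp₁p⟩ := hn.exists_prime_dvd_ne hpn hne
    exact h.card_ne_two_of_mod_four_eq_one hS hK hn hnl hp hp4 hpn hp₁ hpn₁
      (by rintro rfl; exact hp₁p dvd_rfl) hc
  have hp' : ∀ p : ℕ, p.Prime → p ∣ n → p ≠ 2 → p % 4 = 3 := fun p hpp hpn hp2 => by
    have := hpp.eq_two_or_odd
    have : p % 4 ≠ 1 := fun h4 => hp ⟨p, hpp, h4, hpn⟩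
    omega
  by_cases hq : ∃ q : ℕ, q.Prime ∧ q ∣ n ∧ q ≠ 2
  · obtain ⟨q, hq, hqn, hq2⟩ := hq
    by_cases hq' : ∃ r : ℕ, r.Prime ∧ r ∣ n ∧ r ≠ 2 ∧ q ≠ r
    · obtain ⟨r, hr, hrn, hr2, hqr⟩ := hq'
      refine Or.inr (Or.inr (Or.inr ⟨q, r, hq, hr, hp' q hq hqn hq2, hp' r hr hrn hr2, hqr,
        by_contra fun hne => ?_⟩))
      obtain ⟨p₁, hp₁, hpn₁, hdvd⟩ := hn.exists_prime_dvd_ne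
        (((Nat.coprime_primes hq hr).2 hqr).mul_dvd_of_dvd_of_dvd hqn hrn) hne
      exact h.card_ne_two_of_mod_four_eq_three hS hK hn hnl hq hr (hp' q hq hqn hq2)
        (hp' r hr hrn hr2) hqn hrn hp₁ hpn₁ hqr
        (by rintro rfl; exact hdvd (dvd_mul_right _ _))
        (by rintro rfl; exact hdvd (dvd_mul_left _ _)) hc
    · refine Or.inr (Or.inr (Or.inl ⟨q, hq, hp' q hq hqn hq2, or_iff_not_imp_left.2 fun hne =>
        by_contra fun hne2 => ?_⟩))
      have key : ∀ r : ℕ, r.Prime → r ∣ n → ¬r ∣ q → r = 2 := fun r hr hrn hrq =>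
        by_contra fun hr2 => hq' ⟨r, hr, hrn, hr2, by rintro rfl; exact hrq dvd_rfl⟩
      obtain ⟨r, hr, hrn, hrq⟩ := hn.exists_prime_dvd_ne hqn hne
      obtain rfl := key r hr hrn hrq
      obtain ⟨r', hr', hrn', hrq'⟩ := hn.exists_prime_dvd_ne
        (((Nat.coprime_primes Nat.prime_two hq).2 hq2.symm).mul_dvd_of_dvd_of_dvd hrn hqn) hne2
      obtain rfl := key r' hr' hrn' fun hd => hrq' (hd.mul_left _)
      exact hrq' (dvd_mul_right _ _)
  · refine Or.inr (Or.inl (by_contra fun hne => ?_))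
    obtain ⟨r, hr, hrn⟩ := Nat.exists_prime_and_dvd hn1
    have hr2 : r = 2 := by_contra fun hr2 => hq ⟨r, hr, hrn, hr2⟩
    subst hr2
    obtain ⟨r, hr, hrn, hr2⟩ := hn.exists_prime_dvd_ne hrn hne
    exact hq ⟨r, hr, hrn, by rintro rfl; exact hr2 dvd_rfl⟩

theorem card_twoTorsion_classGroup_eq_two_iff :
    Nat.card {x : ClassGroup (𝓞 K) // x ^ 2 = 1} = 2 ↔
      ((∃ p : ℕ, p.Prime ∧ p % 4 = 1 ∧ p ≠ l ∧ n = p ∧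
          (legSym l p = -1 ∨ (legSym l p = 1 ∧ quartSym l p ≠ quartSym p l))) ∨
        (n = 2 ∧ quartSym l 2 ≠ (-1 : ℤ) ^ ((l - 1) / 8)) ∨
        (∃ δ q : ℕ, (δ = 1 ∨ δ = 2) ∧ q.Prime ∧ q % 4 = 3 ∧ q ≠ l ∧ n = δ * q ∧
          legSym l q = -1) ∨
        (∃ q₁ q₂ : ℕ, q₁.Prime ∧ q₂.Prime ∧ q₁ % 4 = 3 ∧ q₂ % 4 = 3 ∧
          q₁ ≠ l ∧ q₂ ≠ l ∧ q₁ ≠ q₂ ∧ n = q₁ * q₂ ∧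
          (legSym l q₁ = -1 ∨ legSym l q₂ = -1))) := by
  have hl8 := h.mod_eight
  have : Fact l.Prime := ⟨h.prime⟩
  have hB : Odd B := Nat.odd_iff.2 (by have := h.mod_four; omega)
  have hpl : ∀ p : ℕ, p.Prime → p ∣ n → p ≠ l := by
    rintro p hp hpn rfl
    exact hp.ne_one (Nat.eq_one_of_dvd_coprimes hnl hpn dvd_rfl)
  have hleg : ∀ p : ℕ, p.Prime → p ≠ 2 → p ≠ l → (legSym l p = -1 ↔ ¬IsSquare (l : ZMod p)) := by
    intro p hp hp2 hpl
    have : Fact p.Prime := ⟨hp⟩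
    rw [legSym_eq_ite_isSquare hl8 hp2 hpl]
    split_ifs with hsq <;> simp [hsq]
  have hleg' : ∀ p : ℕ, p.Prime → p ≠ 2 → p ≠ l → (legSym l p = 1 ↔ IsSquare (l : ZMod p)) := by
    intro p hp hp2 hpl
    have : Fact p.Prime := ⟨hp⟩
    rw [legSym_eq_ite_isSquare hl8 hp2 hpl]
    split_ifs with hsq <;> simp [hsq]
  constructor
  · intro hc
    rcases h.exists_form_of_card_eq_two hS hK hn hnl hc with ⟨p, hp, hp4, rfl⟩ | hn2 |
      ⟨q, hq, hq4, hnq⟩ | ⟨q₁, q₂, hq₁, hq₂, hq₁4, hq₂4, hne, hnq⟩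
    · have hp2 : n ≠ 2 := by omega
      have hpl := hpl n hp dvd_rfl
      have : Fact n.Prime := ⟨hp⟩
      refine Or.inl ⟨n, hp, hp4, hpl, rfl, ?_⟩
      rw [hleg n hp hp2 hpl, hleg' n hp hp2 hpl]
      refine or_iff_not_imp_left.2 fun hsq => ?_
      rw [not_not] at hsq
      obtain ⟨s₀, hs₀⟩ := isSquare_iff_exists_sq _ |>.1 hsq
      refine ⟨hsq, (quartSym_ne_iff_not_isSquare hl8 hp4 hpl h.norm_eq hB hs₀.symm).2 fun hε => ?_⟩
      exact h.card_ne_two_of_isSquare hS hK hn hnl hp4 dvd_rfl hs₀.symm hε hc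
    · refine Or.inr (Or.inl ⟨hn2, ?_⟩)
      rw [quartSym_two_ne_iff hl8 h.norm_eq h.four_dvd]
      exact fun h8 => h.card_ne_two_of_eight_dvd hS hK hn2 h8 hc
    · have hqn : q ∣ n := by rcases hnq with rfl | rfl <;> simp
      have hql := hpl q hq hqn
      have : Fact q.Prime := ⟨hq⟩
      have hsq : legSym l q = -1 := by
        rw [hleg q hq (by omega) hql]
        exact fun hsq => h.card_ne_two_of_eq_or_eq_two_mul hS hK hn hnl hq4 hnq hsq hc
      rcases hnq with hnq | hnq
      · exact Or.inr (Or.inr (Or.inl ⟨1, q, Or.inl rfl, hq, hq4, hql, by rw [hnq, one_mul], hsq⟩))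
      · exact Or.inr (Or.inr (Or.inl ⟨2, q, Or.inr rfl, hq, hq4, hql, hnq, hsq⟩))
    · have hqn₁ : q₁ ∣ n := hnq ▸ dvd_mul_right _ _
      have hqn₂ : q₂ ∣ n := hnq ▸ dvd_mul_left _ _
      have hql₁ := hpl q₁ hq₁ hqn₁
      have hql₂ := hpl q₂ hq₂ hqn₂
      have : Fact q₁.Prime := ⟨hq₁⟩
      have : Fact q₂.Prime := ⟨hq₂⟩
      refine Or.inr (Or.inr (Or.inr ⟨q₁, q₂, hq₁, hq₂, hq₁4, hq₂4, hql₁, hql₂, hne, hnq, ?_⟩))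
      rw [hleg q₁ hq₁ (by omega) hql₁, hleg q₂ hq₂ (by omega) hql₂, ← not_and_or]
      exact fun hsq => h.card_ne_two_of_isSquare_of_isSquare hS hK hn hnl hq₁4 hq₂4 hne hqn₁ hqn₂
        hsq.1 hsq.2 hc
  · have two_of_le : n ≠ 1 → Nat.card {x : ClassGroup (𝓞 K) // x ^ 2 = 1} ≤ 2 →
        Nat.card {x : ClassGroup (𝓞 K) // x ^ 2 = 1} = 2 := fun hn1 hle => by
      have h1 := h.card_twoTorsion_classGroup_ne_one hS hK hn hnl hn1
      have : Nonempty {x : ClassGroup (𝓞 K) // x ^ 2 = 1} := ⟨⟨1, one_pow 2⟩⟩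
      have h0 : 0 < Nat.card {x : ClassGroup (𝓞 K) // x ^ 2 = 1} := Nat.card_pos
      omega
    rintro (⟨p, hp, hp4, hpl, hnp, hsym⟩ | ⟨hn2, hsym⟩ | ⟨δ, q, hδ, hq, hq4, hql, hnq, hsym⟩ |
      ⟨q₁, q₂, hq₁, hq₂, hq₁4, hq₂4, hql₁, hql₂, hne, hnq, hsym⟩)
    · have : Fact p.Prime := ⟨hp⟩
      refine two_of_le (hnp ▸ hp.ne_one) ?_
      rw [hleg p hp (by omega) hpl, hleg' p hp (by omega) hpl] at hsym
      rcases hsym with hsym | ⟨hsq, hsym⟩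
      · exact h.card_le_two_of_not_isSquare hS hK hp4 hnp hpl hsym
      · obtain ⟨s₀, hs₀⟩ := isSquare_iff_exists_sq _ |>.1 hsq
        exact h.card_le_two_of_not_isSquare_fundamental hS hK hp4 hnp hpl hs₀.symm
          ((quartSym_ne_iff_not_isSquare hl8 hp4 hpl h.norm_eq hB hs₀.symm).1 hsym)
    · exact two_of_le (by omega) (h.card_le_two_of_not_eight_dvd hS hK hn2
        ((quartSym_two_ne_iff hl8 h.norm_eq h.four_dvd).1 hsym))
    · have : Fact q.Prime := ⟨hq⟩
      refine two_of_le ?_ (h.card_le_two_of_eq_or_eq_two_mul hS hK hn hnl hq4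
        (hδ.imp (fun h1 => by rw [hnq, h1, one_mul]) fun h2 => by rw [hnq, h2])
        ((hleg q hq (by omega) hql).1 hsym))
      have := hq.one_lt
      rcases hδ with rfl | rfl <;> omega
    · have : Fact q₁.Prime := ⟨hq₁⟩
      have : Fact q₂.Prime := ⟨hq₂⟩
      rw [hleg q₁ hq₁ (by omega) hql₁, hleg q₂ hq₂ (by omega) hql₂] at hsym
      refine two_of_le (by rw [hnq, Ne, mul_eq_one]; exact fun h1 => hq₁.ne_one h1.1) ?_
      by_cases hl₁ : IsSquare (l : ZMod q₁)
      · exact h.card_le_two_of_not_isSquare_of_isSquare hS hK hn hnl hq₂4 hq₁4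
          (by rw [hnq, mul_comm]) (hsym.resolve_left (not_not.2 hl₁)) hl₁
      by_cases hl₂ : IsSquare (l : ZMod q₂)
      · exact h.card_le_two_of_not_isSquare_of_isSquare hS hK hn hnl hq₁4 hq₂4 hnq hl₁ hl₂
      · exact h.card_le_two_of_not_isSquare_of_not_isSquare hS hK hn hnl hq₁4 hq₂4 hnq hl₁ hl₂

end IsRealQuad

theorem IsRealQuad.not_isSquare_radicand {l A B : ℕ} {k : Type*} [Field k] [NumberField k] {s : k}
    (h : IsRealQuad l A B k s) {n : ℕ} (hn : n ≠ 0) :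
    ¬IsSquare ((n : k) * ((A + B * s) * s)) := by
  rintro ⟨z, hz⟩
  obtain ⟨S, rfl⟩ := h.exists_coe_eq
  have h1 : Algebra.norm ℚ ((n : k) * ((A + B * (S : k)) * S)) = l * n ^ 2 := by
    have := congrArg (Int.cast : ℤ → ℚ)
      (show Algebra.norm ℤ ((n : 𝓞 k) * ((A + B * S) * S)) = l * n ^ 2 by
      rw [map_mul, map_mul, h.norm_natCast, h.norm_fundamental rfl, h.norm_sqrt rfl]; ring)
    rw [Algebra.coe_norm_int] at this
    exact_mod_cast this
  rw [hz, map_mul] at h1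
  have hn' : (n : ℚ) ≠ 0 := Nat.cast_ne_zero.2 hn
  have h2 : IsSquare (l : ℚ) :=
    ⟨Algebra.norm ℚ z / n, by rw [div_mul_div_comm, h1, ← sq]; field_simp⟩
  rw [Rat.isSquare_natCast_iff] at h2
  exact h.prime.prime.not_isSquare h2

theorem IntermediateField.exists_eq_add_mul_of_mem_adjoin {K L : Type*} [Field K] [Field L]
    [Algebra K L] (F : IntermediateField K L) {t : L} (ht : IsIntegral K t) (ht2 : t ^ 2 ∈ F)
    {z : L} (hz : z ∈ adjoin K {t}) : ∃ x ∈ F, ∃ y ∈ F, z = x + y * t := by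
  rw [← mem_toSubalgebra, adjoin_simple_toSubalgebra_of_isAlgebraic ht.isAlgebraic] at hz
  induction hz using Algebra.adjoin_induction with
  | mem x hx => exact ⟨0, F.zero_mem, 1, F.one_mem, by rw [Set.mem_singleton_iff.1 hx]; ring⟩
  | algebraMap r => exact ⟨_, F.algebraMap_mem r, 0, F.zero_mem, by ring⟩
  | add x y _ _ hx hy =>
    obtain ⟨a, ha, b, hb, rfl⟩ := hx
    obtain ⟨c, hc, d, hd, rfl⟩ := hy
    exact ⟨_, F.add_mem ha hc, _, F.add_mem hb hd, by ring⟩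
  | mul x y _ _ hx hy =>
    obtain ⟨a, ha, b, hb, rfl⟩ := hx
    obtain ⟨c, hc, d, hd, rfl⟩ := hy
    exact ⟨_, F.add_mem (F.mul_mem ha hc) (F.mul_mem (F.mul_mem hb hd) ht2), _,
      F.add_mem (F.mul_mem ha hd) (F.mul_mem hb hc), by ring⟩

/-- `l ≡ 1 (mod 8)` prime, `n` squarefree positive coprime to `l`.
The 2-class group `H` of `𝕂 = ℚ(√(n·ε₀·√l))` is nontrivial cyclic (`r₂(H) = 1`,
i.e. the 2-torsion of the class group has exactly 2 elements) iff `n` has one of the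
listed forms (with `p ≡ 1 (mod 4)`, `q, q₁, q₂ ≡ 3 (mod 4)` primes coprime to `l`,
`δ ∈ {1,2}`). -/
theorem stmt_13 (l : ℕ) (hl : l.Prime) (hl8 : l % 8 = 1)
    (ε₀ : ℝ) (hε : IsFundamentalUnit l ε₀)
    (hεnorm : ∃ u v : ℚ, ε₀ = (u : ℝ) + (v : ℝ) * Real.sqrt (l : ℝ) ∧
      (u : ℝ) ^ 2 - (v : ℝ) ^ 2 * (l : ℝ) = -1)
    (n : ℕ) (hn0 : 0 < n) (hnsq : Squarefree n) (hnl : n.Coprime l)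
    (K : IntermediateField ℚ ℝ)
    (hK : K = IntermediateField.adjoin ℚ
      ({Real.sqrt ((n : ℝ) * ε₀ * Real.sqrt (l : ℝ))} : Set ℝ))
    [NumberField K] :
    twoTorsCard K = 2 ^ 1 ↔
      ((∃ p : ℕ, p.Prime ∧ p % 4 = 1 ∧ p ≠ l ∧ n = p ∧
          (legSym l p = -1 ∨ (legSym l p = 1 ∧ quartSym l p ≠ quartSym p l))) ∨
        (n = 2 ∧ quartSym l 2 ≠ (-1 : ℤ) ^ ((l - 1) / 8)) ∨
        (∃ δ q : ℕ, (δ = 1 ∨ δ = 2) ∧ q.Prime ∧ q % 4 = 3 ∧ q ≠ l ∧ n = δ * q ∧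
          legSym l q = -1) ∨
        (∃ q₁ q₂ : ℕ, q₁.Prime ∧ q₂.Prime ∧ q₁ % 4 = 3 ∧ q₂ % 4 = 3 ∧
          q₁ ≠ l ∧ q₂ ≠ l ∧ q₁ ≠ q₂ ∧ n = q₁ * q₂ ∧
          (legSym l q₁ = -1 ∨ legSym l q₂ = -1))) := by
  obtain ⟨A, B, hAB, hnorm, hA4, hB4, hA⟩ := hε.exists_eq hl hl8 hεnorm
  have hr := hε.isRealQuad hl hl8 hAB hnorm hA4 hB4
  set k := IntermediateField.adjoin ℚ ({√(l : ℝ)} : Set ℝ) with hk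
  set s : k := ⟨√(l : ℝ), IntermediateField.mem_adjoin_simple_self ℚ _⟩ with hs
  set t := √((n : ℝ) * ε₀ * √(l : ℝ)) with ht
  have hsl : √(l : ℝ) ^ 2 = l := Real.sq_sqrt (Nat.cast_nonneg l)
  have hε1 : 1 < ε₀ := hε.1
  have ht2 : t ^ 2 = n * ((A + B * √(l : ℝ)) * √(l : ℝ)) := by
    rw [ht, Real.sq_sqrt (by positivity), hAB, mul_assoc]
  have htK : t ∈ K := hK ▸ IntermediateField.mem_adjoin_simple_self ℚ t
  have htint : IsIntegral ℚ t := by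
    have : FiniteDimensional ℚ K := by convert NumberField.to_finiteDimensional (K := K)
    exact (IsIntegral.of_finite ℚ (⟨t, htK⟩ : K)).map K.val
  have hle : k ≤ K := by
    rw [hk, IntermediateField.adjoin_simple_le_iff]
    have hn' : (n : ℝ) ≠ 0 := by positivity
    have hA' : (A : ℝ) ≠ 0 := by positivity
    have : √(l : ℝ) = (t ^ 2 / n - B * l) / A := by
      rw [ht2]
      field_simp
      linear_combination -B * hsl
    rw [this]
    exact div_mem (sub_mem (div_mem (pow_mem htK 2) (natCast_mem K n))
      (mul_mem (natCast_mem K B) (natCast_mem K l))) (natCast_mem K A)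
  have : NumberField k :=
    { to_charZero := inferInstance
      to_finiteDimensional := by
        have hintg : IsIntegral ℚ √(l : ℝ) := .of_pow two_pos <| by
          rw [hsl, ← map_natCast (algebraMap ℚ ℝ)]
          exact isIntegral_algebraMap
        have : FiniteDimensional ℚ k := IntermediateField.adjoin.finiteDimensional hintg
        convert this }
  have h : IsRealQuad l A B k s := by convert hr
  let : Algebra k K := (IntermediateField.inclusion hle).toAlgebra
  obtain ⟨S, hS⟩ := h.exists_coe_eq
  have hd : (((n : 𝓞 k) * ((A + B * S) * S) : 𝓞 k) : k) = n * ((A + B * s) * s) := by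
    rw [← hS]; simp
  have hmap : ∀ x : k, ((algebraMap k K x : K) : ℝ) = x := fun x => rfl
  have hquad : IsQuadExt k K (((n : 𝓞 k) * ((A + B * S) * S) : 𝓞 k) : k) ⟨t, htK⟩ := by
    rw [hd]
    refine ⟨Subtype.ext ?_, fun z => ?_, h.not_isSquare_radicand hn0.ne'⟩
    · rw [hmap]
      simpa [hs] using ht2
    · have ht2k : t ^ 2 ∈ k := by
        rw [ht2]
        exact (n * ((A + B * s) * s) : k).2
      obtain ⟨x, hx, y, hy, hxy⟩ := k.exists_eq_add_mul_of_mem_adjoin htint ht2k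
        (show (z : ℝ) ∈ _ from hK ▸ z.2)
      exact ⟨⟨x, hx⟩, ⟨y, hy⟩, Subtype.ext hxy⟩
  rw [twoTorsCard, pow_one]
  exact h.card_twoTorsion_classGroup_eq_two_iff hS hquad hnsq hnl
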